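/- Let Ω = (x₀,x₁) ⊂ ℝ be a bounded open interval and T > 0. Let a : ℝ × ℝ × [x₀,x₁] × [0,T] → ℝ be positive and locally Hölder continuous: there is α ∈ (0,1) such that for every bounded subset K of its domain there is C_K > 0 with |a(z) − a(z')| ≤ C_K·|z − z'|^α for all z, z' ∈ K. Suppose there are A, P > 0 with a(p,q,x,t)·p² ≥ A whenever |p| ≥ P. Let 𝒫 = ([x₀,x₁] × {0}) ∪ ({x₀,x₁} × [0,T]) be the parabolic boundary and let u₀ : 𝒫 → ℝ be continuous. Then there exists u : [x₀,x₁] × [0,T] → ℝ, continuous, whose partial derivatives u_t, u_x, u_{xx} exist and are continuous on Ω × (0,T), satisfying u_t = a(u_x,u,x,t)·u_{xx} on Ω × (0,T) and u = u₀ on 𝒫. -/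

import Mathlib

open Filter Topology

/-- The centred second difference of a function on the integers. -/
def lap (f : ℤ → ℝ) (i : ℤ) : ℝ := f (i + 1) - 2 * f i + f (i - 1)

/-- The explicit finite difference scheme for `u_t = a u_xx` at the grid point `(n, i)`, in units
where the mesh size is one and the time step is `lam`. -/
def SchemeAt (lam : ℝ) (a u : ℕ → ℤ → ℝ) (n : ℕ) (i : ℤ) : Prop :=
  u (n + 1) i = u n i + lam * a n i * lap (u n) i

/-- Discrete maximum principle for functions of two grid variables. -/
theorem grid_max_principle {B : ℤ → ℤ → Prop} {Z : ℕ → ℤ → ℤ → ℝ} {N : ℕ}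
    (h0 : ∀ i j, B i j → Z 0 i j ≤ 0)
    (hs : ∀ n < N, ∀ i j, B i j → Z (n + 1) i j ≤ 0 ∨
      (B (i + 1) j ∧ B (i - 1) j ∧ B i (j + 1) ∧ B i (j - 1) ∧
        ∃ p q : ℝ, 0 ≤ p ∧ 0 ≤ q ∧ p + q ≤ 1 / 2 ∧
          Z (n + 1) i j ≤ Z n i j + p * lap (fun k => Z n k j) i + q * lap (fun k => Z n i k) j)) :
    ∀ n ≤ N, ∀ i j, B i j → Z n i j ≤ 0 := by
  intro n
  induction n with
  | zero => intro _ i j hb; exact h0 i j hb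
  | succ n ih =>
    intro hn i j hb
    have ih' := ih (by omega)
    rcases hs n (by omega) i j hb with h | ⟨h1, h2, h3, h4, p, q, hp, hq, hpq, h⟩
    · exact h
    · have e0 := ih' _ _ hb
      have e1 := ih' _ _ h1
      have e2 := ih' _ _ h2
      have e3 := ih' _ _ h3
      have e4 := ih' _ _ h4
      simp only [lap] at h
      have : Z n i j + p * (Z n (i + 1) j - 2 * Z n i j + Z n (i - 1) j)
          + q * (Z n i (j + 1) - 2 * Z n i j + Z n i (j - 1))
          = (1 - 2 * p - 2 * q) * Z n i j + p * Z n (i + 1) j + p * Z n (i - 1) j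
            + q * Z n i (j + 1) + q * Z n i (j - 1) := by ring
      rw [this] at h
      have f0 : (1 - 2 * p - 2 * q) * Z n i j ≤ 0 :=
        mul_nonpos_of_nonneg_of_nonpos (by linarith) e0
      have f1 := mul_nonpos_of_nonneg_of_nonpos hp e1
      have f2 := mul_nonpos_of_nonneg_of_nonpos hp e2
      have f3 := mul_nonpos_of_nonneg_of_nonpos hq e3
      have f4 := mul_nonpos_of_nonneg_of_nonpos hq e4
      linarith

/-- One-sided form of `grid_gradient`. -/
theorem grid_gradient_upper {u a : ℕ → ℤ → ℝ} {R N : ℕ} {lam c M : ℝ} (hR : 1 ≤ R)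
    (hlam : 0 < lam) (hc : 0 < c) (hN : (R : ℝ) ^ 2 ≤ lam * N)
    (hM : ∀ n ≤ N, ∀ i : ℤ, |i| ≤ R → |u n i| ≤ M)
    (ha : ∀ n < N, ∀ i : ℤ, |i| < R → c ≤ a n i ∧ lam * a n i ≤ 1 / 8)
    (hs : ∀ n < N, ∀ i : ℤ, |i| < R → SchemeAt lam a u n i) :
    u N 1 - u N 0 ≤ (4 + 1 / c) * M / R := by
  have hM0 : 0 ≤ M := (abs_nonneg _).trans (hM 0 (by omega) 0 (by simp))
  have hR' : (1 : ℝ) ≤ R := by exact_mod_cast hR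
  have hRpos : (0 : ℝ) < R := by linarith
  set K : ℝ := 2 + 1 / (2 * c) with hK
  set m : ℝ := M / R ^ 2 with hm
  have hm0 : 0 ≤ m := by positivity
  have hmR : m * R ^ 2 = M := by rw [hm]; field_simp
  have hK2 : 2 ≤ K := by rw [hK]; have : 0 < 1 / (2 * c) := by positivity
                         linarith
  have hKc : 2 * c * (K - 2) = 1 := by rw [hK]; field_simp; ring
  have key := grid_max_principle (N := N) (B := fun i j => -(R : ℤ) ≤ j ∧ j ≤ i ∧ i ≤ R)
    (Z := fun n i j => u n i - u n j - m * (K * ((i - j) * (2 * R - (i - j)))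
      + 2 * ((i : ℝ) ^ 2 + (j : ℝ) ^ 2) + 2 * (lam * ((N : ℝ) - n)))) ?_ ?_ N le_rfl 1 0
      ⟨by omega, by omega, by omega⟩
  · simp only [sub_self, mul_zero, add_zero] at key
    push_cast at key
    have h1 : m * (K * ((1 - 0) * (2 * R - (1 - 0))) + 2 * ((1:ℝ) ^ 2 + 0 ^ 2))
        ≤ (4 + 1 / c) * M / R := by
      have : (4 + 1 / c) * M / R = m * (2 * K * R) := by
        rw [hm, hK]; field_simp; ring
      rw [this]
      apply mul_le_mul_of_nonneg_left _ hm0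
      nlinarith
    linarith
  · rintro i j ⟨h1, h2, h3⟩
    have hi := abs_le.1 (hM 0 (by omega) i (abs_le.2 ⟨by omega, h3⟩))
    have hj := abs_le.1 (hM 0 (by omega) j (abs_le.2 ⟨h1, by omega⟩))
    have r1 : -(R : ℝ) ≤ j := by exact_mod_cast h1
    have r2 : (j : ℝ) ≤ i := by exact_mod_cast h2
    have r3 : (i : ℝ) ≤ R := by exact_mod_cast h3
    have e1 : 0 ≤ K * (((i : ℝ) - j) * (2 * R - (i - j))) :=
      mul_nonneg (by linarith) (mul_nonneg (by linarith) (by linarith))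
    have : 2 * M ≤ m * (K * (((i : ℝ) - j) * (2 * R - (i - j)))
      + 2 * ((i : ℝ) ^ 2 + (j : ℝ) ^ 2) + 2 * (lam * ((N : ℝ) - (0 : ℕ)))) := by
      rw [← hmR]
      have : 2 * (m * (R : ℝ) ^ 2) = m * (2 * R ^ 2) := by ring
      rw [this]
      apply mul_le_mul_of_nonneg_left _ hm0
      push_cast
      nlinarith [sq_nonneg (i : ℝ), sq_nonneg (j : ℝ)]
    linarith
  · rintro n hn i j ⟨h1, h2, h3⟩
    have r1 : -(R : ℝ) ≤ j := by exact_mod_cast h1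
    have r2 : (j : ℝ) ≤ i := by exact_mod_cast h2
    have r3 : (i : ℝ) ≤ R := by exact_mod_cast h3
    have hnN : ((n + 1 : ℕ) : ℝ) ≤ N := by exact_mod_cast hn
    have e1 : 0 ≤ K * (((i : ℝ) - j) * (2 * R - (i - j))) :=
      mul_nonneg (by linarith) (mul_nonneg (by linarith) (by linarith))
    have e2 : 0 ≤ lam * ((N : ℝ) - (n + 1 : ℕ)) := mul_nonneg hlam.le (by linarith)
    by_cases hb : i = j ∨ i = R ∨ j = -R
    · left
      have hi := abs_le.1 (hM (n + 1) (by omega) i (abs_le.2 ⟨by omega, h3⟩))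
      have hj := abs_le.1 (hM (n + 1) (by omega) j (abs_le.2 ⟨h1, by omega⟩))
      rcases hb with hb | hb
      · subst hb
        have : 0 ≤ m * (K * (((i : ℝ) - i) * (2 * R - (i - i)))
          + 2 * ((i : ℝ) ^ 2 + (i : ℝ) ^ 2) + 2 * (lam * ((N : ℝ) - (n + 1 : ℕ)))) := by
          apply mul_nonneg hm0
          nlinarith [sq_nonneg (i : ℝ)]
        linarith
      · have hsq : (R : ℝ) ^ 2 ≤ (i : ℝ) ^ 2 + (j : ℝ) ^ 2 := by
          rcases hb with hb | hb
          · subst hb; push_cast; nlinarith [sq_nonneg (j : ℝ)]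
          · subst hb; push_cast; nlinarith [sq_nonneg (i : ℝ)]
        have : 2 * M ≤ m * (K * (((i : ℝ) - j) * (2 * R - (i - j)))
          + 2 * ((i : ℝ) ^ 2 + (j : ℝ) ^ 2) + 2 * (lam * ((N : ℝ) - (n + 1 : ℕ)))) := by
          rw [← hmR]
          have : 2 * (m * (R : ℝ) ^ 2) = m * (2 * R ^ 2) := by ring
          rw [this]
          apply mul_le_mul_of_nonneg_left _ hm0
          linarith
        linarith
    · push Not at hb
      obtain ⟨hb1, hb2, hb3⟩ := hb
      right
      refine ⟨⟨by omega, by omega, by omega⟩, ⟨by omega, by omega, by omega⟩,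
        ⟨by omega, by omega, by omega⟩, ⟨by omega, by omega, by omega⟩, ?_⟩
      have hiR : |i| < R := abs_lt.2 ⟨by omega, by omega⟩
      have hjR : |j| < R := abs_lt.2 ⟨by omega, by omega⟩
      obtain ⟨ci, li⟩ := ha n hn i hiR
      obtain ⟨cj, lj⟩ := ha n hn j hjR
      refine ⟨lam * a n i, lam * a n j, by nlinarith, by nlinarith, by linarith, ?_⟩
      have si := hs n hn i hiR
      have sj := hs n hn j hjR
      simp only [SchemeAt, lap] at si sj ⊢
      rw [si, sj]
      push_cast
      have hfin : 0 ≤ m * lam * ((a n i - c) + (a n j - c)) * (K - 2) :=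
        mul_nonneg (mul_nonneg (mul_nonneg hm0 hlam.le) (by linarith)) (by linarith)
      have h2 : m * lam * (2 * c * (K - 2)) = m * lam := by rw [hKc]; ring
      nlinarith

/-- Interior gradient estimate for the difference scheme, with a constant depending only on the
lower bound of the coefficient. -/
theorem grid_gradient {u a : ℕ → ℤ → ℝ} {R N : ℕ} {lam c M : ℝ} (hR : 1 ≤ R)
    (hlam : 0 < lam) (hc : 0 < c) (hN : (R : ℝ) ^ 2 ≤ lam * N)
    (hM : ∀ n ≤ N, ∀ i : ℤ, |i| ≤ R → |u n i| ≤ M)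
    (ha : ∀ n < N, ∀ i : ℤ, |i| < R → c ≤ a n i ∧ lam * a n i ≤ 1 / 8)
    (hs : ∀ n < N, ∀ i : ℤ, |i| < R → SchemeAt lam a u n i) :
    |u N 1 - u N 0| ≤ (4 + 1 / c) * M / R := by
  rw [abs_le]
  refine ⟨?_, grid_gradient_upper hR hlam hc hN hM ha hs⟩
  have := grid_gradient_upper (u := fun n i => -u n i) (a := a) hR hlam hc hN
    (fun n hn i hi => by simpa using hM n hn i hi) ha (fun n hn i hi => by
      have := hs n hn i hi
      simp only [SchemeAt, lap] at this ⊢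
      rw [this]; ring)
  linarith

/-- A function on an integer interval with increments in `[0, ω]`. -/
theorem increments_between {f : ℤ → ℝ} {L : ℤ} {ω : ℝ}
    (h : ∀ i, -L ≤ i → i < L → 0 ≤ f (i + 1) - f i ∧ f (i + 1) - f i ≤ ω) {i j : ℤ}
    (hj : -L ≤ j) (hji : j ≤ i) (hi : i ≤ L) : 0 ≤ f i - f j ∧ f i - f j ≤ ω * (i - j) := by
  induction i, hji using Int.leInduction with
  | base => simp
  | succ i hji ih =>
    have h1 := ih (by omega)
    have h2 := h i (by omega) (by omega)
    push_cast
    constructor <;> linarith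

set_option maxHeartbeats 1000000 in
/-- Persistence of a large increase for monotone solutions of the difference scheme. -/
theorem grid_persistence {V a : ℕ → ℤ → ℝ} {R e N : ℕ} {lam c C ω : ℝ} (hR : 1 ≤ R) (he : 1 ≤ e)
    (hlam : 0 < lam) (hc : 0 < c) (heC : 2 * C ≤ e) (hN : lam * N ≤ R ^ 2) (hω : 0 ≤ ω)
    (hinc : ∀ n ≤ N, ∀ i : ℤ, -((10 + 3 * e) * R : ℕ) ≤ i → i < ((10 + 3 * e) * R : ℕ) →
      0 ≤ V n (i + 1) - V n i ∧ V n (i + 1) - V n i ≤ ω)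
    (ha : ∀ n < N, ∀ i : ℤ, |i| < ((10 + 3 * e) * R : ℕ) →
      c ≤ a n i ∧ a n i ≤ C ∧ lam * a n i ≤ 1 / 8)
    (hs : ∀ n < N, ∀ i : ℤ, |i| < ((10 + 3 * e) * R : ℕ) → SchemeAt lam a V n i)
    (h0 : ω * R ≤ V 0 R - V 0 (-R)) :
    ∀ n ≤ N, ∀ i j : ℤ, -((10 + 3 * e) * R : ℕ) ≤ j → j ≤ -((1 + e) * R : ℕ) →
      ((1 + e) * R : ℕ) ≤ i → i ≤ ((10 + 3 * e) * R : ℕ) → ω * R / 2 ≤ V n i - V n j := by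
  set L : ℤ := (((10 + 3 * e) * R : ℕ) : ℤ) with hL
  set s : ℤ := (((1 + e) * R : ℕ) : ℤ) with hsdef
  have hRr : (1 : ℝ) ≤ R := by exact_mod_cast hR
  have her : (1 : ℝ) ≤ e := by exact_mod_cast he
  have hE : (0 : ℝ) < e * R := by positivity
  have hLr : (L : ℝ) = (10 + 3 * e) * R := by rw [hL]; push_cast; ring
  have hsr : (s : ℝ) = (1 + e) * R := by rw [hsdef]; push_cast; ring
  have hRL : (R : ℤ) < L := by rw [hL]; push_cast; nlinarith
  have hsL : s < L := by rw [hL, hsdef]; push_cast; nlinarith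
  have hRs : (R : ℤ) ≤ s := by rw [hsdef]; push_cast; nlinarith
  set b : ℝ := ω / (4 * (e * R)) with hb
  have hb0 : 0 ≤ b := by positivity
  have hbE : b * (4 * (e * R)) = ω := by rw [hb]; field_simp
  have key := grid_max_principle (N := N) (B := fun i j => -L ≤ j ∧ j ≤ i ∧ i ≤ L)
    (Z := fun n i j => ω * R - b * (((i : ℝ) - s) ^ 2 + ((j : ℝ) + s) ^ 2)
      - 4 * b * C * (lam * n) - (V n i - V n j)) ?_ ?_
  · intro n hn i j h1 h2 h3 h4
    have k1 := key n hn s (-s) ⟨by omega, by omega, by omega⟩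
    have i1 := increments_between (hinc n hn) (i := i) (j := s) (by omega) h3 h4
    have i2 := increments_between (hinc n hn) (i := -s) (j := j) h1 h2 (by omega)
    push_cast at k1
    have hnN : lam * n ≤ R ^ 2 :=
      (mul_le_mul_of_nonneg_left (by exact_mod_cast hn) hlam.le).trans hN
    have : 4 * b * C * (lam * n) ≤ ω * R / 2 := by
      have hl0 : 0 ≤ lam * n := by positivity
      have e1 : 4 * b * C * (lam * n) ≤ 4 * b * (e / 2) * (lam * n) := by
        gcongr; linarith
      have e2 : 4 * b * (e / 2) * (lam * n) ≤ 4 * b * (e / 2) * R ^ 2 := by gcongr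
      rw [← hbE]
      linarith
    nlinarith
  · rintro i j ⟨h1, h2, h3⟩
    have hi0 := hinc 0 (by omega)
    have aux : ∀ x : ℝ, ω * x ≤ b * (x + e * R) ^ 2 := by
      intro x
      rw [← hbE]
      nlinarith [mul_nonneg hb0 (sq_nonneg (x - e * R))]
    have p1 : V 0 R - ω * 0 ≤ V 0 i ∨ V 0 R - ω * (R - i) ≤ V 0 i := by
      rcases le_total (R : ℤ) i with h | h
      · left; have := increments_between hi0 (i := i) (j := R) (by omega) h h3; linarith
      · right; have := increments_between hi0 (i := R) (j := i) (by omega) h (by omega)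
        push_cast at this; linarith
    have p2 : V 0 j ≤ V 0 (-R) + ω * 0 ∨ V 0 j ≤ V 0 (-R) + ω * (j + R) := by
      rcases le_total j (-R : ℤ) with h | h
      · left; have := increments_between hi0 (i := -R) (j := j) (by omega) h (by omega); linarith
      · right; have := increments_between hi0 (i := j) (j := -R) (by omega) h (by omega)
        push_cast at this; linarith
    have q1 : V 0 R - b * ((i : ℝ) - s) ^ 2 ≤ V 0 i := by
      rcases p1 with h | h
      · nlinarith [mul_nonneg hb0 (sq_nonneg ((i : ℝ) - s))]
      · have := aux (R - i)
        rw [hsr]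
        nlinarith
    have q2 : V 0 j ≤ V 0 (-R) + b * ((j : ℝ) + s) ^ 2 := by
      rcases p2 with h | h
      · nlinarith [mul_nonneg hb0 (sq_nonneg ((j : ℝ) + s))]
      · have := aux (j + R)
        rw [hsr]
        nlinarith
    push_cast
    linarith
  · rintro n hn i j ⟨h1, h2, h3⟩
    by_cases hbd : i = j ∨ i = L ∨ j = -L
    · left
      have hW := (increments_between (hinc (n + 1) (by omega)) h1 h2 h3).1
      have hbig : 4 * (e * R) * R ≤ ((i : ℝ) - s) ^ 2 + ((j : ℝ) + s) ^ 2 := by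
        rcases hbd with h | h | h
        · subst h
          have : ((i : ℝ) - s) ^ 2 + ((i : ℝ) + s) ^ 2 = 2 * (i : ℝ) ^ 2 + 2 * (s : ℝ) ^ 2 := by ring
          rw [this, hsr]
          nlinarith [sq_nonneg (i : ℝ), mul_nonneg (sq_nonneg ((e : ℝ) - 1)) (sq_nonneg (R : ℝ))]
        · rw [h, hLr, hsr]
          have : ((10 + 3 * e) * (R : ℝ) - (1 + e) * R) ^ 2 = (9 + 2 * e) ^ 2 * R ^ 2 := by ring
          rw [this]
          have : 4 * (e * (R : ℝ)) * R ≤ (9 + 2 * e) ^ 2 * R ^ 2 := by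
            have : 4 * (e * (R : ℝ)) * R = (4 * e) * R ^ 2 := by ring
            rw [this]
            gcongr
            nlinarith
          nlinarith [sq_nonneg ((j : ℝ) + (1 + e) * R)]
        · rw [h]
          push_cast
          rw [hLr, hsr]
          have : (-((10 + 3 * e) * (R : ℝ)) + (1 + e) * R) ^ 2 = (9 + 2 * e) ^ 2 * R ^ 2 := by ring
          rw [this]
          have : 4 * (e * (R : ℝ)) * R ≤ (9 + 2 * e) ^ 2 * R ^ 2 := by
            have : 4 * (e * (R : ℝ)) * R = (4 * e) * R ^ 2 := by ring
            rw [this]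
            gcongr
            nlinarith
          nlinarith [sq_nonneg ((i : ℝ) - (1 + e) * R)]
      have hC0 : 0 ≤ C := by
        have := ha n hn 0 (by simp; omega)
        linarith
      have : b * (4 * (e * R) * R) ≤ b * (((i : ℝ) - s) ^ 2 + ((j : ℝ) + s) ^ 2) := by gcongr
      have h5 : 0 ≤ 4 * b * C * (lam * ((n + 1 : ℕ) : ℝ)) := by positivity
      have h6 : b * (4 * (e * R) * R) = ω * R := by rw [← hbE]; ring
      linarith
    · push Not at hbd
      obtain ⟨hb1, hb2, hb3⟩ := hbd
      right
      refine ⟨⟨by omega, by omega, by omega⟩, ⟨by omega, by omega, by omega⟩,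
        ⟨by omega, by omega, by omega⟩, ⟨by omega, by omega, by omega⟩, ?_⟩
      have hiR : |i| < L := abs_lt.2 ⟨by omega, by omega⟩
      have hjR : |j| < L := abs_lt.2 ⟨by omega, by omega⟩
      obtain ⟨ci, Ci, li⟩ := ha n hn i hiR
      obtain ⟨cj, Cj, lj⟩ := ha n hn j hjR
      refine ⟨lam * a n i, lam * a n j, mul_nonneg hlam.le (hc.le.trans ci),
        mul_nonneg hlam.le (hc.le.trans cj), by linarith, ?_⟩
      have si := hs n hn i hiR
      have sj := hs n hn j hjR
      simp only [SchemeAt, lap] at si sj ⊢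
      rw [si, sj]
      push_cast
      have hfin : 0 ≤ b * lam * ((C - a n i) + (C - a n j)) :=
        mul_nonneg (mul_nonneg hb0 hlam.le) (by linarith)
      nlinarith

theorem one_add_sq_div_two_le_cosh (x : ℝ) : 1 + x ^ 2 / 2 ≤ Real.cosh x := by
  have h1 : Real.cosh x = 1 + 2 * Real.sinh (x / 2) ^ 2 := by
    have := Real.cosh_two_mul (x / 2)
    rw [mul_div_cancel₀ x two_ne_zero, Real.cosh_sq] at this
    linarith
  have h2 : (x / 2) ^ 2 ≤ Real.sinh (x / 2) ^ 2 := by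
    rcases le_total 0 (x / 2) with h | h
    · exact pow_le_pow_left₀ h (Real.self_le_sinh_iff.2 h) 2
    · have := Real.sinh_le_self_iff.2 h
      nlinarith
  rw [h1]; linarith

/-- Lower bound for the second difference of a Gaussian. -/
theorem gaussian_second_difference {γ : ℝ} (h1 : γ ≤ 1 / 2) (y : ℝ) :
    Real.exp (-γ * y ^ 2) * (2 * γ ^ 2 * y ^ 2 - 2 * γ) ≤
      Real.exp (-γ * (y + 1) ^ 2) - 2 * Real.exp (-γ * y ^ 2) + Real.exp (-γ * (y - 1) ^ 2) := by
  have e1 : Real.exp (-γ * (y + 1) ^ 2)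
      = Real.exp (-γ * y ^ 2) * (Real.exp (-γ) * Real.exp (-(2 * γ * y))) := by
    rw [← Real.exp_add, ← Real.exp_add]; congr 1; ring
  have e2 : Real.exp (-γ * (y - 1) ^ 2)
      = Real.exp (-γ * y ^ 2) * (Real.exp (-γ) * Real.exp (2 * γ * y)) := by
    rw [← Real.exp_add, ← Real.exp_add]; congr 1; ring
  rw [e1, e2]
  have h2 : 1 - γ ≤ Real.exp (-γ) := by linarith [Real.add_one_le_exp (-γ)]
  have h3 : 2 + (2 * γ * y) ^ 2 ≤ Real.exp (-(2 * γ * y)) + Real.exp (2 * γ * y) := by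
    have := one_add_sq_div_two_le_cosh (2 * γ * y)
    rw [Real.cosh_eq] at this
    linarith
  have h4 : (1 - γ) * (2 + (2 * γ * y) ^ 2)
      ≤ Real.exp (-γ) * (Real.exp (-(2 * γ * y)) + Real.exp (2 * γ * y)) := by
    apply mul_le_mul h2 h3 (by positivity) (Real.exp_pos _).le
  have h5 : 2 * γ ^ 2 * y ^ 2 - 2 * γ
      ≤ Real.exp (-γ) * (Real.exp (-(2 * γ * y)) + Real.exp (2 * γ * y)) - 2 := by
    nlinarith [mul_nonneg (by linarith : 0 ≤ 1 / 2 - γ) (sq_nonneg (γ * y))]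
  have := mul_le_mul_of_nonneg_left h5 (Real.exp_pos (-γ * y ^ 2)).le
  linarith

set_option maxHeartbeats 1000000 in
/-- A monotone solution of the difference scheme which increases by a fixed proportion of the
maximal possible amount has, at later times, increments bounded below. -/
theorem grid_increment_lower {V a : ℕ → ℤ → ℝ} {R e N : ℕ} {lam c C ω g : ℝ} (he : 1 ≤ e)
    (hlam : 0 < lam) (hc : 0 < c) (heC : 2 * C ≤ e) (hN : lam * N ≤ R ^ 2) (hω : 0 ≤ ω)
    (hg2 : 2 ≤ g) (hgC : 4 * C ≤ g * c) (hge : 8 * (3 + e) ^ 2 ≤ g * c) (hgR : g ≤ R)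
    (hinc : ∀ n ≤ N, ∀ i : ℤ, -((10 + 3 * e) * R : ℕ) ≤ i → i < ((10 + 3 * e) * R : ℕ) →
      0 ≤ V n (i + 1) - V n i ∧ V n (i + 1) - V n i ≤ ω)
    (ha : ∀ n < N, ∀ i : ℤ, |i| < ((10 + 3 * e) * R : ℕ) →
      c ≤ a n i ∧ a n i ≤ C ∧ lam * a n i ≤ 1 / 8)
    (hs : ∀ n < N, ∀ i : ℤ, |i| < ((10 + 3 * e) * R : ℕ) → SchemeAt lam a V n i)
    (h0 : ω * R ≤ V 0 R - V 0 (-R)) {k : ℤ} (hk : |k| ≤ R) (hNt : (R : ℝ) ^ 2 ≤ 2 * (lam * N)) :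
    g * (3 + e) / 2 * Real.exp (-(2 * g * (3 + e) ^ 2)) * ω ≤ V N (k + 1) - V N k := by
  have hRr : (2 : ℝ) ≤ R := by linarith
  have hR : 2 ≤ R := by exact_mod_cast hRr
  have pers := grid_persistence (by omega) he hlam hc heC hN hω hinc ha hs h0
  set L : ℤ := (((10 + 3 * e) * R : ℕ) : ℤ) with hL
  set s : ℤ := (((1 + e) * R : ℕ) : ℤ) with hsdef
  set I : ℤ := (((3 + e) * R : ℕ) : ℤ) with hI
  have her : (1 : ℝ) ≤ e := by exact_mod_cast he
  have hIr : (I : ℝ) = (3 + e) * R := by rw [hI]; push_cast; ring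
  have hLI : L = 3 * I + R := by rw [hL, hI]; push_cast; ring
  have hsI : I = s + 2 * R := by rw [hsdef, hI]; push_cast; ring
  have hI2 : 2 ≤ I := by rw [hI]; push_cast; nlinarith
  have hs0 : 0 ≤ s := by rw [hsdef]; positivity
  obtain ⟨hk1, hk2⟩ := abs_le.1 hk
  have hk1r : -(R : ℝ) ≤ k := by exact_mod_cast hk1
  have hk2r : (k : ℝ) ≤ R := by exact_mod_cast hk2
  set γ : ℝ := g / R ^ 2 with hγ
  have hγ0 : 0 < γ := by positivity
  have hγR : γ * R ^ 2 = g := by rw [hγ]; field_simp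
  have hγhalf : γ ≤ 1 / 2 := by
    rw [hγ, div_le_iff₀ (by positivity)]
    nlinarith
  set β : ℝ := γ ^ 2 * c * R ^ 2 / 2 with hβ
  have hβ0 : 0 ≤ β := by positivity
  set ρ2 : ℝ := 2 * (I : ℝ) ^ 2 with hρ2
  set κ : ℝ := ω * R / 2 with hκ
  have hκ0 : 0 ≤ κ := by positivity
  have key := grid_max_principle (N := N) (B := fun i j => -L ≤ j ∧ j ≤ i ∧ i ≤ L)
    (Z := fun n i j => κ * (Real.exp (-β * (lam * ((N : ℝ) - n)))
      * (Real.exp (-γ * ((i : ℝ) - I - k) ^ 2) * Real.exp (-γ * ((j : ℝ) - k + I) ^ 2))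
      - Real.exp (-γ * ρ2)) - (V n i - V n j)) ?_ ?_ N le_rfl (k + 1) k
      ⟨by omega, by omega, by omega⟩
  · push_cast at key
    simp only [sub_self, mul_zero, Real.exp_zero, one_mul] at key
    have e1 : Real.exp (-γ * ((k : ℝ) + 1 - I - k) ^ 2) * Real.exp (-γ * (0 + (I : ℝ)) ^ 2)
        = Real.exp (-γ * ρ2) * Real.exp (γ * (2 * I - 1)) := by
      rw [← Real.exp_add, ← Real.exp_add]; congr 1; rw [hρ2]; ring
    rw [e1] at key
    have e2 : γ * I ≤ Real.exp (γ * (2 * I - 1)) - 1 := by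
      have := Real.add_one_le_exp (γ * (2 * (I : ℝ) - 1))
      have hI2r : (2 : ℝ) ≤ I := by exact_mod_cast hI2
      nlinarith
    have e3 : Real.exp (-γ * ρ2) = Real.exp (-(2 * g * (3 + e) ^ 2)) := by
      congr 1
      rw [hρ2, hIr, ← hγR]; ring
    have e4 : g * (3 + e) / 2 * ω = κ * (γ * I) := by
      rw [hκ, hIr, ← hγR]; ring
    rw [e3] at key
    have e5 := mul_le_mul_of_nonneg_left e2
      (mul_nonneg hκ0 (Real.exp_pos (-(2 * g * (3 + e) ^ 2))).le)
    have e6 : g * (3 + e) / 2 * Real.exp (-(2 * g * (3 + e) ^ 2)) * ω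
        = κ * Real.exp (-(2 * g * (3 + e) ^ 2)) * (γ * I) := by
      linear_combination Real.exp (-(2 * g * (3 + e) ^ 2)) * e4
    linarith
  · rintro i j ⟨h1, h2, h3⟩
    have hW := (increments_between (hinc 0 (by omega)) h1 h2 h3).1
    have : Real.exp (-β * (lam * ((N : ℝ) - (0 : ℕ))))
      * (Real.exp (-γ * ((i : ℝ) - I - k) ^ 2) * Real.exp (-γ * ((j : ℝ) - k + I) ^ 2))
      ≤ Real.exp (-γ * ρ2) := by
      rw [← Real.exp_add, ← Real.exp_add, Real.exp_le_exp]
      have q1 : γ * ρ2 ≤ β * (lam * N) := by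
        have : γ * ρ2 ≤ β * (R ^ 2 / 2) := by
          rw [hρ2, hIr, hβ]
          have : γ ^ 2 * c * R ^ 2 / 2 * (R ^ 2 / 2) = γ * ((γ * R ^ 2) * c / 4) * R ^ 2 := by ring
          rw [this, hγR]
          have : γ * (2 * ((3 + e) * (R : ℝ)) ^ 2) = γ * (2 * (3 + e) ^ 2) * R ^ 2 := by ring
          rw [this]
          gcongr
          linarith
        refine this.trans ?_
        gcongr
        linarith
      have q2 := mul_nonneg hγ0.le (sq_nonneg ((i : ℝ) - I - k))
      have q3 := mul_nonneg hγ0.le (sq_nonneg ((j : ℝ) - k + I))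
      push_cast
      linarith
    have := mul_nonpos_of_nonneg_of_nonpos hκ0 (sub_nonpos.2 this)
    linarith
  · rintro n hn i j ⟨h1, h2, h3⟩
    have hn1 : ((n : ℝ) + 1) ≤ N := by exact_mod_cast hn
    have hW := (increments_between (hinc (n + 1) (by omega)) h1 h2 h3).1
    by_cases hbig : ρ2 ≤ ((i : ℝ) - I - k) ^ 2 + ((j : ℝ) - k + I) ^ 2
    · left
      have : Real.exp (-β * (lam * ((N : ℝ) - (n + 1 : ℕ))))
        * (Real.exp (-γ * ((i : ℝ) - I - k) ^ 2) * Real.exp (-γ * ((j : ℝ) - k + I) ^ 2))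
        ≤ Real.exp (-γ * ρ2) := by
        rw [← Real.exp_add, ← Real.exp_add, Real.exp_le_exp]
        have q1 : 0 ≤ β * (lam * ((N : ℝ) - (n + 1 : ℕ))) := by
          apply mul_nonneg hβ0 (mul_nonneg hlam.le _)
          push_cast; linarith
        have q2 := mul_le_mul_of_nonneg_left hbig hγ0.le
        linarith
      have := mul_nonpos_of_nonneg_of_nonpos hκ0 (sub_nonpos.2 this)
      linarith
    by_cases hsmall : ((i : ℝ) - I - k) ^ 2 + ((j : ℝ) - k + I) ^ 2 ≤ R ^ 2
    · left
      have hi : |(i : ℝ) - I - k| ≤ R := abs_le_of_sq_le_sq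
        (by linarith [sq_nonneg ((j : ℝ) - k + I)]) (by positivity)
      have hj : |(j : ℝ) - k + I| ≤ R := abs_le_of_sq_le_sq
        (by linarith [sq_nonneg ((i : ℝ) - I - k)]) (by positivity)
      have hi' : -(R : ℤ) ≤ i - I - k := by exact_mod_cast (abs_le.1 hi).1
      have hj' : j - k + I ≤ R := by exact_mod_cast (abs_le.1 hj).2
      have hp := pers (n + 1) (by omega) i j h1 (by omega) (by omega) h3
      have : Real.exp (-β * (lam * ((N : ℝ) - (n + 1 : ℕ))))
        * (Real.exp (-γ * ((i : ℝ) - I - k) ^ 2) * Real.exp (-γ * ((j : ℝ) - k + I) ^ 2))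
        ≤ 1 := by
        rw [← Real.exp_add, ← Real.exp_add, Real.exp_le_one_iff]
        have q1 : 0 ≤ β * (lam * ((N : ℝ) - (n + 1 : ℕ))) := by
          apply mul_nonneg hβ0 (mul_nonneg hlam.le _)
          push_cast; linarith
        have q2 := mul_nonneg hγ0.le (sq_nonneg ((i : ℝ) - I - k))
        have q3 := mul_nonneg hγ0.le (sq_nonneg ((j : ℝ) - k + I))
        linarith
      have : κ * (Real.exp (-β * (lam * ((N : ℝ) - (n + 1 : ℕ))))
        * (Real.exp (-γ * ((i : ℝ) - I - k) ^ 2) * Real.exp (-γ * ((j : ℝ) - k + I) ^ 2))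
        - Real.exp (-γ * ρ2)) ≤ κ * 1 := by
        apply mul_le_mul_of_nonneg_left _ hκ0
        linarith [Real.exp_pos (-γ * ρ2)]
      linarith
    push Not at hbig hsmall
    have hij : i ≠ j := by
      rintro rfl
      have : ((i : ℝ) - I - k) ^ 2 + ((i : ℝ) - k + I) ^ 2
        = 2 * ((i : ℝ) - k) ^ 2 + 2 * (I : ℝ) ^ 2 := by ring
      linarith [sq_nonneg ((i : ℝ) - k)]
    have hI2r : (2 : ℝ) ≤ I := by exact_mod_cast hI2
    have hiL : i ≠ L := by
      rintro rfl
      have : (L : ℝ) = 3 * I + R := by exact_mod_cast hLI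
      have h5 : (2 * (I : ℝ)) ^ 2 ≤ ((L : ℝ) - I - k) ^ 2 :=
        pow_le_pow_left₀ (by linarith) (by linarith) 2
      linarith [sq_nonneg ((j : ℝ) - k + I), sq_nonneg (I : ℝ)]
    have hjL : j ≠ -L := by
      rintro rfl
      have : (L : ℝ) = 3 * I + R := by exact_mod_cast hLI
      have h5 : (2 * (I : ℝ)) ^ 2 ≤ (-(((-L : ℤ) : ℝ) - k + I)) ^ 2 :=
        pow_le_pow_left₀ (by linarith) (by push_cast; linarith) 2
      rw [neg_sq] at h5
      linarith [sq_nonneg ((i : ℝ) - I - k), sq_nonneg (I : ℝ)]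
    right
    refine ⟨⟨by omega, by omega, by omega⟩, ⟨by omega, by omega, by omega⟩,
      ⟨by omega, by omega, by omega⟩, ⟨by omega, by omega, by omega⟩, ?_⟩
    have hiR : |i| < L := abs_lt.2 ⟨by omega, by omega⟩
    have hjR : |j| < L := abs_lt.2 ⟨by omega, by omega⟩
    obtain ⟨ci, Ci, li⟩ := ha n hn i hiR
    obtain ⟨cj, Cj, lj⟩ := ha n hn j hjR
    have hai : 0 ≤ lam * a n i := mul_nonneg hlam.le (hc.le.trans ci)
    have haj : 0 ≤ lam * a n j := mul_nonneg hlam.le (hc.le.trans cj)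
    refine ⟨lam * a n i, lam * a n j, hai, haj, by linarith, ?_⟩
    have si := hs n hn i hiR
    have sj := hs n hn j hjR
    have gi := gaussian_second_difference hγhalf ((i : ℝ) - I - k)
    have gj := gaussian_second_difference hγhalf ((j : ℝ) - k + I)
    have hexp : Real.exp (-β * (lam * ((N : ℝ) - (n + 1 : ℕ))))
        = Real.exp (β * lam) * Real.exp (-β * (lam * ((N : ℝ) - n))) := by
      rw [← Real.exp_add]; congr 1; push_cast; ring
    have hβlam : β * lam ≤ 1 := by
      have h7 : c * lam ≤ 1 / 8 := by
        have := mul_le_mul_of_nonneg_left ci hlam.le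
        linarith
      have h8 : γ * R ≤ 1 := by
        have : (γ * R) * R ≤ 1 * R := by
          calc (γ * R) * R = g := by rw [← hγR]; ring
            _ ≤ 1 * R := by linarith
        exact le_of_mul_le_mul_right this (by linarith)
      have h9 : 0 ≤ γ * R := by positivity
      have : β * lam = (γ * R) ^ 2 * (c * lam) / 2 := by rw [hβ]; ring
      rw [this]
      have h10 : (γ * R) ^ 2 ≤ 1 := pow_le_one₀ h9 h8
      have h11 : 0 ≤ c * lam := by positivity
      have := mul_le_mul h10 h7 h11 zero_le_one
      linarith
    have hexp1 : Real.exp (β * lam) ≤ 1 + 2 * (β * lam) := by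
      have h := Real.abs_exp_sub_one_le (x := β * lam)
        (by rw [abs_of_nonneg (by positivity)]; exact hβlam)
      rw [abs_of_nonneg (by positivity : 0 ≤ β * lam)] at h
      linarith [le_abs_self (Real.exp (β * lam) - 1)]
    have si1 : (((i + 1 : ℤ) : ℝ) - I - k) = ((i : ℝ) - I - k) + 1 := by push_cast; ring
    have si2 : (((i - 1 : ℤ) : ℝ) - I - k) = ((i : ℝ) - I - k) - 1 := by push_cast; ring
    have sj1 : (((j + 1 : ℤ) : ℝ) - k + I) = ((j : ℝ) - k + I) + 1 := by push_cast; ring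
    have sj2 : (((j - 1 : ℤ) : ℝ) - k + I) = ((j : ℝ) - k + I) - 1 := by push_cast; ring
    simp only [SchemeAt, lap] at si sj ⊢
    rw [si, sj, hexp, si1, si2, sj1, sj2]
    generalize (i : ℝ) - I - k = y at *
    generalize (j : ℝ) - k + I = z at *
    have hF0 := Real.exp_pos (-β * (lam * ((N : ℝ) - n)))
    generalize Real.exp (-β * (lam * ((N : ℝ) - n))) = F at *
    have hy0 := Real.exp_pos (-γ * y ^ 2)
    have hz0 := Real.exp_pos (-γ * z ^ 2)
    generalize Real.exp (-γ * y ^ 2) = Y at *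
    generalize Real.exp (-γ * z ^ 2) = Z at *
    generalize Real.exp (-γ * (y + 1) ^ 2) = Y1 at *
    generalize Real.exp (-γ * (y - 1) ^ 2) = Y2 at *
    generalize Real.exp (-γ * (z + 1) ^ 2) = Z1 at *
    generalize Real.exp (-γ * (z - 1) ^ 2) = Z2 at *
    generalize Real.exp (-γ * ρ2) = ex at *
    generalize Real.exp (β * lam) = b1 at *
    have m1 : lam * a n i * (Z * (Y * (2 * γ ^ 2 * y ^ 2 - 2 * γ)))
        ≤ lam * a n i * (Z * (Y1 - 2 * Y + Y2)) := by gcongr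
    have m2 : lam * a n j * (Y * (Z * (2 * γ ^ 2 * z ^ 2 - 2 * γ)))
        ≤ lam * a n j * (Y * (Z1 - 2 * Z + Z2)) := by gcongr
    have m3 : 2 * (β * lam) ≤ lam * a n i * (2 * γ ^ 2 * y ^ 2 - 2 * γ)
        + lam * a n j * (2 * γ ^ 2 * z ^ 2 - 2 * γ) := by
      have r1 : 0 ≤ lam * (a n i - c) * (2 * γ ^ 2 * y ^ 2) := by
        have := sub_nonneg.2 ci
        positivity
      have r2 : 0 ≤ lam * (a n j - c) * (2 * γ ^ 2 * z ^ 2) := by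
        have := sub_nonneg.2 cj
        positivity
      have r3 : lam * a n i * (2 * γ) ≤ lam * C * (2 * γ) := by gcongr
      have r4 : lam * a n j * (2 * γ) ≤ lam * C * (2 * γ) := by gcongr
      have r5 : lam * γ ^ 2 * c * R ^ 2 ≤ lam * γ ^ 2 * c * (y ^ 2 + z ^ 2) := by gcongr
      have r6 : lam * γ * (4 * C) ≤ lam * γ * (g * c) := by gcongr
      rw [← hγR] at r6
      have r7 : 2 * (β * lam) = lam * γ ^ 2 * c * R ^ 2 := by rw [hβ]; ring
      have r8 : lam * γ * (γ * R ^ 2 * c) = lam * γ ^ 2 * c * R ^ 2 := by ring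
      linarith
    have m4 : (Y * Z) * b1 ≤ Y * Z + lam * a n i * (Z * (Y1 - 2 * Y + Y2))
        + lam * a n j * (Y * (Z1 - 2 * Z + Z2)) := by
      have n1 : (Y * Z) * b1 ≤ (Y * Z) * (1 + 2 * (β * lam)) := by gcongr
      have n2 := mul_le_mul_of_nonneg_left m3 (mul_pos hy0 hz0).le
      linarith
    have m5 := mul_le_mul_of_nonneg_left m4 (mul_nonneg hκ0 hF0.le)
    linarith

/-- Decay of the oscillation of the increments of a solution of the difference scheme. -/
theorem grid_increment_osc {u a : ℕ → ℤ → ℝ} {R e N : ℕ} {lam c C m ω g : ℝ} (he : 1 ≤ e)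
    (hlam : 0 < lam) (hc : 0 < c) (heC : 2 * C ≤ e) (hN : lam * N ≤ R ^ 2) (hω : 0 ≤ ω)
    (hg2 : 2 ≤ g) (hgC : 4 * C ≤ g * c) (hge : 8 * (3 + e) ^ 2 ≤ g * c) (hgR : g ≤ R)
    (hinc : ∀ n ≤ N, ∀ i : ℤ, |i| ≤ ((10 + 3 * e) * R : ℕ) →
      m ≤ u n (i + 1) - u n i ∧ u n (i + 1) - u n i ≤ m + ω)
    (ha : ∀ n < N, ∀ i : ℤ, |i| ≤ ((10 + 3 * e) * R : ℕ) →
      c ≤ a n i ∧ a n i ≤ C ∧ lam * a n i ≤ 1 / 8)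
    (hs : ∀ n < N, ∀ i : ℤ, |i| ≤ ((10 + 3 * e) * R : ℕ) → SchemeAt lam a u n i) :
    ∃ m', ∀ n ≤ N, (R : ℝ) ^ 2 ≤ 2 * (lam * n) → ∀ k : ℤ, |k| ≤ R →
      m' ≤ u n (k + 1) - u n k ∧ u n (k + 1) - u n k ≤
        m' + (1 - g * (3 + e) / 2 * Real.exp (-(2 * g * (3 + e) ^ 2))) * ω := by
  set θ := g * (3 + e) / 2 * Real.exp (-(2 * g * (3 + e) ^ 2)) with hθ
  have hRL : R ≤ (10 + 3 * e) * R := by nlinarith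
  have hkL : ∀ k : ℤ, |k| ≤ R → |k| ≤ ((10 + 3 * e) * R : ℕ) := fun k hk =>
    hk.trans (by exact_mod_cast hRL)
  have hsub : ∀ n ≤ N, lam * n ≤ R ^ 2 := fun n hn =>
    (mul_le_mul_of_nonneg_left (by exact_mod_cast hn) hlam.le).trans hN
  rcases le_total (m * (2 * R) + ω * R) (u 0 R - u 0 (-R)) with h | h
  · refine ⟨m + θ * ω, fun n hn hnt k hk => ?_⟩
    have := grid_increment_lower (V := fun n i => u n i - m * i) (a := a) (N := n) he hlam hc heC
      (hsub n hn) hω hg2 hgC hge hgR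
      (fun n' hn' i h1 h2 => by
        have := hinc n' (by omega) i (abs_le.2 ⟨h1, h2.le⟩)
        push_cast
        constructor <;> linarith)
      (fun n' hn' i hi => ha n' (by omega) i hi.le)
      (fun n' hn' i hi => by
        have := hs n' (by omega) i hi.le
        simp only [SchemeAt, lap] at this ⊢
        rw [this]; push_cast; ring)
      (by push_cast; linarith) hk hnt
    have h2 := hinc n hn k (hkL k hk)
    push_cast at this
    rw [← hθ] at this
    constructor <;> linarith
  · refine ⟨m, fun n hn hnt k hk => ?_⟩
    have := grid_increment_lower (V := fun n i => (m + ω) * i - u n i) (a := a) (N := n) he hlam hc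
      heC (hsub n hn) hω hg2 hgC hge hgR
      (fun n' hn' i h1 h2 => by
        have := hinc n' (by omega) i (abs_le.2 ⟨h1, h2.le⟩)
        push_cast
        constructor <;> linarith)
      (fun n' hn' i hi => ha n' (by omega) i hi.le)
      (fun n' hn' i hi => by
        have := hs n' (by omega) i hi.le
        simp only [SchemeAt, lap] at this ⊢
        rw [this]; push_cast; ring)
      (by push_cast; linarith) hk hnt
    have h2 := hinc n hn k (hkL k hk)
    push_cast at this
    rw [← hθ] at this
    constructor <;> linarith

set_option maxHeartbeats 1000000 in
/-- Interior Hölder estimate for the increments of a solution of the difference scheme, with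
constants depending only on the bounds of the coefficient. -/
theorem grid_gradient_holder {c C : ℝ} (hc : 0 < c) : ∃ β K : ℝ, 0 < β ∧ β ≤ 1 ∧ 0 < K ∧
    ∀ (u a : ℕ → ℤ → ℝ) (N : ℕ) (lam R G : ℝ), 0 < lam → lam ≤ 1 → 0 < R → R ^ 2 ≤ lam * N →
      (∀ n ≤ N, ∀ i : ℤ, |(i : ℝ)| ≤ R → |u n (i + 1) - u n i| ≤ G) →
      (∀ n < N, ∀ i : ℤ, |(i : ℝ)| ≤ R → c ≤ a n i ∧ a n i ≤ C ∧ lam * a n i ≤ 1 / 8) →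
      (∀ n < N, ∀ i : ℤ, |(i : ℝ)| ≤ R → SchemeAt lam a u n i) →
      ∀ k : ℤ, |(k : ℝ)| ≤ R →
        |(u N (k + 1) - u N k) - (u N 1 - u N 0)| ≤ K * G * (|(k : ℝ)| / R) ^ β := by
  obtain ⟨e, he⟩ := exists_nat_ge (max 1 (2 * C))
  have he1 : 1 ≤ e := by exact_mod_cast (le_max_left _ _).trans he
  have heC : 2 * C ≤ e := (le_max_right _ _).trans he
  have her : (1 : ℝ) ≤ e := by exact_mod_cast he1
  set g : ℝ := max 2 (max (4 * C / c) (8 * (3 + e) ^ 2 / c)) with hg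
  have hg2 : 2 ≤ g := le_max_left _ _
  have hgC : 4 * C ≤ g * c := by
    rw [← div_le_iff₀ hc]; exact (le_max_left _ _).trans (le_max_right _ _)
  have hge : 8 * (3 + e) ^ 2 ≤ g * c := by
    rw [← div_le_iff₀ hc]; exact (le_max_right _ _).trans (le_max_right _ _)
  set θ := g * (3 + e) / 2 * Real.exp (-(2 * g * (3 + e) ^ 2)) with hθ
  have hθ0 : 0 < θ := by positivity
  have hθ1 : θ < 1 := by
    rw [hθ, Real.exp_neg, ← div_eq_mul_inv, div_lt_one (Real.exp_pos _)]
    have := Real.add_one_le_exp (2 * g * (3 + e) ^ 2)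
    nlinarith [mul_nonneg (by linarith : 0 ≤ g) (by positivity : (0:ℝ) ≤ 3 + e)]
  set B : ℝ := 10 + 3 * e with hB
  have hB13 : 13 ≤ B := by rw [hB]; linarith
  set Λ : ℝ := 4 * B with hΛ
  have hΛ1 : 1 < Λ := by linarith
  set Rmin : ℝ := 2 * B * g with hRmin
  have hRmin1 : 1 ≤ Rmin := by rw [hRmin]; nlinarith
  set β : ℝ := -Real.log (1 - θ) / Real.log Λ with hβ
  have hlogΛ : 0 < Real.log Λ := Real.log_pos hΛ1
  have hβ0 : 0 < β := div_pos (neg_pos.2 (Real.log_neg (by linarith) (by linarith))) hlogΛ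
  have hΛβ : Λ ^ β = (1 - θ)⁻¹ := by
    rw [Real.rpow_def_of_pos (by linarith), hβ, mul_div_cancel₀ _ hlogΛ.ne', Real.exp_neg,
      Real.exp_log (by linarith)]
  refine ⟨min β 1, 2 * (Λ * Rmin) ^ β, lt_min hβ0 one_pos, min_le_right _ _, by positivity, ?_⟩
  intro u a N lam R G hlam hlam1 hR hN hG ha hs k hk
  have hG0 : 0 ≤ G := (abs_nonneg _).trans (hG N le_rfl 0 (by simpa using hR.le))
  let P : ℝ → ℝ → Prop := fun ρ ω => ∃ m, ∀ n ≤ N, lam * ((N : ℝ) - n) ≤ ρ ^ 2 → ∀ i : ℤ,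
    |(i : ℝ)| ≤ ρ → m ≤ u n (i + 1) - u n i ∧ u n (i + 1) - u n i ≤ m + ω
  have hP0 : P R (2 * G) := ⟨-G, fun n hn _ i hi => by
    have := abs_le.1 (hG n hn i hi)
    constructor <;> linarith⟩
  have hstep : ∀ ρ ω, Rmin ≤ ρ → ρ ≤ R → 0 ≤ ω → P ρ ω → P (ρ / Λ) ((1 - θ) * ω) := by
    rintro ρ ω hρ hρR hω ⟨m, hm⟩
    have hρ0 : 0 < ρ := by linarith
    set R1 : ℕ := ⌊ρ / B⌋₊ with hR1
    have r1 : (R1 : ℝ) ≤ ρ / B := Nat.floor_le (by positivity)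
    have r2 : ρ / B < R1 + 1 := Nat.lt_floor_add_one _
    have r0 : 2 * g ≤ ρ / B := by
      rw [le_div_iff₀ (by linarith)]; rw [hRmin] at hρ; linarith
    have r3 : ρ / Λ ≤ R1 / 2 := by
      have : ρ / Λ = ρ / B / 4 := by rw [hΛ]; field_simp
      rw [this]; linarith
    have r4 : g ≤ R1 := by linarith
    have r5 : (R1 : ℝ) * B ≤ ρ := by rwa [le_div_iff₀ (by linarith)] at r1
    have hρΛ0 : 0 ≤ ρ / Λ := by positivity
    have r6 : (ρ / Λ) ^ 2 ≤ R1 ^ 2 / 4 := by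
      have := pow_le_pow_left₀ hρΛ0 r3 2
      linarith
    set N1 : ℕ := ⌊(R1 : ℝ) ^ 2 / lam⌋₊ with hN1
    have t1 : lam * N1 ≤ R1 ^ 2 := by
      have := Nat.floor_le (by positivity : 0 ≤ (R1 : ℝ) ^ 2 / lam)
      rw [le_div_iff₀ hlam] at this
      linarith
    have t2 : (R1 : ℝ) ^ 2 ≤ lam * N1 + 1 := by
      have := Nat.lt_floor_add_one ((R1 : ℝ) ^ 2 / lam)
      rw [div_lt_iff₀ hlam] at this
      linarith
    have r7 : (R1 : ℝ) ^ 2 ≤ ρ ^ 2 := pow_le_pow_left₀ (by positivity) (by nlinarith) 2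
    have r8 : (4 : ℝ) ≤ R1 ^ 2 := by nlinarith
    have hρR2 : ρ ^ 2 ≤ R ^ 2 := pow_le_pow_left₀ hρ0.le hρR 2
    have hN1N : N1 ≤ N := by
      have : lam * N1 ≤ lam * N := by linarith
      exact_mod_cast le_of_mul_le_mul_left this hlam
    have hcast : ((N - N1 : ℕ) : ℝ) = (N : ℝ) - N1 := by push_cast [hN1N]; ring
    have hLρ : ∀ i : ℤ, |i| ≤ ((10 + 3 * e) * R1 : ℕ) → |(i : ℝ)| ≤ ρ := by
      intro i hi
      have : |(i : ℝ)| ≤ ((10 + 3 * e) * R1 : ℕ) := by exact_mod_cast hi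
      push_cast at this
      rw [hB] at r5
      linarith
    obtain ⟨m', hm'⟩ := grid_increment_osc (u := fun n i => u (N - N1 + n) i)
      (a := fun n i => a (N - N1 + n) i) (m := m) (ω := ω) (N := N1) he1 hlam hc heC t1 hω hg2 hgC
      hge r4
      (fun n hn i hi => hm _ (by omega) (by
        push_cast [hcast]
        have : 0 ≤ lam * n := by positivity
        linarith) i (hLρ i hi))
      (fun n hn i hi => ha (N - N1 + n) (by omega) i ((hLρ i hi).trans hρR))
      (fun n hn i hi => hs (N - N1 + n) (by omega) i ((hLρ i hi).trans hρR))
    refine ⟨m', fun n hn hnt i hi => ?_⟩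
    have hlt : lam * ((N : ℝ) - n) ≤ lam * N1 := by linarith
    have hle : (N : ℝ) - n ≤ N1 := le_of_mul_le_mul_left hlt hlam
    have hle' : N ≤ N1 + n := by
      have : (N : ℝ) ≤ N1 + n := by linarith
      exact_mod_cast this
    obtain ⟨q, rfl⟩ : ∃ q, n = N - N1 + q := ⟨n - (N - N1), by omega⟩
    refine hm' q (by omega) ?_ i ?_
    · push_cast [hcast] at hnt
      linarith
    · have : |(i : ℝ)| ≤ R1 := by linarith
      exact_mod_cast this
  have hiter : ∀ j : ℕ, Rmin ≤ R / Λ ^ j → P (R / Λ ^ j) ((1 - θ) ^ j * (2 * G)) := by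
    intro j
    induction j with
    | zero => intro _; simpa using hP0
    | succ j ih =>
      intro hj
      have hle : R / Λ ^ (j + 1) ≤ R / Λ ^ j := by
        apply div_le_div_of_nonneg_left hR.le (by positivity)
        exact pow_le_pow_right₀ hΛ1.le (by omega)
      have hle2 : R / Λ ^ j ≤ R := div_le_self hR.le (one_le_pow₀ hΛ1.le)
      have := hstep _ _ (hj.trans hle) hle2
        (mul_nonneg (pow_nonneg (by linarith) _) (by linarith)) (ih (hj.trans hle))
      convert this using 1
      · rw [pow_succ]; field_simp
      · rw [pow_succ]; ring
  by_cases hk0 : k = 0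
  · subst hk0
    simp only [zero_add, sub_self, abs_zero]
    positivity
  have hk1 : 1 ≤ |(k : ℝ)| := by exact_mod_cast Int.one_le_abs hk0
  have hred : (|(k : ℝ)| / R) ^ β ≤ (|(k : ℝ)| / R) ^ min β 1 :=
    Real.rpow_le_rpow_of_exponent_ge (by positivity) ((div_le_one hR).2 hk) (min_le_left _ _)
  suffices h : |(u N (k + 1) - u N k) - (u N 1 - u N 0)|
      ≤ 2 * (Λ * Rmin) ^ β * G * (|(k : ℝ)| / R) ^ β from
    h.trans (mul_le_mul_of_nonneg_left hred (by positivity))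
  have hrw : 2 * (Λ * Rmin) ^ β * G * (|(k : ℝ)| / R) ^ β
      = 2 * G * (Λ * (Rmin * |(k : ℝ)| / R)) ^ β := by
    have : Λ * (Rmin * |(k : ℝ)| / R) = Λ * Rmin * (|(k : ℝ)| / R) := by ring
    rw [this, Real.mul_rpow (x := Λ * Rmin) (by positivity) (by positivity)]
    ring
  rw [hrw]
  rcases le_or_gt (Rmin * |(k : ℝ)|) R with hcase | hcase
  · obtain ⟨j, hj1, hj2⟩ := exists_nat_pow_near (x := R / (Rmin * |(k : ℝ)|)) (y := Λ)
      (by rw [le_div_iff₀ (by positivity)]; linarith) hΛ1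
    have hj1' : Rmin * |(k : ℝ)| ≤ R / Λ ^ j := by
      rw [le_div_iff₀ (by positivity)] at hj1 ⊢; linarith
    obtain ⟨m, hm⟩ := hiter j (by nlinarith)
    have b1 := hm N le_rfl (by simp; positivity) k (by nlinarith)
    have b2 := hm N le_rfl (by simp; positivity) 0 (by simp; positivity)
    rw [zero_add] at b2
    have b3 : |(u N (k + 1) - u N k) - (u N 1 - u N 0)| ≤ (1 - θ) ^ j * (2 * G) := by
      rw [abs_le]; constructor <;> linarith
    have b4 : (1 - θ) ^ j ≤ (Λ * (Rmin * |(k : ℝ)| / R)) ^ β := by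
      have e1 : (1 - θ) ^ j = ((Λ ^ j)⁻¹) ^ β := by
        rw [Real.inv_rpow (by positivity), ← Real.rpow_natCast Λ j, ← Real.rpow_mul (by positivity),
          mul_comm, Real.rpow_mul (by positivity), hΛβ, Real.rpow_natCast, inv_pow, inv_inv]
      rw [e1]
      apply Real.rpow_le_rpow (by positivity) _ hβ0.le
      rw [div_lt_iff₀ (by positivity)] at hj2
      rw [inv_le_iff_one_le_mul₀ (by positivity), ← mul_div_assoc, div_mul_eq_mul_div,
        le_div_iff₀ hR, one_mul]
      rw [pow_succ] at hj2
      linarith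
    nlinarith
  · have b1 := abs_le.1 (hG N le_rfl k hk)
    have b2 := abs_le.1 (hG N le_rfl 0 (by simpa using hR.le))
    rw [zero_add] at b2
    have b3 : |(u N (k + 1) - u N k) - (u N 1 - u N 0)| ≤ 2 * G * 1 := by
      rw [abs_le]; constructor <;> linarith
    refine b3.trans ?_
    gcongr
    apply Real.one_le_rpow _ hβ0.le
    have : 1 ≤ Rmin * |(k : ℝ)| / R := by rw [le_div_iff₀ hR]; linarith
    nlinarith

/-- A concave power lies below its tangents. -/
theorem mul_rpow_le_tangent {γ x y : ℝ} (h0 : 0 ≤ γ) (h1 : γ ≤ 1) (hx : 0 < x) (hy : 0 ≤ y) :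
    x * y ^ γ ≤ x ^ γ * (x + γ * (y - x)) := by
  have h := rpow_one_add_le_one_add_mul_self (s := (y - x) / x) (p := γ)
    (by rw [le_div_iff₀ hx]; linarith) h0 h1
  have e : 1 + (y - x) / x = y / x := by field_simp; ring
  rw [e, Real.div_rpow hy hx.le, div_le_iff₀ (by positivity)] at h
  have := mul_le_mul_of_nonneg_left h hx.le
  have e2 : x * ((1 + γ * ((y - x) / x)) * x ^ γ) = x ^ γ * (x + γ * (y - x)) := by field_simp
  linarith

/-- The weight used in the second difference estimate is a strict subsolution. -/
theorem weight_second_difference {γ p q : ℝ} (h0 : 0 < γ) (h1 : γ ≤ 1) (hp : 1 ≤ p)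
    (hq : |q| ≤ p) :
    2 * γ * p ^ γ ≤ (((p + 1) ^ 2 - q ^ 2) * (p + 1) ^ γ - 2 * ((p ^ 2 - q ^ 2) * p ^ γ)
      + ((p - 1) ^ 2 - q ^ 2) * (p - 1) ^ γ)
      + ((p ^ 2 - (q + 1) ^ 2) * p ^ γ - 2 * ((p ^ 2 - q ^ 2) * p ^ γ)
      + (p ^ 2 - (q - 1) ^ 2) * p ^ γ) := by
  have t1 := mul_rpow_le_tangent h0.le h1 (x := p + 1) (y := p) (by linarith) (by linarith)
  have t2 := mul_rpow_le_tangent h0.le h1 (x := p) (y := p + 1) (by linarith) (by linarith)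
  have t3 := mul_rpow_le_tangent h0.le h1 (x := p) (y := p - 1) (by linarith) (by linarith)
  have hpp := Real.rpow_pos_of_pos (by linarith : 0 < p) γ
  have hconc : (p + 1) ^ γ - 2 * p ^ γ + (p - 1) ^ γ ≤ 0 := by
    have : p * ((p + 1) ^ γ - 2 * p ^ γ + (p - 1) ^ γ) ≤ 0 := by linarith
    by_contra hcon
    push Not at hcon
    have := mul_pos (by linarith : 0 < p) hcon
    linarith
  have hq2 : 0 ≤ q ^ 2 := sq_nonneg q
  have hmono : p ^ γ ≤ (p + 1) ^ γ := Real.rpow_le_rpow (by linarith) (by linarith) h0.le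
  have hmono' : (p - 1) ^ γ ≤ p ^ γ := Real.rpow_le_rpow (by linarith) (by linarith) h0.le
  have hlow : (p - 1) ^ 2 * (p ^ γ - (p - 1) ^ γ) ≤ γ * (p - 1) * p ^ γ := by
    rcases hp.eq_or_lt with rfl | hp1
    · simp
    · have t4 := mul_rpow_le_tangent h0.le h1 (x := p - 1) (y := p) (by linarith) (by linarith)
      have t5 := mul_le_mul_of_nonneg_left t4 (by linarith : 0 ≤ p - 1)
      have t6 : γ * (p - 1) * (p - 1) ^ γ ≤ γ * (p - 1) * p ^ γ := by
        apply mul_le_mul_of_nonneg_left hmono' (mul_nonneg h0.le (by linarith))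
      linarith
  have hup : γ * (p + 1) * p ^ γ ≤ (p + 1) ^ 2 * ((p + 1) ^ γ - p ^ γ) := by
    have t5 := mul_le_mul_of_nonneg_left t1 (by linarith : 0 ≤ p + 1)
    have t6 : γ * (p + 1) * p ^ γ ≤ γ * (p + 1) * (p + 1) ^ γ := by
      apply mul_le_mul_of_nonneg_left hmono (mul_nonneg h0.le (by linarith))
    linarith
  have hq3 : 0 ≤ q ^ 2 * -((p + 1) ^ γ - 2 * p ^ γ + (p - 1) ^ γ) :=
    mul_nonneg hq2 (by linarith)
  linarith

/-- One-sided form of `grid_second_difference`. -/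
theorem grid_second_difference_upper {u a : ℕ → ℤ → ℝ} {ρ N : ℕ} {lam c G H S γ : ℝ} (hρ : 1 ≤ ρ)
    (hlam : 0 < lam) (hc : 0 < c) (hγ0 : 0 < γ) (hγ1 : γ ≤ 1) (hH : 0 ≤ H)
    (hN : (ρ : ℝ) ^ 2 ≤ lam * N)
    (hG : ∀ n ≤ N, ∀ i : ℤ, |i| ≤ ρ → |u n (i + 1) - u n i| ≤ G)
    (ha : ∀ n < N, c ≤ a n 0 ∧ lam * a n 0 ≤ 1 / 8)
    (hh : ∀ n < N, ∀ i : ℤ, |i| ≤ ρ → |a n i - a n 0| ≤ H * |(i : ℝ)| ^ γ)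
    (hS : ∀ n < N, ∀ i : ℤ, |i| ≤ ρ → |lap (u n) i| ≤ S)
    (hs : ∀ n < N, ∀ i : ℤ, |i| ≤ ρ → SchemeAt lam a u n i) :
    lap (u N) 0 ≤ (2 + 1 / (c * γ)) * G / ρ + 2 / (c * γ) * H * S * (ρ : ℝ) ^ γ := by
  have hρr : (1 : ℝ) ≤ ρ := by exact_mod_cast hρ
  have hρ0 : (0 : ℝ) < ρ := by linarith
  have hG0 : 0 ≤ G := (abs_nonneg _).trans (hG N le_rfl 0 (by simp))
  have hS0 : 0 ≤ S := by
    have hN0 : N ≠ 0 := by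
      rintro rfl
      simp only [CharP.cast_eq_zero, mul_zero] at hN
      nlinarith
    exact (abs_nonneg _).trans (hS 0 (by omega) 0 (by simp))
  set A1 : ℝ := 2 * G / ρ with hA1
  set A3 : ℝ := 2 * G / (ρ * (ρ : ℝ) ^ γ) with hA3
  set A2 : ℝ := (A3 + 4 * H * S) / (2 * c * γ) with hA2
  have hργ : 0 < (ρ : ℝ) ^ γ := by positivity
  have hA10 : 0 ≤ A1 := by positivity
  have hA30 : 0 ≤ A3 := by positivity
  have hA20 : 0 ≤ A2 := by positivity
  have hA1ρ : A1 * ρ = 2 * G := by rw [hA1]; field_simp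
  have hA2c : 2 * c * γ * A2 = A3 + 4 * H * S := by rw [hA2]; field_simp
  have hA3ρ : A3 * (ρ * (ρ : ℝ) ^ γ) = 2 * G := by rw [hA3]; field_simp
  have lip : ∀ n ≤ N, ∀ p q : ℤ, q ≤ p → |p| ≤ ρ → |q| ≤ ρ → |u n p - u n q| ≤ G * (p - q) := by
    intro n hn p q hqp hp hq
    induction p, hqp using Int.leInduction with
    | base => simp
    | succ i hqi ih =>
      have hi : |i| ≤ ρ := abs_le.2 ⟨by have := (abs_le.1 hq).1; omega,
        by have := (abs_le.1 hp).2; omega⟩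
      have h1 := ih hi
      have h2 := hG n hn i hi
      have h3 := abs_add_le (u n (i + 1) - u n i) (u n i - u n q)
      rw [sub_add_sub_cancel] at h3
      push_cast
      linarith
  have hgrow : ∀ n ≤ N, ∀ p q : ℤ, |q| ≤ p → p ≤ ρ →
      (u n p + u n (-p)) - (u n q + u n (-q)) ≤ 2 * G * (p - |(q : ℝ)|) := by
    intro n hn p q hqp hpρ
    have hp0 : 0 ≤ p := (abs_nonneg q).trans hqp
    have hpa : |p| ≤ ρ := by rwa [abs_of_nonneg hp0]
    rcases le_total 0 q with h | h
    · rw [abs_of_nonneg h] at hqp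
      have hqa : |q| ≤ ρ := by rw [abs_of_nonneg h]; omega
      have e1 := (abs_le.1 (lip n hn p q hqp hpa hqa)).2
      have e2 := (abs_le.1 (lip n hn (-q) (-p) (by omega) (by simpa) (by simpa))).1
      rw [abs_of_nonneg (by exact_mod_cast h : (0 : ℝ) ≤ q)]
      push_cast at e2
      linarith
    · rw [abs_of_nonpos h] at hqp
      have hqa : |q| ≤ ρ := by rw [abs_of_nonpos h]; omega
      have e1 := (abs_le.1 (lip n hn p (-q) (by omega) hpa (by simpa))).2
      have e2 := (abs_le.1 (lip n hn q (-p) (by omega) (by simpa) (by simpa))).1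
      rw [abs_of_nonpos (by exact_mod_cast h : (q : ℝ) ≤ 0)]
      push_cast at e1 e2
      linarith
  have key := grid_max_principle (N := N) (B := fun p q => |q| ≤ p ∧ p ≤ ρ)
    (Z := fun n p q => ((u n p + u n (-p)) - (u n q + u n (-q)))
      - ((A1 + A2 * (ρ : ℝ) ^ γ) * ((p : ℝ) ^ 2 - (q : ℝ) ^ 2)
        - A2 * (((p : ℝ) ^ 2 - (q : ℝ) ^ 2) * (p : ℝ) ^ γ)
        + A3 * (lam * ((N : ℝ) - n)) * (p : ℝ) ^ γ)) ?_ ?_ N le_rfl 1 0 ⟨by simp, by omega⟩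
  · simp only [sub_self, mul_zero, add_zero, neg_zero, Int.cast_one, Int.cast_zero,
      one_pow, Real.one_rpow, ne_eq, OfNat.ofNat_ne_zero, not_false_eq_true, zero_pow, sub_zero,
      mul_one] at key
    simp only [lap, zero_add, zero_sub]
    have : A1 + A2 * (ρ : ℝ) ^ γ
        = (2 + 1 / (c * γ)) * G / ρ + 2 / (c * γ) * H * S * (ρ : ℝ) ^ γ := by
      rw [hA2, hA3, hA1]; field_simp; ring
    linarith
  · rintro p q ⟨h1, h2⟩
    have hg := hgrow 0 (by omega) p q h1 h2
    have hp0 : 0 ≤ p := (abs_nonneg q).trans h1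
    have hp0r : (0 : ℝ) ≤ p := by exact_mod_cast hp0
    have hpr : (p : ℝ) ≤ ρ := by exact_mod_cast h2
    have hqr : |(q : ℝ)| ≤ p := by exact_mod_cast h1
    have hq0 := abs_nonneg (q : ℝ)
    have hsq : 0 ≤ (p : ℝ) ^ 2 - (q : ℝ) ^ 2 := by
      rw [← sq_abs (q : ℝ)]; nlinarith
    have hpγ : (p : ℝ) ^ γ ≤ (ρ : ℝ) ^ γ := Real.rpow_le_rpow hp0r hpr hγ0.le
    have hpp : (p : ℝ) * (ρ : ℝ) ^ γ ≤ ρ * (p : ℝ) ^ γ := by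
      rcases hp0r.eq_or_lt with h | h
      · rw [← h, Real.zero_rpow hγ0.ne']; simp
      · have := Real.rpow_le_rpow_of_exponent_ge (x := (p : ℝ) / ρ) (y := 1) (z := γ)
          (by positivity) ((div_le_one hρ0).2 hpr) hγ1
        rw [Real.rpow_one, Real.div_rpow hp0r hρ0.le, div_le_div_iff₀ hρ0 hργ] at this
        linarith
    have e1 : 0 ≤ A1 * ((p : ℝ) ^ 2 - (q : ℝ) ^ 2) := by positivity
    have e2 : 0 ≤ A2 * (((p : ℝ) ^ 2 - (q : ℝ) ^ 2) * ((ρ : ℝ) ^ γ - (p : ℝ) ^ γ)) :=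
      mul_nonneg hA20 (mul_nonneg hsq (by linarith))
    have e3 : 2 * G * p ≤ A3 * (lam * ((N : ℝ) - (0 : ℕ))) * (p : ℝ) ^ γ := by
      rw [← hA3ρ]
      have m1 : A3 * ρ * (p * (ρ : ℝ) ^ γ) ≤ A3 * ρ * (ρ * (p : ℝ) ^ γ) := by gcongr
      have m2 : A3 * (p : ℝ) ^ γ * ρ ^ 2 ≤ A3 * (p : ℝ) ^ γ * (lam * N) := by gcongr
      push_cast
      linarith
    have e4 : 0 ≤ 2 * G * |(q : ℝ)| := by positivity
    linarith
  · rintro n hn p q ⟨h1, h2⟩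
    have hnN : ((n + 1 : ℕ) : ℝ) ≤ N := by exact_mod_cast hn
    have hg := hgrow (n + 1) (by omega) p q h1 h2
    have hp0 : 0 ≤ p := (abs_nonneg q).trans h1
    have hp0r : (0 : ℝ) ≤ p := by exact_mod_cast hp0
    have hpr : (p : ℝ) ≤ ρ := by exact_mod_cast h2
    have hqr : |(q : ℝ)| ≤ p := by exact_mod_cast h1
    have hq0 := abs_nonneg (q : ℝ)
    have e3 : 0 ≤ A3 * (lam * ((N : ℝ) - (n + 1 : ℕ))) * (p : ℝ) ^ γ := by
      have := sub_nonneg.2 hnN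
      positivity
    by_cases hb : p = |q| ∨ p = ρ
    · left
      rcases hb with hb | hb
      · have hbr : (p : ℝ) = |(q : ℝ)| := by exact_mod_cast hb
        have : (p : ℝ) ^ 2 - (q : ℝ) ^ 2 = 0 := by rw [hbr, sq_abs, sub_self]
        rw [this]
        rw [hbr, sub_self] at hg
        linarith
      · have hbr : (p : ℝ) = ρ := by rw [hb]; simp
        rw [hbr] at hg e3 hqr ⊢
        have : 2 * G * ((ρ : ℝ) - |(q : ℝ)|) ≤ A1 * ((ρ : ℝ) ^ 2 - (q : ℝ) ^ 2) := by
          rw [← hA1ρ, ← sq_abs (q : ℝ)]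
          have : A1 * (ρ ^ 2 - |(q : ℝ)| ^ 2)
            = A1 * ρ * (ρ - |(q : ℝ)|) + A1 * |(q : ℝ)| * (ρ - |(q : ℝ)|) := by ring
          rw [this]
          have := mul_nonneg (mul_nonneg hA10 hq0) (sub_nonneg.2 hqr)
          linarith
        linarith
    · push Not at hb
      right
      have hqp : |q| < p := lt_of_le_of_ne h1 (Ne.symm hb.1)
      have hpρ : p < ρ := lt_of_le_of_ne h2 hb.2
      have hq' := abs_lt.1 hqp
      refine ⟨⟨by omega, by omega⟩, ⟨by omega, by omega⟩, ⟨abs_le.2 ⟨by omega, by omega⟩, h2⟩,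
        ⟨abs_le.2 ⟨by omega, by omega⟩, h2⟩, ?_⟩
      obtain ⟨c0, l0⟩ := ha n hn
      have hl0 : 0 ≤ lam * a n 0 := mul_nonneg hlam.le (hc.le.trans c0)
      refine ⟨lam * a n 0, lam * a n 0, hl0, hl0, by linarith, ?_⟩
      have err : ∀ i : ℤ, |i| ≤ p →
          lam * (a n i * lap (u n) i) ≤ lam * (a n 0 * lap (u n) i) + lam * (H * (p : ℝ) ^ γ * S)
          ∧ lam * (a n 0 * lap (u n) i) - lam * (H * (p : ℝ) ^ γ * S)
            ≤ lam * (a n i * lap (u n) i) := by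
        intro i hi
        have hiρ : |i| ≤ ρ := hi.trans h2
        have f1 : |a n i - a n 0| ≤ H * (p : ℝ) ^ γ := by
          refine (hh n hn i hiρ).trans ?_
          gcongr
          exact_mod_cast hi
        have f2 : |(a n i - a n 0) * lap (u n) i| ≤ H * (p : ℝ) ^ γ * S := by
          rw [abs_mul]
          exact mul_le_mul f1 (hS n hn i hiρ) (abs_nonneg _) (by positivity)
        obtain ⟨f3, f4⟩ := abs_le.1 f2
        have f5 := mul_le_mul_of_nonneg_left f3 hlam.le
        have f6 := mul_le_mul_of_nonneg_left f4 hlam.le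
        constructor <;> linarith
      have hpa : |p| = p := abs_of_nonneg hp0
      have sp := hs n hn p (by rw [hpa]; exact h2)
      have sp' := hs n hn (-p) (by rw [abs_neg, hpa]; exact h2)
      have sq := hs n hn q (by omega)
      have sq' := hs n hn (-q) (by rw [abs_neg]; omega)
      have ep := (err p hpa.le).1
      have ep' := (err (-p) (by rw [abs_neg, hpa])).1
      have eq := (err q h1).2
      have eq' := (err (-q) (by rwa [abs_neg])).2
      have hwt := weight_second_difference hγ0 hγ1 (p := p) (q := q)
        (by exact_mod_cast (by omega : 1 ≤ p)) hqr
      have hconc : ((p : ℝ) + 1) ^ γ - 2 * (p : ℝ) ^ γ + ((p : ℝ) - 1) ^ γ ≤ 0 := by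
        have hpos : (0 : ℝ) < p := by exact_mod_cast (by omega : 0 < p)
        have hpos1 : (1 : ℝ) ≤ p := by exact_mod_cast (by omega : 1 ≤ p)
        have t2 := mul_rpow_le_tangent hγ0.le hγ1 (x := p) (y := p + 1) hpos (by linarith)
        have t3 := mul_rpow_le_tangent hγ0.le hγ1 (x := p) (y := p - 1) hpos (by linarith)
        by_contra hcon
        push Not at hcon
        have := mul_pos hpos hcon
        linarith
      have n1 : -(p + 1) = -p - 1 := by ring
      have n2 : -(p - 1) = -p + 1 := by ring
      have n3 : -(q + 1) = -q - 1 := by ring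
      have n4 : -(q - 1) = -q + 1 := by ring
      simp only [SchemeAt, mul_assoc] at sp sp' sq sq'
      simp only [lap] at sp sp' sq sq' ep ep' eq eq' ⊢
      simp only [n1, n2, n3, n4]
      rw [sp, sp', sq, sq']
      push_cast
      set X := ((p : ℝ) + 1) ^ γ
      set Y := ((p : ℝ) - 1) ^ γ
      set Q := (p : ℝ) ^ γ
      have hQ0 : 0 ≤ Q := by positivity
      have w1 := mul_le_mul_of_nonneg_left hwt (mul_nonneg hl0 hA20)
      have w2 : lam * Q * (2 * c * γ * A2) ≤ lam * a n 0 * A2 * (2 * γ * Q) := by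
        have : lam * Q * (2 * c * γ * A2) = lam * c * A2 * (2 * γ * Q) := by ring
        rw [this]
        gcongr
      rw [hA2c] at w2
      have w3 : lam * a n 0 * (A3 * (lam * ((N : ℝ) - n))) * (X - 2 * Q + Y) ≤ 0 := by
        apply mul_nonpos_of_nonneg_of_nonpos _ hconc
        push_cast at hnN
        have : 0 ≤ (N : ℝ) - n := by linarith
        positivity
      linarith

/-- Interior estimate for second differences in terms of a Hölder modulus of the coefficient
and an a priori bound, the latter entering with a small factor on small scales. -/
theorem grid_second_difference {u a : ℕ → ℤ → ℝ} {ρ N : ℕ} {lam c G H S γ : ℝ} (hρ : 1 ≤ ρ)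
    (hlam : 0 < lam) (hc : 0 < c) (hγ0 : 0 < γ) (hγ1 : γ ≤ 1) (hH : 0 ≤ H)
    (hN : (ρ : ℝ) ^ 2 ≤ lam * N)
    (hG : ∀ n ≤ N, ∀ i : ℤ, |i| ≤ ρ → |u n (i + 1) - u n i| ≤ G)
    (ha : ∀ n < N, c ≤ a n 0 ∧ lam * a n 0 ≤ 1 / 8)
    (hh : ∀ n < N, ∀ i : ℤ, |i| ≤ ρ → |a n i - a n 0| ≤ H * |(i : ℝ)| ^ γ)
    (hS : ∀ n < N, ∀ i : ℤ, |i| ≤ ρ → |lap (u n) i| ≤ S)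
    (hs : ∀ n < N, ∀ i : ℤ, |i| ≤ ρ → SchemeAt lam a u n i) :
    |lap (u N) 0| ≤ (2 + 1 / (c * γ)) * G / ρ + 2 / (c * γ) * H * S * (ρ : ℝ) ^ γ := by
  have hneg : ∀ n i, lap (fun j => -u n j) i = -lap (u n) i := fun n i => by
    simp only [lap]; ring
  rw [abs_le]
  refine ⟨?_, grid_second_difference_upper hρ hlam hc hγ0 hγ1 hH hN hG ha hh hS hs⟩
  have := grid_second_difference_upper (u := fun n i => -u n i) (a := a) hρ hlam hc hγ0 hγ1 hH hN
    (fun n hn i hi => by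
      have e : -u n (i + 1) - -u n i = -(u n (i + 1) - u n i) := by ring
      rw [e, abs_neg]; exact hG n hn i hi) ha hh
    (fun n hn i hi => by rw [hneg, abs_neg]; exact hS n hn i hi) (fun n hn i hi => by
      have := hs n hn i hi
      simp only [SchemeAt, hneg] at this ⊢
      rw [this]; ring)
  rw [hneg] at this
  linarith

theorem lap_shift (f : ℤ → ℝ) (j i : ℤ) : lap (fun k => f (j + k)) i = lap f (j + i) := by
  simp only [lap]
  rw [← add_assoc, ← add_sub_assoc]

theorem SchemeAt.shift {lam : ℝ} {a u : ℕ → ℤ → ℝ} {m n : ℕ} {j i : ℤ}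
    (h : SchemeAt lam a u (m + n) (j + i)) :
    SchemeAt lam (fun n i => a (m + n) (j + i)) (fun n i => u (m + n) (j + i)) n i := by
  simp only [SchemeAt] at h ⊢
  rw [lap_shift (fun k => u (m + n) k), ← add_assoc, h]

theorem abs_lap_le {f : ℤ → ℝ} {i : ℤ} {G : ℝ} (h1 : |f (i + 1) - f i| ≤ G)
    (h2 : |f (i - 1 + 1) - f (i - 1)| ≤ G) : |lap f i| ≤ 2 * G := by
  rw [sub_add_cancel] at h2
  have h1 := abs_le.1 h1
  have h2 := abs_le.1 h2
  simp only [lap]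
  rw [abs_le]; constructor <;> linarith

set_option maxHeartbeats 1000000 in
/-- Interior estimate for second differences when the coefficient is Hölder continuous in
space. -/
theorem grid_second_difference_interior {c γ H₀ : ℝ} (hc : 0 < c) (hγ0 : 0 < γ) (hγ1 : γ ≤ 1)
    (hH₀ : 0 ≤ H₀) : ∃ K : ℝ, 0 < K ∧
    ∀ (u a : ℕ → ℤ → ℝ) (N : ℕ) (lam R G H : ℝ), 0 < lam → lam ≤ 1 → 0 < R → R ^ 2 ≤ lam * N →
      0 ≤ H → H * R ^ γ ≤ H₀ →
      (∀ n ≤ N, ∀ i : ℤ, |(i : ℝ)| ≤ R + 1 → |u n (i + 1) - u n i| ≤ G) →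
      (∀ n < N, ∀ i : ℤ, |(i : ℝ)| ≤ R → c ≤ a n i ∧ lam * a n i ≤ 1 / 8) →
      (∀ n < N, ∀ i j : ℤ, |(i : ℝ)| ≤ R → |(j : ℝ)| ≤ R →
        |a n i - a n j| ≤ H * |(i : ℝ) - j| ^ γ) →
      (∀ n < N, ∀ i : ℤ, |(i : ℝ)| ≤ R → SchemeAt lam a u n i) →
      |lap (u N) 0| ≤ K * G / R := by
  set θ : ℝ := min (1 / 4) ((c * γ / (8 * (H₀ + 1))) ^ γ⁻¹) with hθ
  have hθ0 : 0 < θ := lt_min (by norm_num) (by positivity)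
  have hθ4 : θ ≤ 1 / 4 := min_le_left _ _
  have hθγ : 4 / (c * γ) * H₀ * θ ^ γ ≤ 1 / 2 := by
    have h1 : θ ^ γ ≤ c * γ / (8 * (H₀ + 1)) := by
      have := Real.rpow_le_rpow hθ0.le (min_le_right (1 / 4) _ : θ ≤ _) hγ0.le
      rwa [← Real.rpow_mul (by positivity), inv_mul_cancel₀ hγ0.ne', Real.rpow_one] at this
    calc 4 / (c * γ) * H₀ * θ ^ γ ≤ 4 / (c * γ) * H₀ * (c * γ / (8 * (H₀ + 1))) := by gcongr
      _ = H₀ / (H₀ + 1) / 2 := by field_simp; ring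
      _ ≤ 1 / 2 := by
        have : H₀ / (H₀ + 1) ≤ 1 := (div_le_one (by linarith)).2 (by linarith)
        linarith
  set B : ℝ := 2 + 1 / (c * γ) with hB
  have hB2 : 2 ≤ B := by
    have : 0 < 1 / (c * γ) := by positivity
    linarith
  refine ⟨B * 4 / θ, by positivity, ?_⟩
  intro u a N lam R G H hlam hlam1 hR hN hH hHR hG ha hh hs
  have hG0 : 0 ≤ G := (abs_nonneg _).trans (hG N le_rfl 0 (by simp; linarith))
  set d : ℕ × ℤ → ℝ := fun z => min (R - |(z.2 : ℝ)|) √(lam * z.1) with hd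
  set s : Finset (ℕ × ℤ) := (Finset.range (N + 1)) ×ˢ Finset.Icc (-⌊R⌋) ⌊R⌋ with hsdef
  have hmem : ∀ n i, (n, i) ∈ s ↔ n ≤ N ∧ |(i : ℝ)| ≤ R := by
    intro n i
    simp only [hsdef, Finset.mem_product, Finset.mem_range, Finset.mem_Icc]
    rw [abs_le, neg_le, neg_le (a := (R : ℝ)), Int.le_floor, Int.le_floor]
    push_cast
    constructor <;> rintro ⟨h1, h2, h3⟩ <;> exact ⟨by omega, h2, h3⟩
  have hne : s.Nonempty := ⟨(N, 0), (hmem N 0).2 ⟨le_rfl, by simpa using hR.le⟩⟩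
  obtain ⟨⟨n0, i0⟩, hz0, hmax⟩ := s.exists_max_image (fun z => d z * |lap (u z.1) z.2|) hne
  obtain ⟨hn0, hi0⟩ := (hmem _ _).1 hz0
  set σ := d (n0, i0) * |lap (u n0) i0| with hσ
  have hcenter : d (N, 0) = R := by
    simp only [hd, Int.cast_zero, abs_zero, sub_zero]
    apply min_eq_left
    exact Real.le_sqrt_of_sq_le hN
  suffices hgoal : σ ≤ B * 4 / θ * G by
    have := hmax (N, 0) ((hmem N 0).2 ⟨le_rfl, by simpa using hR.le⟩)
    simp only [hcenter] at this
    rw [le_div_iff₀ hR]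
    linarith
  have hlap2 : |lap (u n0) i0| ≤ 2 * G := by
    apply abs_lap_le (hG n0 hn0 i0 (by linarith)) (hG n0 hn0 (i0 - 1) _)
    push_cast
    have := abs_sub (i0 : ℝ) 1
    rw [abs_one] at this
    linarith
  set D := d (n0, i0) with hD
  have hD0 : 0 ≤ D := le_min (by simpa using hi0) (Real.sqrt_nonneg _)
  have hD1 : D ≤ R - |(i0 : ℝ)| := min_le_left _ _
  have hDR : D ≤ R := hD1.trans (by linarith [abs_nonneg (i0 : ℝ)])
  have hD2 : D ^ 2 ≤ lam * n0 := by
    have := pow_le_pow_left₀ hD0 (min_le_right _ _ : D ≤ √(lam * n0)) 2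
    rwa [Real.sq_sqrt (by positivity)] at this
  rcases lt_or_ge (θ * D) 1 with hsmall | hbig
  · have h1 : σ ≤ D * (2 * G) := mul_le_mul_of_nonneg_left hlap2 hD0
    have h2 : D ≤ 1 / θ := by rw [le_div_iff₀ hθ0]; linarith
    have h3 : D * (2 * G) ≤ 1 / θ * (2 * G) := by gcongr
    have h4 : 1 / θ * (2 * G) ≤ B * 4 / θ * G := by
      have : 1 / θ * (2 * G) = 2 / θ * G := by ring
      rw [this]
      gcongr
      linarith
    linarith
  have hDpos : 0 < D := by
    rcases hD0.eq_or_lt with h | h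
    · rw [← h] at hbig; linarith
    · exact h
  set ρ : ℕ := ⌊θ * D⌋₊ with hρ
  have hρ1 : 1 ≤ ρ := Nat.le_floor (by simpa using hbig)
  have hρ1_real : (1 : ℝ) ≤ ρ := by exact_mod_cast hρ1
  have hρle : (ρ : ℝ) ≤ θ * D := Nat.floor_le (by positivity)
  have hρge : θ * D ≤ 2 * ρ := by
    have : θ * D < ρ + 1 := Nat.lt_floor_add_one _
    linarith
  have hρD : (ρ : ℝ) ≤ D / 4 := by nlinarith
  set N' : ℕ := ⌈(ρ : ℝ) ^ 2 / lam⌉₊ with hN'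
  have t1 : (ρ : ℝ) ^ 2 ≤ lam * N' := by
    have := Nat.le_ceil ((ρ : ℝ) ^ 2 / lam)
    rw [div_le_iff₀ hlam] at this
    linarith
  have t2 : lam * N' ≤ 2 * (ρ : ℝ) ^ 2 := by
    have := Nat.ceil_lt_add_one (by positivity : 0 ≤ (ρ : ℝ) ^ 2 / lam)
    have h2 : lam * N' ≤ lam * ((ρ : ℝ) ^ 2 / lam + 1) := by gcongr
    rw [mul_add, mul_div_cancel₀ _ hlam.ne'] at h2
    nlinarith
  have hρ2 : (ρ : ℝ) ^ 2 ≤ D ^ 2 / 16 := by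
    have := pow_le_pow_left₀ (by positivity) hρD 2
    linarith
  have hNn : N' ≤ n0 := by
    have : lam * N' ≤ lam * n0 := by linarith [sq_nonneg D]
    exact_mod_cast le_of_mul_le_mul_left this hlam
  have hcast : ((n0 - N' : ℕ) : ℝ) = (n0 : ℝ) - N' := by push_cast [hNn]; ring
  have hin : ∀ i : ℤ, |i| ≤ ρ → |((i0 + i : ℤ) : ℝ)| ≤ R - D / 2 := by
    intro i hi
    have h1 : |(i : ℝ)| ≤ ρ := by exact_mod_cast hi
    push_cast
    have := abs_add_le (i0 : ℝ) i
    linarith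
  have hinR : ∀ i : ℤ, |i| ≤ ρ → |((i0 + i : ℤ) : ℝ)| ≤ R := fun i hi =>
    (hin i hi).trans (by linarith)
  have hσ0 : 0 ≤ σ := mul_nonneg hD0 (abs_nonneg _)
  have main := grid_second_difference (u := fun n i => u (n0 - N' + n) (i0 + i))
    (a := fun n i => a (n0 - N' + n) (i0 + i)) (N := N') (S := 2 * σ / D) (G := G) hρ1 hlam hc hγ0
    hγ1 hH t1
    (fun n hn i hi => by
      rw [← add_assoc]; exact hG (n0 - N' + n) (by omega) _ ((hinR i hi).trans (by linarith)))
    (fun n hn => ha (n0 - N' + n) (by omega) _ (hinR 0 (by simp)))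
    (fun n hn i hi => by
      have := hh (n0 - N' + n) (by omega) (i0 + i) (i0 + 0) (hinR i hi) (hinR 0 (by simp))
      push_cast at this
      rwa [add_sub_add_left_eq_sub, sub_zero] at this)
    (fun n hn i hi => by
      rw [lap_shift (fun k => u (n0 - N' + n) k)]
      have h1 := hmax (n0 - N' + n, i0 + i) ((hmem _ _).2 ⟨by omega, hinR i hi⟩)
      have h2 : D / 2 ≤ d (n0 - N' + n, i0 + i) := by
        apply le_min
        · linarith [hin i hi]
        · apply Real.le_sqrt_of_sq_le
          push_cast [hcast]
          have : 0 ≤ lam * n := by positivity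
          nlinarith
      have h3 := mul_le_mul_of_nonneg_right h2 (abs_nonneg (lap (u (n0 - N' + n)) (i0 + i)))
      rw [le_div_iff₀ hDpos]
      simp only at h1
      linarith)
    (fun n hn i hi => SchemeAt.shift (hs (n0 - N' + n) (by omega) _ (hinR i hi)))
  rw [lap_shift (fun k => u (n0 - N' + N') k)] at main
  simp only [add_zero, Nat.sub_add_cancel hNn] at main
  have m1 : σ ≤ D * (B * G / ρ + 2 / (c * γ) * H * (2 * σ / D) * (ρ : ℝ) ^ γ) :=
    mul_le_mul_of_nonneg_left main hD0
  have m2 : D * (B * G / ρ) ≤ B * 2 / θ * G := by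
    have : D / ρ ≤ 2 / θ := by
      rw [div_le_div_iff₀ (by positivity) hθ0]; linarith
    calc D * (B * G / ρ) = B * G * (D / ρ) := by ring
      _ ≤ B * G * (2 / θ) := by gcongr
      _ = _ := by ring
  have m3 : D * (2 / (c * γ) * H * (2 * σ / D) * (ρ : ℝ) ^ γ) ≤ σ / 2 := by
    have e1 : (ρ : ℝ) ^ γ ≤ θ ^ γ * R ^ γ := by
      rw [← Real.mul_rpow hθ0.le hR.le]
      apply Real.rpow_le_rpow (by positivity) _ hγ0.le
      nlinarith
    calc D * (2 / (c * γ) * H * (2 * σ / D) * (ρ : ℝ) ^ γ)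
        = 4 / (c * γ) * H * σ * (ρ : ℝ) ^ γ := by field_simp; ring
      _ ≤ 4 / (c * γ) * H * σ * (θ ^ γ * R ^ γ) := by gcongr
      _ = 4 / (c * γ) * (H * R ^ γ) * θ ^ γ * σ := by ring
      _ ≤ 4 / (c * γ) * H₀ * θ ^ γ * σ := by gcongr
      _ ≤ 1 / 2 * σ := by gcongr
      _ = σ / 2 := by ring
  have m4 : B * 4 / θ * G = 2 * (B * 2 / θ * G) := by ring
  linarith

/-- Forward space difference of a grid function. -/
def fdiff (f : ℕ → ℤ → ℝ) (n : ℕ) (i : ℤ) : ℝ := f n (i + 1) - f n i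

theorem SchemeAt.fdiff {lam a₀ : ℝ} {f : ℕ → ℤ → ℝ} {n : ℕ} {i : ℤ}
    (h : SchemeAt lam (fun _ _ => a₀) f n i) (h' : SchemeAt lam (fun _ _ => a₀) f n (i + 1)) :
    SchemeAt lam (fun _ _ => a₀) (fdiff f) n i := by
  simp only [SchemeAt, lap, _root_.fdiff] at h h' ⊢
  rw [h, h', sub_add_cancel, add_sub_cancel_right]
  ring

theorem lap_eq_fdiff (f : ℕ → ℤ → ℝ) (n : ℕ) (i : ℤ) :
    lap (f n) i = fdiff (fdiff f) n (i - 1) := by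
  simp only [lap, fdiff, sub_add_cancel]
  ring

/-- Interior difference estimate for the scheme with constant coefficient, on a cylinder. -/
theorem grid_const_fdiff {f : ℕ → ℤ → ℝ} {s N N₁ R : ℕ} {r : ℤ} {lam a₀ M : ℝ} (hR : 1 ≤ R)
    (hlam : 0 < lam) (ha₀ : 0 < a₀) (hla : lam * a₀ ≤ 1 / 8) (hN₁ : (R : ℝ) ^ 2 ≤ lam * N₁)
    (hM : ∀ n, s ≤ n → n ≤ N → ∀ i : ℤ, |i| ≤ r → |f n i| ≤ M)
    (hs : ∀ n, s ≤ n → n < N → ∀ i : ℤ, |i| < r → SchemeAt lam (fun _ _ => a₀) f n i) :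
    (∀ n, s + N₁ ≤ n → n ≤ N → ∀ i : ℤ, |i| ≤ r - R → |fdiff f n i| ≤ (4 + 1 / a₀) * M / R) ∧
    (∀ n, s + N₁ ≤ n → n < N → ∀ i : ℤ, |i| < r - R →
      SchemeAt lam (fun _ _ => a₀) (fdiff f) n i) := by
  have habs : ∀ i k : ℤ, |i| ≤ r - R → |k| ≤ R → |i + k| ≤ r := fun i k hi hk =>
    (abs_add_le i k).trans (by omega)
  have habs' : ∀ i k : ℤ, |i| ≤ r - R → |k| < R → |i + k| < r := fun i k hi hk =>
    (abs_add_le i k).trans_lt (by omega)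
  refine ⟨fun n hn hnN i hi => ?_, fun n hn hnN i hi => ?_⟩
  · have := grid_gradient (u := fun m k => f (n - N₁ + m) (i + k)) (a := fun _ _ => a₀) (N := N₁)
      (M := M) hR hlam ha₀ hN₁ (fun m hm k hk => hM _ (by omega) (by omega) _ (habs i k hi hk))
      (fun _ _ _ _ => ⟨le_rfl, hla⟩)
      (fun m hm k hk => SchemeAt.shift (a := fun _ _ => a₀) (m := n - N₁) (j := i)
        (hs (n - N₁ + m) (by omega) (by omega) _ (habs' i k hi hk)))
    simpa only [fdiff, add_zero, Nat.sub_add_cancel (by omega : N₁ ≤ n)] using this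
  · refine SchemeAt.fdiff (hs n (by omega) hnN i (by omega)) (hs n (by omega) hnN _ ?_)
    have := abs_add_le i 1
    rw [abs_one] at this
    omega

theorem abs_sub_le_of_increment {f : ℤ → ℝ} {m : ℤ} {G : ℝ}
    (h : ∀ i, |i| ≤ m → |f (i + 1) - f i| ≤ G) : ∀ i, |i| ≤ m → |f i - f 0| ≤ G * |(i : ℝ)| := by
  have main : ∀ j : ℕ, (j : ℤ) ≤ m →
      |f j - f 0| ≤ G * j ∧ |f (-j) - f 0| ≤ G * j := by
    intro j
    induction j with
    | zero => intro _; simp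
    | succ j ih =>
      intro hj
      push_cast at hj ⊢
      obtain ⟨h1, h2⟩ := ih (by omega)
      have e1 := h j (by rw [Nat.abs_cast]; omega)
      have e2 := h (-((j : ℤ) + 1)) (by rw [abs_neg, abs_of_nonneg (by omega)]; omega)
      have e3 : -((j : ℤ) + 1) + 1 = -j := by ring
      rw [e3] at e2
      rw [abs_le] at h1 h2 e1 e2
      exact ⟨abs_le.2 ⟨by linarith, by linarith⟩, abs_le.2 ⟨by linarith, by linarith⟩⟩
  intro i hi
  rcases le_total 0 i with h0 | h0
  · lift i to ℕ using h0
    rw [Nat.abs_cast] at hi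
    simpa using (main i hi).1
  · obtain ⟨j, rfl⟩ : ∃ j : ℕ, i = -j := ⟨i.natAbs, by omega⟩
    rw [abs_neg, Nat.abs_cast] at hi
    simpa using (main j hi).2

theorem abs_le_of_lap {w : ℤ → ℝ} {m : ℤ} {ε : ℝ} (h0 : w 0 = 0) (h1 : |w 1| ≤ ε)
    (h1' : |w (-1)| ≤ ε) (h : ∀ i, |i| ≤ m → |lap w i| ≤ ε) :
    ∀ i, |i| ≤ m → |w i| ≤ ε * (i : ℝ) ^ 2 := by
  have main : ∀ v : ℤ → ℝ, v 0 = 0 → |v 1| ≤ ε → (∀ i, |i| ≤ m → |lap v i| ≤ ε) →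
      ∀ j : ℕ, (j : ℤ) ≤ m → |v (j + 1) - v j| ≤ ε * (j + 1) ∧ |v j| ≤ ε * j ^ 2 := by
    intro v h0 h1 h j
    have hε : 0 ≤ ε := (abs_nonneg _).trans h1
    induction j with
    | zero => intro _; simpa [h0] using h1
    | succ j ih =>
      intro hj
      push_cast at hj ⊢
      obtain ⟨i1, i2⟩ := ih (by omega)
      have e := h ((j : ℤ) + 1) (by rw [abs_of_nonneg (by omega)]; omega)
      simp only [lap, add_sub_cancel_right] at e
      rw [abs_le] at i1 i2 e ⊢
      refine ⟨⟨by linarith, by linarith⟩, ?_⟩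
      rw [abs_le]
      have : 0 ≤ ε * j := by positivity
      constructor <;> nlinarith
  intro i hi
  rcases le_total 0 i with hi0 | hi0
  · lift i to ℕ using hi0
    rw [Nat.abs_cast] at hi
    simpa using (main w h0 h1 h i hi).2
  · obtain ⟨j, rfl⟩ : ∃ j : ℕ, i = -j := ⟨i.natAbs, by omega⟩
    rw [abs_neg, Nat.abs_cast] at hi
    have := (main (fun k => w (-k)) (by simpa) (by simpa) (fun i hi => by
      have := h (-i) (by simpa using hi)
      simp only [lap] at this ⊢
      have e1 : -(i + 1) = -i - 1 := by ring
      have e2 : -(i - 1) = -i + 1 := by ring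
      rw [e1, e2]
      convert this using 2
      ring) j hi).2
    simpa using this

/-- Estimate over time of a grid function with bounded time differences. -/
theorem abs_sub_le_of_time_increment {f : ℕ → ℝ} {n₁ n₂ : ℕ} {G : ℝ}
    (h : ∀ n, n₁ ≤ n → n < n₂ → |f (n + 1) - f n| ≤ G) :
    ∀ n n', n₁ ≤ n → n ≤ n₂ → n₁ ≤ n' → n' ≤ n₂ → |f n - f n'| ≤ G * |(n : ℝ) - n'| := by
  have main : ∀ n k, n₁ ≤ n → n + k ≤ n₂ → |f (n + k) - f n| ≤ G * k := by
    intro n k hn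
    induction k with
    | zero => intro _; simp
    | succ k ih =>
      intro hk
      have e1 := ih (by omega)
      have e2 := h (n + k) (by omega) (by omega)
      rw [← add_assoc]
      push_cast
      rw [abs_le] at *
      constructor <;> linarith
  intro n n' h1 h2 h3 h4
  rcases le_total n n' with hle | hle
  · obtain ⟨k, rfl⟩ := Nat.exists_eq_add_of_le hle
    rw [abs_sub_comm]
    simpa using main n k h1 h4
  · obtain ⟨k, rfl⟩ := Nat.exists_eq_add_of_le hle
    simpa using main n' k h3 h2

/-- Bound for solutions of an inhomogeneous explicit scheme by the data. -/
theorem grid_abs_le {w p : ℕ → ℤ → ℝ} {r : ℤ} {N : ℕ} {M E : ℝ} (hE : 0 ≤ E)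
    (h0 : ∀ i : ℤ, |i| ≤ r → |w 0 i| ≤ M) (hb : ∀ n ≤ N, ∀ i : ℤ, |i| = r → |w n i| ≤ M)
    (hp : ∀ n < N, ∀ i : ℤ, |i| < r → 0 ≤ p n i ∧ p n i ≤ 1 / 2)
    (hs : ∀ n < N, ∀ i : ℤ, |i| < r → |w (n + 1) i - (w n i + p n i * lap (w n) i)| ≤ E) :
    ∀ n ≤ N, ∀ i : ℤ, |i| ≤ r → |w n i| ≤ M + n * E := by
  intro n
  induction n with
  | zero => intro _ i hi; simpa using h0 i hi
  | succ n ih =>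
    intro hn i hi
    have ih := ih (by omega)
    have hnE : 0 ≤ ((n + 1 : ℕ) : ℝ) * E := by positivity
    rcases hi.eq_or_lt with h | h
    · exact (hb _ hn i h).trans (by linarith)
    · obtain ⟨p0, p1⟩ := hp n hn i h
      have e := abs_le.1 (hs n hn i h)
      have a0 := abs_le.1 (ih i hi)
      have a1 := abs_le.1 (ih (i + 1) (by rw [abs_lt] at h; rw [abs_le]; omega))
      have a2 := abs_le.1 (ih (i - 1) (by rw [abs_lt] at h; rw [abs_le]; omega))
      simp only [lap] at e
      push_cast
      set B := M + n * E
      have b1 := mul_le_mul_of_nonneg_left a0.1 (by linarith : 0 ≤ 1 - 2 * p n i)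
      have b2 := mul_le_mul_of_nonneg_left a0.2 (by linarith : 0 ≤ 1 - 2 * p n i)
      have b3 := mul_le_mul_of_nonneg_left a1.1 p0
      have b4 := mul_le_mul_of_nonneg_left a1.2 p0
      have b5 := mul_le_mul_of_nonneg_left a2.1 p0
      have b6 := mul_le_mul_of_nonneg_left a2.2 p0
      have hB : M + (n + 1) * E = B + E := by simp only [B]; ring
      rw [abs_le, hB]
      constructor <;> linarith

/-- The solution of the constant coefficient scheme with the values of `u` at time zero and
outside of the interval of radius `r`. -/
def constScheme (lam a₀ : ℝ) (r : ℤ) (u : ℕ → ℤ → ℝ) : ℕ → ℤ → ℝ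
  | 0, i => u 0 i
  | n + 1, i => if |i| < r then constScheme lam a₀ r u n i
      + lam * a₀ * lap (constScheme lam a₀ r u n) i else u (n + 1) i

theorem constScheme_schemeAt {lam a₀ : ℝ} {r : ℤ} {u : ℕ → ℤ → ℝ} {n : ℕ} {i : ℤ} (hi : |i| < r) :
    SchemeAt lam (fun _ _ => a₀) (constScheme lam a₀ r u) n i := by
  simp only [SchemeAt, constScheme, if_pos hi]

theorem constScheme_of_le {lam a₀ : ℝ} {r : ℤ} {u : ℕ → ℤ → ℝ} {n : ℕ} {i : ℤ} (hi : r ≤ |i|) :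
    constScheme lam a₀ r u n i = u n i := by
  cases n with
  | zero => rfl
  | succ n => simp only [constScheme, if_neg (not_lt.2 hi)]

/-- Expansion of a solution of the constant coefficient scheme around the point `(n₀, 0)`. -/
theorem grid_const_expansion {f : ℕ → ℤ → ℝ} {R N₁ : ℕ} {lam a₀ k M ρ : ℝ} (hR : 1 ≤ R)
    (hlam : 0 < lam) (ha₀ : 0 < a₀) (hk : 4 + 1 / a₀ ≤ k) (hla : lam * a₀ ≤ 1 / 8)
    (hN₁ : (R : ℝ) ^ 2 ≤ lam * N₁) (hρ0 : 0 ≤ ρ) (hρ : ρ ≤ R)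
    (hM : ∀ n ≤ 6 * N₁, ∀ i : ℤ, |i| ≤ 8 * R → |f n i| ≤ M)
    (hs : ∀ n < 6 * N₁, ∀ i : ℤ, |i| < 8 * R → SchemeAt lam (fun _ _ => a₀) f n i) :
    ∀ n ≤ 6 * N₁, lam * |(n : ℝ) - (5 * N₁ : ℕ)| ≤ ρ ^ 2 → ∀ i : ℤ, |(i : ℝ)| ≤ ρ →
      |f n i - (f (5 * N₁) 0 + (f (5 * N₁) 1 - f (5 * N₁) (-1)) / 2 * i
        + lap (f (5 * N₁)) 0 * ((i : ℝ) ^ 2 / 2 + a₀ * (lam * ((n : ℝ) - (5 * N₁ : ℕ)))))|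
      ≤ (1 + a₀) * (k ^ 3 + a₀ * k ^ 4) * (M / R ^ 2) * (ρ ^ 3 / R) := by
  have hM0 : 0 ≤ M := (abs_nonneg _).trans (hM 0 (by omega) 0 (by simp))
  have hRr : (1 : ℝ) ≤ R := by exact_mod_cast hR
  have hR0 : (0 : ℝ) < R := by linarith
  set k₀ := 4 + 1 / a₀ with hk₀
  have hk₀0 : 0 < k₀ := by positivity
  obtain ⟨b1, s1⟩ := grid_const_fdiff (s := 0) (N := 6 * N₁) (r := 8 * R) hR hlam ha₀ hla hN₁
    (fun n _ hn i hi => hM n hn i hi) (fun n _ hn i hi => hs n hn i hi)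
  obtain ⟨b2, s2⟩ := grid_const_fdiff hR hlam ha₀ hla hN₁ b1 s1
  obtain ⟨b3, s3⟩ := grid_const_fdiff hR hlam ha₀ hla hN₁ b2 s2
  obtain ⟨b4, s4⟩ := grid_const_fdiff hR hlam ha₀ hla hN₁ b3 s3
  clear b1 b2 s1 s3 s4
  rw [← hk₀] at b3 b4
  set n₀ := 5 * N₁ with hn₀
  have hm0 : 0 ≤ M / R ^ 2 := by positivity
  have d3 : ∀ n, 4 * N₁ ≤ n → n ≤ 6 * N₁ → ∀ i : ℤ, |i| ≤ R →
      |lap (f n) (i + 1) - lap (f n) i| ≤ k ^ 3 * (M / R ^ 2) / R := by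
    intro n h1 h2 i hi
    rw [lap_eq_fdiff, lap_eq_fdiff]
    have := b3 n (by omega) h2 (i - 1) (by rw [abs_le] at hi ⊢; omega)
    have e : i + 1 - 1 = i - 1 + 1 := by ring
    rw [e]
    refine (show _ ≤ _ from this).trans ?_
    calc k₀ * (k₀ * (k₀ * M / R) / R) / R = k₀ ^ 3 * (M / R ^ 2) / R := by field_simp
      _ ≤ _ := by gcongr
  have d4 : ∀ n, 4 * N₁ ≤ n → n < 6 * N₁ → ∀ i : ℤ, |i| ≤ R →
      |lap (f (n + 1)) i - lap (f n) i| ≤ lam * (a₀ * k ^ 4 * (M / R ^ 2) / R ^ 2) := by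
    intro n h1 h2 i hi
    have e := s2 n (by omega) h2 (i - 1) (by rw [abs_le] at hi; rw [abs_lt]; omega)
    simp only [SchemeAt] at e
    rw [lap_eq_fdiff, lap_eq_fdiff, e, add_sub_cancel_left, lap_eq_fdiff, abs_mul,
      abs_of_pos (by positivity)]
    have := b4 n (by omega) (by omega) (i - 1 - 1) (by rw [abs_le] at hi ⊢; omega)
    calc lam * a₀ * _ ≤ lam * a₀ * (k₀ * (k₀ * (k₀ * (k₀ * M / R) / R) / R) / R) := by gcongr
      _ = lam * (a₀ * k₀ ^ 4 * (M / R ^ 2) / R ^ 2) := by field_simp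
      _ ≤ _ := by gcongr
  clear b3 b4 s2 hM
  set ε := (k ^ 3 + a₀ * k ^ 4) * (M / R ^ 2) * (ρ / R) with hε
  have hk0 : 0 < k := hk₀0.trans_le hk
  have hε0 : 0 ≤ ε := by positivity
  have hN₁0 : 0 ≤ lam * N₁ - ρ ^ 2 := by
    have := pow_le_pow_left₀ hρ0 hρ 2
    linarith
  have htime : ∀ n : ℕ, lam * |(n : ℝ) - n₀| ≤ ρ ^ 2 → 4 * N₁ ≤ n := by
    intro n hn
    have : lam * |(n : ℝ) - n₀| ≤ lam * N₁ := by linarith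
    have := abs_le.1 (le_of_mul_le_mul_left this hlam)
    have h4 : ((4 * N₁ : ℕ) : ℝ) ≤ n := by
      have := this.1
      rw [hn₀] at this
      push_cast at this ⊢
      linarith
    exact_mod_cast h4
  have hfl : ∀ i : ℤ, |(i : ℝ)| ≤ ρ → |i| ≤ R := by
    intro i hi
    have : |(i : ℝ)| ≤ R := hi.trans hρ
    exact_mod_cast this
  have hlapc : ∀ n ≤ 6 * N₁, lam * |(n : ℝ) - n₀| ≤ ρ ^ 2 → ∀ i : ℤ, |(i : ℝ)| ≤ ρ →
      |lap (f n) i - lap (f n₀) 0| ≤ ε := by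
    intro n hn hnt i hi
    have hn4 := htime n hnt
    have h1 := abs_sub_le_of_increment (f := lap (f n)) (d3 n hn4 hn) i (hfl i hi)
    have h2 := abs_sub_le_of_time_increment (f := fun n => lap (f n) 0)
      (fun n h1 h2 => d4 n h1 h2 0 (by simp)) n n₀ hn4 hn (by omega) (by omega)
    have h3 : k ^ 3 * (M / R ^ 2) / R * |(i : ℝ)| ≤ k ^ 3 * (M / R ^ 2) / R * ρ := by gcongr
    have h4 : lam * (a₀ * k ^ 4 * (M / R ^ 2) / R ^ 2) * |(n : ℝ) - n₀|
        ≤ a₀ * k ^ 4 * (M / R ^ 2) / R * ρ := by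
      calc _ = a₀ * k ^ 4 * (M / R ^ 2) / R ^ 2 * (lam * |(n : ℝ) - n₀|) := by ring
        _ ≤ a₀ * k ^ 4 * (M / R ^ 2) / R ^ 2 * (R * ρ) := by
          refine mul_le_mul_of_nonneg_left (hnt.trans ?_) (by positivity)
          rw [sq]
          gcongr
        _ = _ := by field_simp
    have h5 := abs_sub_le (lap (f n) i) (lap (f n) 0) (lap (f n₀) 0)
    have h6 : ε = k ^ 3 * (M / R ^ 2) / R * ρ + a₀ * k ^ 4 * (M / R ^ 2) / R * ρ := by
      rw [hε]; ring
    linarith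
  set v : ℕ → ℤ → ℝ := fun n i => f n i - (f n₀ 0 + (f n₀ 1 - f n₀ (-1)) / 2 * i
        + lap (f n₀) 0 * ((i : ℝ) ^ 2 / 2 + a₀ * (lam * ((n : ℝ) - n₀)))) with hv
  have hlapv : ∀ n i, lap (v n) i = lap (f n) i - lap (f n₀) 0 := by
    intro n i
    simp only [hv, lap]
    push_cast
    ring
  have hvs : ∀ n < 6 * N₁, lam * |(n : ℝ) - n₀| ≤ ρ ^ 2 → ∀ i : ℤ, |(i : ℝ)| ≤ ρ →
      |v (n + 1) i - v n i| ≤ lam * (a₀ * ε) := by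
    intro n hn hnt i hi
    have e : v (n + 1) i - v n i = lam * (a₀ * (lap (f n) i - lap (f n₀) 0)) := by
      have := hs n hn i (by have := hfl i hi; omega)
      simp only [SchemeAt] at this
      simp only [hv, this]
      push_cast
      ring
    rw [e, abs_mul, abs_mul, abs_of_pos hlam, abs_of_pos ha₀]
    have := hlapc n hn.le hnt i hi
    gcongr
  intro n hn hnt i hi
  have hsp : |v n₀ i| ≤ ε * (i : ℝ) ^ 2 := by
    have v0 : v n₀ 0 = 0 := by simp [hv]
    have v1 : v n₀ 1 = 0 := by simp [hv, lap]; ring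
    have v2 : v n₀ (-1) = 0 := by simp [hv, lap]; ring
    refine abs_le_of_lap (w := v n₀) (m := |i|) v0 (by simpa [v1]) (by simpa [v2]) ?_ i le_rfl
    intro j hj
    rw [hlapv]
    refine hlapc n₀ (by omega) (by simpa using sq_nonneg ρ) j (le_trans ?_ hi)
    exact_mod_cast hj
  have htm : |v n i - v n₀ i| ≤ lam * (a₀ * ε) * |(n : ℝ) - n₀| := by
    refine abs_sub_le_of_time_increment (f := fun n => v n i) (n₁ := min n n₀) (n₂ := max n n₀)
      (fun m h1 h2 => hvs m (by omega) (le_trans ?_ hnt) i hi) n n₀ (by omega) (by omega) (by omega)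
      (by omega)
    refine mul_le_mul_of_nonneg_left ?_ hlam.le
    rcases le_total n n₀ with h | h
    · have r1 : (n : ℝ) ≤ m := by exact_mod_cast (by omega : n ≤ m)
      have r2 : (m : ℝ) ≤ n₀ := by exact_mod_cast (by omega : m ≤ n₀)
      rw [abs_of_nonpos (by linarith), abs_of_nonpos (by linarith)]
      linarith
    · have r1 : (n₀ : ℝ) ≤ m := by exact_mod_cast (by omega : n₀ ≤ m)
      have r2 : (m : ℝ) ≤ n := by exact_mod_cast (by omega : m ≤ n)
      rw [abs_of_nonneg (by linarith), abs_of_nonneg (by linarith)]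
      linarith
  change |v n i| ≤ _
  have e1 : ε * (i : ℝ) ^ 2 ≤ ε * ρ ^ 2 := by
    rw [← sq_abs (i : ℝ)]
    gcongr
  have e2 : lam * (a₀ * ε) * |(n : ℝ) - n₀| ≤ a₀ * ε * ρ ^ 2 := by
    calc _ = a₀ * ε * (lam * |(n : ℝ) - n₀|) := by ring
      _ ≤ _ := mul_le_mul_of_nonneg_left hnt (by positivity)
  have e3 := abs_sub_abs_le_abs_sub (v n i) (v n₀ i)
  calc |v n i| ≤ ε * ρ ^ 2 + a₀ * ε * ρ ^ 2 := by linarith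
    _ = _ := by rw [hε]; ring

/-- Expansion of a solution of the scheme whose coefficient is close to a constant. -/
theorem grid_expansion {c C : ℝ} (hc : 0 < c) (hC : 0 ≤ C) : ∃ K : ℝ, 0 < K ∧
    ∀ (u a : ℕ → ℤ → ℝ) (R N₁ : ℕ) (lam S η a₀ ρ : ℝ), 1 ≤ R → 0 < lam → c ≤ a₀ → a₀ ≤ C →
      lam * a₀ ≤ 1 / 8 → (R : ℝ) ^ 2 ≤ lam * N₁ → lam * N₁ ≤ 2 * (R : ℝ) ^ 2 →
      0 ≤ ρ → ρ ≤ R →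
      (∀ n ≤ 6 * N₁, ∀ i : ℤ, |i| ≤ 8 * R → |lap (u n) i| ≤ S) →
      (∀ n < 6 * N₁, ∀ i : ℤ, |i| ≤ 8 * R → |a n i| ≤ C ∧ |a n i - a₀| ≤ η) →
      (∀ n < 6 * N₁, ∀ i : ℤ, |i| ≤ 8 * R → SchemeAt lam a u n i) →
      ∃ c₀ c₁ c₂ : ℝ,
        ∀ n ≤ 6 * N₁, lam * |(n : ℝ) - (5 * N₁ : ℕ)| ≤ ρ ^ 2 → ∀ i : ℤ, |(i : ℝ)| ≤ ρ →
          |u n i - (c₀ + c₁ * i + c₂ * ((i : ℝ) ^ 2 / 2 + a₀ * (lam * ((n : ℝ) - (5 * N₁ : ℕ)))))|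
          ≤ K * S * (ρ ^ 3 / R + η * R ^ 2) := by
  set k : ℝ := 4 + 1 / c with hk
  have hk0 : 0 < k := by positivity
  set K₁ : ℝ := (1 + C) * (k ^ 3 + C * k ^ 4) * (12 * C + 64) with hK₁
  refine ⟨12 + K₁, by positivity, ?_⟩
  intro u a R N₁ lam S η a₀ ρ hR hlam hca hac hla hN1 hN2 hρ0 hρ hS ha hs
  have ha₀ : 0 < a₀ := hc.trans_le hca
  have hRr : (1 : ℝ) ≤ R := by exact_mod_cast hR
  have hR0 : (0 : ℝ) < R := by linarith
  have hN₁ : 0 < N₁ := by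
    rcases Nat.eq_zero_or_pos N₁ with h | h
    · rw [h] at hN1; simp at hN1; linarith [hN1]
    · exact h
  have hS0 : 0 ≤ S := (abs_nonneg _).trans (hS 0 (by omega) 0 (by simp))
  have hη0 : 0 ≤ η := (abs_nonneg _).trans (ha 0 (by omega) 0 (by simp)).2
  set n₀ := 5 * N₁ with hn₀
  set h := constScheme lam a₀ (8 * R) u with hh
  have hcmp : ∀ n ≤ 6 * N₁, ∀ i : ℤ, |i| ≤ 8 * R → |u n i - h n i| ≤ 12 * R ^ 2 * (η * S) := by
    intro n hn i hi
    have := grid_abs_le (w := fun n i => u n i - h n i) (p := fun _ _ => lam * a₀) (r := 8 * R)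
      (N := 6 * N₁) (M := 0) (E := lam * (η * S)) (by positivity)
      (fun i _ => by simp [hh, constScheme])
      (fun n hn i hi => by simp [hh, constScheme_of_le hi.ge])
      (fun n hn i hi => ⟨by positivity, by linarith⟩)
      (fun n hn i hi => by
        have e1 := hs n hn i hi.le
        have e2 := constScheme_schemeAt (lam := lam) (a₀ := a₀) (u := u) (n := n) hi
        rw [← hh] at e2
        have e3 : u (n + 1) i - h (n + 1) i
            - (u n i - h n i + lam * a₀ * lap (fun i => u n i - h n i) i)
            = lam * ((a n i - a₀) * lap (u n) i) := by
          simp only [SchemeAt] at e1 e2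
          rw [e1, e2]
          simp only [lap]
          ring
        rw [e3, abs_mul, abs_mul, abs_of_pos hlam]
        have i1 := (ha n hn i hi.le).2
        have i2 := hS n hn.le i hi.le
        gcongr) n hn i hi
    refine this.trans ?_
    have h1 : (n : ℝ) ≤ 6 * N₁ := by exact_mod_cast hn
    calc 0 + (n : ℝ) * (lam * (η * S)) ≤ 6 * N₁ * (lam * (η * S)) := by rw [zero_add]; gcongr
      _ = 6 * (lam * N₁) * (η * S) := by ring
      _ ≤ 6 * (2 * R ^ 2) * (η * S) := by gcongr
      _ = _ := by ring
  set l : ℤ → ℝ := fun i => u n₀ 0 + (u n₀ 1 - u n₀ 0) * i with hl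
  have hlapl : ∀ (g : ℤ → ℝ) i, lap (fun i => g i - l i) i = lap g i := by
    intro g i
    simp only [lap, hl]
    push_cast
    ring
  set M : ℝ := (12 * C + 64) * S * R ^ 2 with hM
  have hul : ∀ n ≤ 6 * N₁, ∀ i : ℤ, |i| ≤ 8 * R → |u n i - l i| ≤ M := by
    intro n hn i hi
    have h1 := abs_sub_le_of_time_increment (f := fun n => u n i) (n₁ := 0) (n₂ := 6 * N₁)
      (G := lam * (C * S)) (fun n _ hn => by
        have e := hs n hn i hi
        simp only [SchemeAt] at e
        rw [e, add_sub_cancel_left, mul_assoc, abs_mul, abs_mul, abs_of_pos hlam]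
        have i1 := (ha n hn i hi).1
        have i2 := hS n hn.le i hi
        gcongr) n n₀ (by omega) hn (by omega) (by omega)
    have h2 : |(n : ℝ) - n₀| ≤ 6 * N₁ := by
      have r1 : (n : ℝ) ≤ 6 * N₁ := by exact_mod_cast hn
      have r2 : (n₀ : ℝ) = 5 * N₁ := by rw [hn₀]; push_cast; ring
      have r3 : (0 : ℝ) ≤ n := by positivity
      rw [abs_le, r2]
      constructor <;> linarith
    have h3 : lam * (C * S) * |(n : ℝ) - n₀| ≤ 12 * C * S * R ^ 2 := by
      calc _ ≤ lam * (C * S) * (6 * N₁) := by gcongr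
        _ = 6 * C * S * (lam * N₁) := by ring
        _ ≤ 6 * C * S * (2 * R ^ 2) := by gcongr
        _ = _ := by ring
    have h4 : |u n₀ i - l i| ≤ S * (i : ℝ) ^ 2 := by
      refine abs_le_of_lap (w := fun i => u n₀ i - l i) (m := 8 * R) (by simp [hl])
        (by simpa [hl] using hS0) ?_ ?_ i hi
      · have := hS n₀ (by omega) 0 (by simp)
        rw [← hlapl] at this
        simpa [lap, hl] using this
      · intro j hj
        rw [hlapl]
        exact hS n₀ (by omega) j hj
    have h5 : (i : ℝ) ^ 2 ≤ 64 * R ^ 2 := by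
      have : |(i : ℝ)| ≤ 8 * R := by exact_mod_cast hi
      have := pow_le_pow_left₀ (abs_nonneg _) this 2
      rw [sq_abs] at this
      linarith
    have h6 : S * (i : ℝ) ^ 2 ≤ S * (64 * R ^ 2) := by gcongr
    have h7 := abs_sub_le (u n i) (u n₀ i) (l i)
    rw [hM]
    linarith
  have hhl : ∀ n ≤ 6 * N₁, ∀ i : ℤ, |i| ≤ 8 * R → |h n i - l i| ≤ M := by
    intro n hn i hi
    have := grid_abs_le (w := fun n i => h n i - l i) (p := fun _ _ => lam * a₀) (r := 8 * R)
      (N := 6 * N₁) (M := M) (E := 0) le_rfl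
      (fun i hi => by simpa [hh, constScheme] using hul 0 (by omega) i hi)
      (fun n hn i hi => by simpa only [hh, constScheme_of_le hi.ge] using hul n hn i hi.le)
      (fun n hn i hi => ⟨by positivity, by linarith⟩)
      (fun n hn i hi => by
        have e2 := constScheme_schemeAt (lam := lam) (a₀ := a₀) (u := u) (n := n) hi
        rw [← hh] at e2
        simp only [SchemeAt] at e2
        rw [hlapl, e2]
        ring_nf
        simp) n hn i hi
    simpa using this
  have main := grid_const_expansion (f := fun n i => h n i - l i) (k := k) (M := M) (ρ := ρ) hR hlam
    ha₀ (by rw [hk]; gcongr) hla hN1 hρ0 hρ hhl (fun n hn i hi => by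
      have e2 := constScheme_schemeAt (lam := lam) (a₀ := a₀) (u := u) (n := n) hi
      rw [← hh] at e2
      simp only [SchemeAt] at e2 ⊢
      rw [hlapl, e2]
      ring)
  rw [← hn₀] at main
  refine ⟨h n₀ 0, (h n₀ 1 - h n₀ (-1)) / 2, lap (h n₀) 0, ?_⟩
  intro n hn hnt i hi
  have hm := main n hn hnt i hi
  rw [hlapl] at hm
  have hi8 : |i| ≤ 8 * R := by
    have : |(i : ℝ)| ≤ 8 * R := by linarith
    exact_mod_cast this
  have e1 : h n i - l i - (h n₀ 0 - l 0 + (h n₀ 1 - l 1 - (h n₀ (-1) - l (-1))) / 2 * i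
      + lap (h n₀) 0 * ((i : ℝ) ^ 2 / 2 + a₀ * (lam * ((n : ℝ) - n₀))))
      = h n i - (h n₀ 0 + (h n₀ 1 - h n₀ (-1)) / 2 * i
        + lap (h n₀) 0 * ((i : ℝ) ^ 2 / 2 + a₀ * (lam * ((n : ℝ) - n₀)))) := by
    simp only [hl]
    push_cast
    ring
  rw [e1] at hm
  have h1 := hcmp n hn i hi8
  have h2 := abs_sub_le (u n i) (h n i) (h n₀ 0 + (h n₀ 1 - h n₀ (-1)) / 2 * i
        + lap (h n₀) 0 * ((i : ℝ) ^ 2 / 2 + a₀ * (lam * ((n : ℝ) - n₀))))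
  have h3 : M / R ^ 2 = (12 * C + 64) * S := by rw [hM]; field_simp
  have h4 : (1 + a₀) * (k ^ 3 + a₀ * k ^ 4) * (M / R ^ 2) * (ρ ^ 3 / R) ≤ K₁ * S * (ρ ^ 3 / R) := by
    rw [h3]
    calc _ ≤ (1 + C) * (k ^ 3 + C * k ^ 4) * ((12 * C + 64) * S) * (ρ ^ 3 / R) := by gcongr
      _ = _ := by rw [hK₁]; ring
  have h5 : 0 ≤ 12 * S * (ρ ^ 3 / R) := by positivity
  have h6 : 0 ≤ K₁ * S * (η * R ^ 2) := by positivity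
  have h7 : (12 + K₁) * S * (ρ ^ 3 / R + η * R ^ 2) = 12 * S * (ρ ^ 3 / R) + K₁ * S * (ρ ^ 3 / R)
      + K₁ * S * (η * R ^ 2) + 12 * R ^ 2 * (η * S) := by ring
  linarith

/-- Solutions of the scheme with mesh size `h` on a cylinder of radius `8 * R` in space, for a
coefficient which depends in a Hölder continuous way on the difference quotients of the solution,
the solution, and the space and time variables. -/
structure GridSolution (c C M α H h lam : ℝ) (R N : ℕ) (u a : ℕ → ℤ → ℝ) : Prop where
  bound : ∀ n ≤ N, ∀ i : ℤ, |i| ≤ 8 * R → |u n i| ≤ M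
  coeff : ∀ n ≤ N, ∀ i : ℤ, |i| ≤ 8 * R → c ≤ a n i ∧ a n i ≤ C ∧ lam * a n i ≤ 1 / 8
  scheme : ∀ n < N, ∀ i : ℤ, |i| ≤ 8 * R → SchemeAt lam a u n i
  holder : ∀ n ≤ N, ∀ i : ℤ, |i| ≤ 8 * R → ∀ n' ≤ N, ∀ i' : ℤ, |i'| ≤ 8 * R →
    |a n i - a n' i'| ≤ H * (|(u n (i + 1) - u n i) - (u n' (i' + 1) - u n' i')| / h
      + |u n i - u n' i'| + h * |(i : ℝ) - i'| + h ^ 2 * (lam * |(n : ℝ) - n'|)) ^ α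

set_option maxHeartbeats 1000000 in
/-- Interior bounds for first and second difference quotients. -/
theorem grid_regularity {c C M α H r₀ : ℝ} (hc : 0 < c) (hM : 0 ≤ M) (hα0 : 0 < α)
    (hα1 : α ≤ 1) (hH : 0 ≤ H) (hr₀ : 0 < r₀) : ∃ S : ℝ, 0 < S ∧
    ∀ (u a : ℕ → ℤ → ℝ) (h lam : ℝ) (R N₁ N : ℕ), 0 < h → 0 < lam → lam ≤ 1 → 1 ≤ R →
      r₀ ≤ h * R → h * R ≤ 2 * r₀ → (R : ℝ) ^ 2 ≤ lam * N₁ →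
      GridSolution c C M α H h lam R N u a →
      ∀ n, 3 * N₁ ≤ n → n ≤ N → ∀ i : ℤ, |i| ≤ 4 * R →
        |u n (i + 1) - u n i| ≤ S * h ∧ |lap (u n) i| ≤ S * h ^ 2 := by
  obtain ⟨β, K, hβ0, hβ1, hK, holder⟩ := grid_gradient_holder (C := C) hc
  set k : ℝ := 4 + 1 / c with hk
  have hk0 : 0 < k := by positivity
  set G₁ : ℝ := k * (M + 1) / r₀ with hG₁
  have hG₁0 : 0 < G₁ := by positivity
  set X : ℝ := K * G₁ + G₁ * (2 * r₀) + 2 * r₀ with hX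
  have hX0 : 0 < X := by positivity
  have hγ0 : 0 < β * α := by positivity
  have hγ1 : β * α ≤ 1 := by nlinarith
  obtain ⟨K₂, hK₂, second⟩ := grid_second_difference_interior (H₀ := H * X ^ α) hc hγ0 hγ1
    (by positivity)
  refine ⟨G₁ + 2 * K₂ * G₁ / r₀, by positivity, ?_⟩
  intro u a h lam R N₁ N hh hlam hlam1 hR hr1 hr2 hN₁ sol
  have hRr : (1 : ℝ) ≤ R := by exact_mod_cast hR
  have hR0 : (0 : ℝ) < R := by linarith
  have hGh : k * M / R ≤ G₁ * h := by
    rw [hG₁, div_mul_eq_mul_div, div_le_div_iff₀ hR0 hr₀]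
    calc k * M * r₀ ≤ k * (M + 1) * (h * R) := by gcongr; linarith
      _ = _ := by ring
  have grad : ∀ n, N₁ ≤ n → n ≤ N → ∀ i : ℤ, |i| ≤ 7 * R → |u n (i + 1) - u n i| ≤ G₁ * h := by
    intro n hn hnN i hi
    have habs : ∀ k : ℤ, |k| ≤ R → |i + k| ≤ 8 * R := fun k hk =>
      (abs_add_le i k).trans (by omega)
    have := grid_gradient (u := fun m k => u (n - N₁ + m) (i + k))
      (a := fun m k => a (n - N₁ + m) (i + k)) (N := N₁) (M := M) hR hlam hc hN₁
      (fun m hm k hk => sol.bound _ (by omega) _ (habs k hk))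
      (fun m hm k hk => by
        obtain ⟨h1, _, h2⟩ := sol.coeff (n - N₁ + m) (by omega) _ (habs k hk.le)
        exact ⟨h1, h2⟩)
      (fun m hm k hk => SchemeAt.shift (sol.scheme (n - N₁ + m) (by omega) _ (habs k hk.le)))
    simp only [add_zero, Nat.sub_add_cancel hn] at this
    exact this.trans hGh
  have gradH : ∀ n, 2 * N₁ ≤ n → n ≤ N → ∀ i : ℤ, |i| ≤ 6 * R → ∀ j : ℤ, |(j : ℝ)| ≤ R →
      |(u n (i + j + 1) - u n (i + j)) - (u n (i + 1) - u n i)|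
        ≤ K * (G₁ * h) * (|(j : ℝ)| / R) ^ β := by
    intro n hn hnN i hi
    have habs : ∀ k : ℤ, |(k : ℝ)| ≤ R → |i + k| ≤ 7 * R := fun k hk => by
      have : |k| ≤ R := by exact_mod_cast hk
      exact (abs_add_le i k).trans (by omega)
    have := holder (fun m k => u (n - N₁ + m) (i + k)) (fun m k => a (n - N₁ + m) (i + k)) N₁
      lam R (G₁ * h) hlam hlam1 hR0 hN₁
      (fun m hm k hk => by
        rw [← add_assoc]; exact grad (n - N₁ + m) (by omega) (by omega) _ (habs k hk))
      (fun m hm k hk => sol.coeff (n - N₁ + m) (by omega) _ (by have := habs k hk; omega))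
      (fun m hm k hk => SchemeAt.shift (sol.scheme (n - N₁ + m) (by omega) _
        (by have := habs k hk; omega)))
    simp only [add_zero, Nat.sub_add_cancel (by omega : N₁ ≤ n), ← add_assoc] at this
    exact this
  have coefH : ∀ n, 2 * N₁ ≤ n → n ≤ N → ∀ i : ℤ, |i| ≤ 6 * R → ∀ j : ℤ, |(j : ℝ)| ≤ R →
      |i + j| ≤ 6 * R → |a n (i + j) - a n i| ≤ H * X ^ α / R ^ (β * α) * |(j : ℝ)| ^ (β * α) := by
    intro n hn hnN i hi j hj hij
    refine (sol.holder n hnN (i + j) (by omega) n hnN i (by omega)).trans ?_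
    have hq0 : 0 ≤ |(j : ℝ)| / R := by positivity
    have hq1 : |(j : ℝ)| / R ≤ 1 := (div_le_one hR0).2 hj
    have hq : |(j : ℝ)| / R ≤ (|(j : ℝ)| / R) ^ β := Real.self_le_rpow_of_le_one hq0 hq1 hβ1
    have e1 : |u n (i + j + 1) - u n (i + j) - (u n (i + 1) - u n i)| / h
        ≤ K * G₁ * (|(j : ℝ)| / R) ^ β := by
      rw [div_le_iff₀ hh]
      refine (gradH n hn hnN i hi j hj).trans_eq (by ring)
    have hjj : h * |(j : ℝ)| ≤ 2 * r₀ * (|(j : ℝ)| / R) ^ β := by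
      calc h * |(j : ℝ)| = h * R * (|(j : ℝ)| / R) := by field_simp
        _ ≤ 2 * r₀ * (|(j : ℝ)| / R) ^ β := by gcongr
    have e2 : |u n (i + j) - u n i| ≤ G₁ * (2 * r₀) * (|(j : ℝ)| / R) ^ β := by
      have := abs_sub_le_of_increment (f := fun k => u n (i + k)) (m := |j|) (G := G₁ * h)
        (fun k hk => by
          rw [← add_assoc]
          have hj' : |j| ≤ R := by exact_mod_cast hj
          exact grad n (by omega) hnN _ ((abs_add_le i k).trans (by omega))) j le_rfl
      simp only [add_zero] at this
      calc _ ≤ G₁ * (h * |(j : ℝ)|) := this.trans_eq (by ring)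
        _ ≤ G₁ * (2 * r₀ * (|(j : ℝ)| / R) ^ β) := by gcongr
        _ = _ := by ring
    have e3 : h * |((i + j : ℤ) : ℝ) - i| ≤ 2 * r₀ * (|(j : ℝ)| / R) ^ β := by
      push_cast
      rwa [add_sub_cancel_left]
    have e4 : h ^ 2 * (lam * |(n : ℝ) - n|) = 0 := by simp
    have e5 : |u n (i + j + 1) - u n (i + j) - (u n (i + 1) - u n i)| / h
        + |u n (i + j) - u n i| + h * |((i + j : ℤ) : ℝ) - i| + h ^ 2 * (lam * |(n : ℝ) - n|)
        ≤ X * (|(j : ℝ)| / R) ^ β := by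
      have : X * (|(j : ℝ)| / R) ^ β = K * G₁ * (|(j : ℝ)| / R) ^ β
          + G₁ * (2 * r₀) * (|(j : ℝ)| / R) ^ β + 2 * r₀ * (|(j : ℝ)| / R) ^ β := by
        rw [hX]; ring
      linarith
    calc _ ≤ H * (X * (|(j : ℝ)| / R) ^ β) ^ α := by gcongr
      _ = H * (X ^ α * (|(j : ℝ)| / R) ^ (β * α)) := by
        rw [Real.mul_rpow hX0.le (by positivity), ← Real.rpow_mul hq0]
      _ = _ := by rw [Real.div_rpow (abs_nonneg _) hR0.le]; ring
  intro n hn hnN i hi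
  have hSG : G₁ ≤ G₁ + 2 * K₂ * G₁ / r₀ := le_add_of_nonneg_right (by positivity)
  refine ⟨(grad n (by omega) hnN i (by omega)).trans (by gcongr), ?_⟩
  have hin : ∀ k : ℤ, |(k : ℝ)| ≤ (R : ℝ) / 2 → |k| ≤ R ∧ |i + k| ≤ 6 * R := fun k hk => by
    have : |(k : ℝ)| ≤ R := by linarith
    have : |k| ≤ R := by exact_mod_cast this
    exact ⟨this, (abs_add_le i k).trans (by omega)⟩
  have := second (fun m k => u (n - N₁ + m) (i + k)) (fun m k => a (n - N₁ + m) (i + k)) N₁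
    lam (R / 2) (G₁ * h) (H * X ^ α / R ^ (β * α)) hlam hlam1 (by positivity)
    (by have := sq_nonneg (R : ℝ); linarith [hN₁]) (by positivity)
    (by
      rw [div_mul_eq_mul_div, div_le_iff₀ (by positivity)]
      gcongr
      linarith)
    (fun m hm k hk => by
      have h1 : |(k : ℝ)| ≤ 2 * R := by linarith
      have h2 : |k| ≤ 2 * R := by exact_mod_cast h1
      rw [← add_assoc]
      exact grad (n - N₁ + m) (by omega) (by omega) _ ((abs_add_le i k).trans (by omega)))
    (fun m hm k hk => by
      obtain ⟨h1, _, h2⟩ := sol.coeff (n - N₁ + m) (by omega) (i + k)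
        (by have := (hin k hk).2; omega)
      exact ⟨h1, h2⟩)
    (fun m hm k j hk hj => by
      have e := coefH (n - N₁ + m) (by omega) (by omega) (i + j) (hin j hj).2 (k - j)
        (by push_cast; have := abs_sub (k : ℝ) j; linarith)
        (by rw [add_assoc, add_sub_cancel]; exact (hin k hk).2)
      rw [add_assoc, add_sub_cancel] at e
      push_cast at e
      exact e)
    (fun m hm k hk => SchemeAt.shift (sol.scheme (n - N₁ + m) (by omega) _
      (by have := (hin k hk).2; omega)))
  rw [lap_shift (fun k => u (n - N₁ + N₁) k), add_zero, Nat.sub_add_cancel (by omega : N₁ ≤ n)]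
    at this
  refine this.trans ?_
  have h1 : K₂ * (G₁ * h) / (R / 2) ≤ 2 * K₂ * G₁ / r₀ * h ^ 2 := by
    rw [div_le_iff₀ (by positivity)]
    have : 2 * K₂ * G₁ / r₀ * h ^ 2 * (R / 2) = K₂ * G₁ * h / r₀ * (h * R) := by ring
    rw [this]
    have h2 : K₂ * G₁ * h / r₀ * r₀ ≤ K₂ * G₁ * h / r₀ * (h * R) := by gcongr
    rw [div_mul_cancel₀ _ hr₀.ne'] at h2
    linarith
  have h2 : 0 ≤ G₁ * h ^ 2 := by positivity
  linarith [add_mul G₁ (2 * K₂ * G₁ / r₀) (h ^ 2)]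

/-- Oscillation over a parabolic cylinder of a solution of the scheme and of its differences, in
terms of its second differences. -/
theorem grid_cylinder_osc {u a : ℕ → ℤ → ℝ} {n₁ n₂ n₀ r : ℕ} {lam C S : ℝ} (hr : 1 ≤ r)
    (hlam : 0 < lam) (hC : 0 ≤ C) (h1 : n₁ ≤ n₀) (h2 : n₀ ≤ n₂)
    (hS : ∀ n, n₁ ≤ n → n ≤ n₂ → ∀ i : ℤ, |i| ≤ 8 * r + 1 → |lap (u n) i| ≤ S)
    (ha : ∀ n, n₁ ≤ n → n < n₂ → ∀ i : ℤ, |i| ≤ 8 * r → |a n i| ≤ C)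
    (hs : ∀ n, n₁ ≤ n → n < n₂ → ∀ i : ℤ, |i| ≤ 8 * r → SchemeAt lam a u n i) :
    ∀ n, n₁ ≤ n → n ≤ n₂ → lam * |(n : ℝ) - n₀| ≤ 10 * r ^ 2 → ∀ i : ℤ, |i| ≤ 8 * r →
      |u n i - u n₀ i| ≤ 10 * C * S * r ^ 2 ∧
      |(u n (i + 1) - u n i) - (u n₀ 1 - u n₀ 0)| ≤ (10 + 20 * C) * S * r := by
  have hS0 : 0 ≤ S := (abs_nonneg _).trans (hS n₀ h1 h2 0 (by simp; omega))
  have hr1 : (1 : ℝ) ≤ r := by exact_mod_cast hr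
  have hr0 : (0 : ℝ) < r := by linarith
  intro n hn1 hn2 hnt
  have time : ∀ i : ℤ, |i| ≤ 8 * r → |u n i - u n₀ i| ≤ 10 * C * S * r ^ 2 := by
    intro i hi
    have := abs_sub_le_of_time_increment (f := fun n => u n i) (n₁ := n₁) (n₂ := n₂)
      (G := lam * (C * S)) (fun n hn hn' => by
        have e := hs n hn hn' i hi
        simp only [SchemeAt] at e
        rw [e, add_sub_cancel_left, mul_assoc, abs_mul, abs_mul, abs_of_pos hlam]
        have i1 := ha n hn hn' i hi
        have i2 := hS n hn hn'.le i (by omega)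
        gcongr) n n₀ hn1 hn2 h1 h2
    refine this.trans ?_
    calc lam * (C * S) * |(n : ℝ) - n₀| = C * S * (lam * |(n : ℝ) - n₀|) := by ring
      _ ≤ C * S * (10 * r ^ 2) := mul_le_mul_of_nonneg_left hnt (by positivity)
      _ = _ := by ring
  intro i hi
  refine ⟨time i hi, ?_⟩
  have space : |(u n (i + 1) - u n i) - (u n 1 - u n 0)| ≤ S * (8 * r) := by
    have := abs_sub_le_of_increment (f := fun i => u n (i + 1) - u n i) (m := 8 * r) (G := S)
      (fun j hj => by
        have e := hS n hn1 hn2 (j + 1) ((abs_add_le j 1).trans (by rw [abs_one]; omega))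
        simp only [lap, add_sub_cancel_right] at e
        convert e using 2
        ring) i hi
    simp only [zero_add] at this
    refine this.trans ?_
    gcongr
    exact_mod_cast hi
  have quad : ∀ n, n₁ ≤ n → n ≤ n₂ → |u n r - u n 0 - (u n 1 - u n 0) * r| ≤ S * r ^ 2 := by
    intro n hn1 hn2
    have hlapl : ∀ i, lap (fun i => u n i - u n 0 - (u n 1 - u n 0) * i) i = lap (u n) i := by
      intro i
      simp only [lap]
      push_cast
      ring
    have := abs_le_of_lap (w := fun i => u n i - u n 0 - (u n 1 - u n 0) * i) (m := 8 * r + 1)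
      (ε := S) (by simp) (by simpa using hS0) (by
        have := hS n hn1 hn2 0 (by simp; omega)
        rw [← hlapl] at this
        simpa [lap] using this) (fun j hj => by rw [hlapl]; exact hS n hn1 hn2 j hj) r
      (by rw [Nat.abs_cast]; omega)
    simpa using this
  have q1 := abs_le.1 (quad n hn1 hn2)
  have q2 := abs_le.1 (quad n₀ h1 h2)
  have t1 := abs_le.1 (time r (by rw [Nat.abs_cast]; omega))
  have t2 := abs_le.1 (time 0 (by simp))
  have centre : |(u n 1 - u n 0) - (u n₀ 1 - u n₀ 0)| ≤ (2 + 20 * C) * S * r := by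
    refine le_of_mul_le_mul_right ?_ hr0
    rw [← abs_of_pos hr0, ← abs_mul, abs_of_pos hr0, abs_le]
    constructor <;> linarith
  have := abs_sub_le (u n (i + 1) - u n i) (u n 1 - u n 0) (u n₀ 1 - u n₀ 0)
  linarith

set_option maxHeartbeats 1000000 in
/-- Interior second order expansion at all scales for solutions of the scheme. -/
theorem grid_interior_expansion {c C M α H r₀ : ℝ} (hc : 0 < c) (hcC : c ≤ C) (hM : 0 ≤ M)
    (hα0 : 0 < α) (hα1 : α ≤ 1) (hH : 0 ≤ H) (hr₀ : 0 < r₀) :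
    ∃ S K ρ₀ : ℝ, 0 < S ∧ 0 < K ∧ 0 < ρ₀ ∧ ρ₀ ≤ 1 ∧
    ∀ (u a : ℕ → ℤ → ℝ) (h lam : ℝ) (R N₁ : ℕ), 0 < h → 0 < lam → lam ≤ 1 → 1 ≤ R →
      r₀ ≤ h * R → h * R ≤ 2 * r₀ → (R : ℝ) ^ 2 ≤ lam * N₁ →
      GridSolution c C M α H h lam R (5 * N₁) u a →
      (∀ n, 3 * N₁ ≤ n → n ≤ 5 * N₁ → ∀ i : ℤ, |i| ≤ 4 * R →
        |u n (i + 1) - u n i| ≤ S * h ∧ |lap (u n) i| ≤ S * h ^ 2) ∧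
      ∀ ρ, h ≤ ρ → ρ ≤ ρ₀ → ∃ c₀ c₁ c₂ : ℝ, ∀ (n : ℕ) (i : ℤ),
        h ^ 2 * (lam * |(n : ℝ) - (4 * N₁ : ℕ)|) ≤ ρ ^ 2 → h * |(i : ℝ)| ≤ ρ →
        |u n i - (c₀ + c₁ * (h * i) + c₂ * ((h * i) ^ 2 / 2
          + a (4 * N₁) 0 * (h ^ 2 * (lam * ((n : ℝ) - (4 * N₁ : ℕ))))))|
        ≤ K * ρ ^ (2 + α / (3 + α)) := by
  obtain ⟨S, hS, reg⟩ := grid_regularity (C := C) hc hM hα0 hα1 hH hr₀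
  have hC : 0 < C := hc.trans_le hcC
  obtain ⟨K₀, hK₀, expan⟩ := grid_expansion hc hC.le
  set σ : ℝ := α / (3 + α) with hσ
  have hσ0 : 0 < σ := by positivity
  have hσ1 : 0 < 1 - σ := by
    have : 1 - σ = 3 / (3 + α) := by rw [hσ]; field_simp; ring
    rw [this]; positivity
  set X : ℝ := (10 + 20 * C) * S + (8 * S + 10 * C * S * r₀) + 8 + 10 * r₀ with hX
  have hX0 : 0 < X := by positivity
  refine ⟨S, K₀ * S * (1 + 8 * (H * X ^ α)), min 1 ((r₀ / 16) ^ (1 - σ)⁻¹), hS, by positivity,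
    lt_min one_pos (by positivity), min_le_left _ _, ?_⟩
  intro u a h lam R N₁ hh hlam hlam1 hR hr1 hr2 hN₁ sol
  have reg' := reg u a h lam R N₁ (5 * N₁) hh hlam hlam1 hR hr1 hr2 hN₁ sol
  refine ⟨reg', ?_⟩
  intro ρ hhρ hρ
  have hρ0 : 0 < ρ := hh.trans_le hhρ
  have hρ1 : ρ ≤ 1 := hρ.trans (min_le_left _ _)
  set w : ℝ := ρ ^ (1 - σ) with hw
  have hw0 : 0 < w := by positivity
  have hρw : ρ ≤ w := Real.self_le_rpow_of_le_one hρ0.le hρ1 (by linarith)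
  have hw16 : 16 * w ≤ r₀ := by
    have h1 := Real.rpow_le_rpow hρ0.le (hρ.trans (min_le_right _ _)) hσ1.le
    rw [← Real.rpow_mul (by positivity), inv_mul_cancel₀ hσ1.ne', Real.rpow_one] at h1
    rw [hw]; linarith
  set r : ℕ := ⌈w / h⌉₊ with hr
  have hrw : w ≤ h * r := by
    have := Nat.le_ceil (w / h)
    rw [div_le_iff₀ hh] at this
    linarith
  have hrw2 : h * r ≤ 2 * w := by
    have := Nat.ceil_lt_add_one (by positivity : 0 ≤ w / h)
    have h2 : h * r ≤ h * (w / h + 1) := by gcongr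
    rw [mul_add, mul_div_cancel₀ _ hh.ne'] at h2
    linarith
  have hr1' : 1 ≤ r := Nat.one_le_iff_ne_zero.2 (by
    rw [hr]; exact (Nat.ceil_pos.2 (by positivity)).ne')
  have hr1r : (1 : ℝ) ≤ r := by exact_mod_cast hr1'
  have hr0 : (0 : ℝ) < r := by linarith
  have h8r : 8 * r ≤ R := by
    have : h * (8 * r) ≤ h * R := by linarith
    have := le_of_mul_le_mul_left this hh
    exact_mod_cast this
  have h8rr : 8 * (r : ℝ) ≤ R := by exact_mod_cast h8r
  have hhr : h * r ≤ r₀ := by linarith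
  set Nr : ℕ := ⌈(r : ℝ) ^ 2 / lam⌉₊ with hNr
  have t1 : (r : ℝ) ^ 2 ≤ lam * Nr := by
    have := Nat.le_ceil ((r : ℝ) ^ 2 / lam)
    rw [div_le_iff₀ hlam] at this
    linarith
  have t2 : lam * Nr ≤ 2 * (r : ℝ) ^ 2 := by
    have := Nat.ceil_lt_add_one (by positivity : 0 ≤ (r : ℝ) ^ 2 / lam)
    have h2 : lam * Nr ≤ lam * ((r : ℝ) ^ 2 / lam + 1) := by gcongr
    rw [mul_add, mul_div_cancel₀ _ hlam.ne'] at h2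
    have := one_le_pow₀ (n := 2) hr1r
    linarith
  have h5 : 5 * Nr ≤ N₁ := by
    have h1 : (8 * (r : ℝ)) ^ 2 ≤ R ^ 2 := pow_le_pow_left₀ (by positivity) h8rr 2
    have : lam * (5 * Nr) ≤ lam * N₁ := by linarith [sq_nonneg (r : ℝ)]
    have := le_of_mul_le_mul_left this hlam
    exact_mod_cast this
  set n₀ := 4 * N₁ with hn₀
  have hwin : ∀ n : ℕ, n₀ - 5 * Nr ≤ n → n ≤ n₀ + Nr → lam * |(n : ℝ) - n₀| ≤ 10 * r ^ 2 := by
    intro n h1 h2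
    have r1 : (n₀ : ℝ) ≤ n + 5 * Nr := by exact_mod_cast (by omega : n₀ ≤ n + 5 * Nr)
    have r2 : (n : ℝ) ≤ n₀ + Nr := by exact_mod_cast h2
    have r3 : |(n : ℝ) - n₀| ≤ 5 * Nr := by
      have : (0 : ℝ) ≤ Nr := by positivity
      rw [abs_le]; constructor <;> linarith
    have : lam * |(n : ℝ) - n₀| ≤ lam * (5 * Nr) := by gcongr
    linarith
  have hcoef : ∀ n, n₀ - 5 * Nr ≤ n → n ≤ n₀ + Nr → ∀ i : ℤ, |i| ≤ 8 * r →
      |a n i - a n₀ 0| ≤ H * (X * (h * r)) ^ α := by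
    intro n hn1 hn2 i hi
    obtain ⟨o1, o2⟩ := grid_cylinder_osc (u := u) (a := a) (n₁ := n₀ - 5 * Nr) (n₂ := n₀ + Nr)
      (n₀ := n₀) (C := C) (S := S * h ^ 2) hr1' hlam hC.le (by omega) (by omega)
      (fun n h1 h2 i hi => (reg' n (by omega) (by omega) i (by omega)).2)
      (fun n h1 h2 i hi => by
        obtain ⟨b1, b2, _⟩ := sol.coeff n (by omega) i (by omega)
        rw [abs_of_nonneg (by linarith)]; exact b2)
      (fun n h1 h2 i hi => sol.scheme n (by omega) i (by omega)) n hn1 hn2 (hwin n hn1 hn2) i hi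
    refine (sol.holder n (by omega) i (by omega) n₀ (by omega) 0 (by simp)).trans ?_
    simp only [zero_add]
    have hi' : |(i : ℝ)| ≤ 8 * r := by exact_mod_cast hi
    have e1 : |u n (i + 1) - u n i - (u n₀ 1 - u n₀ 0)| / h ≤ (10 + 20 * C) * S * (h * r) := by
      rw [div_le_iff₀ hh]
      linarith
    have e2 : |u n i - u n₀ 0| ≤ (8 * S + 10 * C * S * r₀) * (h * r) := by
      have s1 := abs_sub_le_of_increment (f := fun i => u n₀ i) (m := 8 * r) (G := S * h)
        (fun j hj => (reg' n₀ (by omega) (by omega) j (by omega)).1) i hi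
      have s2 : S * h * |(i : ℝ)| ≤ S * h * (8 * r) := by gcongr
      have s3 := abs_sub_le (u n i) (u n₀ i) (u n₀ 0)
      have s4 : 10 * C * S * (h * r) * (h * r) ≤ 10 * C * S * (h * r) * r₀ := by gcongr
      linarith
    have e3 : h * |(i : ℝ) - (0 : ℤ)| ≤ 8 * (h * r) := by
      push_cast
      rw [sub_zero]
      have : h * |(i : ℝ)| ≤ h * (8 * r) := by gcongr
      linarith
    have e4 : h ^ 2 * (lam * |(n : ℝ) - n₀|) ≤ 10 * r₀ * (h * r) := by
      calc _ ≤ h ^ 2 * (10 * r ^ 2) := mul_le_mul_of_nonneg_left (hwin n hn1 hn2) (by positivity)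
        _ = 10 * (h * r) * (h * r) := by ring
        _ ≤ 10 * r₀ * (h * r) := by gcongr
    have e5 : X * (h * r) = (10 + 20 * C) * S * (h * r) + (8 * S + 10 * C * S * r₀) * (h * r)
        + 8 * (h * r) + 10 * r₀ * (h * r) := by rw [hX]; ring
    rw [e5]
    gcongr
  obtain ⟨c₀, c₁, c₂, hexp⟩ := expan (fun m k => u (n₀ - 5 * Nr + m) k)
    (fun m k => a (n₀ - 5 * Nr + m) k) r Nr lam (S * h ^ 2) (H * (X * (h * r)) ^ α) (a n₀ 0) (ρ / h)
    hr1' hlam (sol.coeff n₀ (by omega) 0 (by simp)).1 (sol.coeff n₀ (by omega) 0 (by simp)).2.1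
    (sol.coeff n₀ (by omega) 0 (by simp)).2.2 t1 t2 (by positivity)
    (by rw [div_le_iff₀ hh]; linarith)
    (fun n hn i hi => (reg' (n₀ - 5 * Nr + n) (by omega) (by omega) i (by omega)).2)
    (fun n hn i hi => by
      refine ⟨?_, hcoef _ (by omega) (by omega) i hi⟩
      obtain ⟨b1, b2, _⟩ := sol.coeff (n₀ - 5 * Nr + n) (by omega) i (by omega)
      rw [abs_of_nonneg (by linarith)]; exact b2)
    (fun n hn i hi => sol.scheme (n₀ - 5 * Nr + n) (by omega) i (by omega))
  refine ⟨c₀, c₁ / h, c₂ / h ^ 2, ?_⟩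
  intro n i hn hi
  have hni : lam * |(n : ℝ) - n₀| ≤ (ρ / h) ^ 2 := by
    rw [div_pow, le_div_iff₀ (by positivity)]
    linarith
  have hρr : (ρ / h) ^ 2 ≤ r ^ 2 := by
    refine pow_le_pow_left₀ (by positivity) ?_ 2
    rw [div_le_iff₀ hh]; linarith
  have hnr := abs_le.1 (le_of_mul_le_mul_left ((hni.trans hρr).trans t1) hlam)
  have m1 : n₀ ≤ n + Nr := by
    have : (n₀ : ℝ) ≤ n + Nr := by linarith
    exact_mod_cast this
  have m2 : n ≤ n₀ + Nr := by
    have : (n : ℝ) ≤ n₀ + Nr := by linarith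
    exact_mod_cast this
  have hcast : ((n - (n₀ - 5 * Nr) : ℕ) : ℝ) - (5 * Nr : ℕ) = (n : ℝ) - n₀ := by
    have : n - (n₀ - 5 * Nr) + n₀ = n + 5 * Nr := by omega
    have : ((n - (n₀ - 5 * Nr) : ℕ) : ℝ) + n₀ = n + (5 * Nr : ℕ) := by exact_mod_cast this
    linarith
  have := hexp (n - (n₀ - 5 * Nr)) (by omega) (by rw [hcast]; exact hni) i
    (by rw [le_div_iff₀ hh]; linarith)
  rw [hcast, (by omega : n₀ - 5 * Nr + (n - (n₀ - 5 * Nr)) = n)] at this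
  have e1 : c₁ / h * (h * i) = c₁ * i := by field_simp
  have e2 : c₂ / h ^ 2 * ((h * i) ^ 2 / 2 + a n₀ 0 * (h ^ 2 * (lam * ((n : ℝ) - n₀))))
      = c₂ * ((i : ℝ) ^ 2 / 2 + a n₀ 0 * (lam * ((n : ℝ) - n₀))) := by field_simp
  rw [e1, e2]
  refine this.trans ?_
  have f1 : h ^ 2 * ((ρ / h) ^ 3 / r) ≤ ρ ^ (2 + σ) := by
    have : h ^ 2 * ((ρ / h) ^ 3 / r) = ρ ^ 3 / (h * r) := by field_simp
    rw [this, div_le_iff₀ (by positivity)]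
    calc ρ ^ 3 = ρ ^ (2 + σ) * w := by
          rw [hw, ← Real.rpow_add hρ0, ← Real.rpow_natCast]
          congr 1; push_cast; ring
      _ ≤ _ := by gcongr
  have f2 : (h * r) ^ (2 + α) ≤ 8 * ρ ^ (2 + σ) := by
    calc (h * r) ^ (2 + α) ≤ (2 * w) ^ (2 + α) := by gcongr
      _ = 2 ^ (2 + α) * w ^ (2 + α) := Real.mul_rpow (by norm_num) hw0.le
      _ ≤ 2 ^ (3 : ℝ) * w ^ (2 + α) := by
        gcongr
        · norm_num
        · linarith
      _ = 8 * ρ ^ (2 + σ) := by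
        rw [hw, ← Real.rpow_mul hρ0.le]
        congr 1
        · norm_num
        · congr 1
          rw [hσ]; field_simp; ring
  have f3 : h ^ 2 * (H * (X * (h * r)) ^ α * r ^ 2) = H * X ^ α * (h * r) ^ (2 + α) := by
    rw [Real.mul_rpow hX0.le (by positivity), Real.rpow_add (by positivity), Real.rpow_two]
    ring
  calc K₀ * (S * h ^ 2) * ((ρ / h) ^ 3 / r + H * (X * (h * r)) ^ α * r ^ 2)
      = K₀ * S * (h ^ 2 * ((ρ / h) ^ 3 / r) + h ^ 2 * (H * (X * (h * r)) ^ α * r ^ 2)) := by ring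
    _ ≤ K₀ * S * (ρ ^ (2 + σ) + H * X ^ α * (8 * ρ ^ (2 + σ))) := by rw [f3]; gcongr
    _ = _ := by ring

theorem quad_coeff_bound {A b c d B : ℝ} (hd : 0 < d) (h0 : |A| ≤ B)
    (h1 : |A + b * d + c * (d ^ 2 / 2)| ≤ B) (h2 : |A + b * (-d) + c * (d ^ 2 / 2)| ≤ B) :
    |b| * d ≤ B ∧ |c| * d ^ 2 ≤ 4 * B := by
  rw [abs_le] at h0 h1 h2
  have e1 : |b| * d = |b * d| := by rw [abs_mul, abs_of_pos hd]
  have e2 : |c| * d ^ 2 = |c * d ^ 2| := by rw [abs_mul, abs_of_pos (pow_pos hd 2)]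
  rw [e1, e2, abs_le, abs_le]
  refine ⟨⟨?_, ?_⟩, ?_, ?_⟩ <;> linarith

theorem hasDerivAt_of_abs_le_rpow {f : ℝ → ℝ} {L x K δ σ : ℝ} (hσ : 0 < σ) (hδ : 0 < δ)
    (h : ∀ y, |y - x| ≤ δ → |f y - f x - L * (y - x)| ≤ K * |y - x| ^ (1 + σ)) :
    HasDerivAt f L x := by
  rw [hasDerivAt_iff_isLittleO]
  have h1 : (fun y => f y - f x - (y - x) • L) =O[𝓝 x] fun y => |y - x| ^ (1 + σ) := by
    refine Asymptotics.IsBigO.of_bound K ?_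
    filter_upwards [Metric.closedBall_mem_nhds x hδ] with y hy
    rw [Metric.mem_closedBall, Real.dist_eq] at hy
    rw [Real.norm_eq_abs, Real.norm_eq_abs, abs_of_nonneg (Real.rpow_nonneg (abs_nonneg _) _),
      smul_eq_mul, mul_comm (y - x)]
    exact h y hy
  refine h1.trans_isLittleO ?_
  rw [← Asymptotics.isLittleO_abs_right]
  have h2 : ∀ y, |y - x| ^ (1 + σ) = |y - x| ^ σ * |y - x| := fun y => by
    rw [add_comm, Real.rpow_add_one' (abs_nonneg _) (by linarith)]
  simp only [h2]
  have h3 : Tendsto (fun y => |y - x| ^ σ) (𝓝 x) (𝓝 0) := by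
    have : Tendsto (fun y : ℝ => |y - x|) (𝓝 x) (𝓝 0) := by
      have : Continuous fun y : ℝ => |y - x| := by fun_prop
      simpa using this.tendsto x
    simpa [Real.zero_rpow hσ.ne'] using this.rpow_const (Or.inr hσ.le)
  simpa using (Asymptotics.isLittleO_one_iff ℝ |>.2 h3).mul_isBigO
    (Asymptotics.isBigO_refl (fun y => |y - x|) (𝓝 x))

/-- The function `U` has a second order parabolic expansion at `(x, t)` at all scales up to `ρ₀`,
with first order coefficient `v` and second order coefficient `s`. -/
def ParabolicExpansion (U : ℝ → ℝ → ℝ) (σ K ρ₀ a₀ v s x t : ℝ) : Prop :=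
  ∀ ρ, 0 < ρ → ρ ≤ ρ₀ → ∀ y τ, |y - x| ≤ ρ → |τ - t| ≤ ρ ^ 2 →
    |U y τ - (U x t + v * (y - x) + s * ((y - x) ^ 2 / 2 + a₀ * (τ - t)))| ≤ K * ρ ^ (2 + σ)

namespace ParabolicExpansion

variable {U : ℝ → ℝ → ℝ} {σ K ρ₀ a₀ v s x t : ℝ}

theorem coeff_bound (h : ParabolicExpansion U σ K ρ₀ a₀ v s x t) (hρ₀ : 0 < ρ₀) {M : ℝ}
    (hM : ∀ y, |y - x| ≤ ρ₀ → |U y t| ≤ M) :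
    |v| * ρ₀ ≤ M + K * ρ₀ ^ (2 + σ) ∧ |s| * ρ₀ ^ 2 ≤ 4 * (M + K * ρ₀ ^ (2 + σ)) := by
  have key : ∀ y, |y - x| ≤ ρ₀ →
      |U x t + v * (y - x) + s * ((y - x) ^ 2 / 2)| ≤ M + K * ρ₀ ^ (2 + σ) := by
    intro y hy
    have h1 := abs_le.1 (h ρ₀ hρ₀ le_rfl y t hy (by simpa using sq_nonneg ρ₀))
    have h2 := abs_le.1 (hM y hy)
    simp only [sub_self, mul_zero, add_zero] at h1
    rw [abs_le]
    constructor <;> linarith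
  refine quad_coeff_bound (A := U x t) hρ₀ ?_ ?_ ?_
  · simpa using key x (by simpa using hρ₀.le)
  · simpa using key (x + ρ₀) (by simp [abs_of_pos hρ₀])
  · simpa using key (x - ρ₀) (by simp [abs_of_pos hρ₀])

theorem compare (hK : 0 ≤ K) (hσ1 : σ ≤ 1)
    (h : ParabolicExpansion U σ K ρ₀ a₀ v s x t)
    {a₁ v₁ s₁ y τ ρ : ℝ} (h₁ : ParabolicExpansion U σ K ρ₀ a₁ v₁ s₁ y τ) (hρ : 0 < ρ)
    (hρρ : 2 * ρ ≤ ρ₀) (hy : |y - x| ≤ ρ) (hτ : |τ - t| ≤ ρ ^ 2) :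
    |v₁ - v - s * (y - x)| ≤ 9 * K * ρ ^ (1 + σ) ∧ |s₁ - s| ≤ 36 * K * ρ ^ σ := by
  have hp : (2 * ρ) ^ (2 + σ) ≤ 8 * ρ ^ (2 + σ) := by
    rw [Real.mul_rpow (by norm_num) hρ.le]
    gcongr
    calc (2 : ℝ) ^ (2 + σ) ≤ 2 ^ (3 : ℝ) := Real.rpow_le_rpow_of_exponent_le (by norm_num)
          (by linarith)
      _ = 8 := by norm_num
  have hKp : K * (2 * ρ) ^ (2 + σ) ≤ K * (8 * ρ ^ (2 + σ)) := by gcongr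
  set A : ℝ := U x t + v * (y - x) + s * ((y - x) ^ 2 / 2 + a₀ * (τ - t)) - U y τ with hA
  have key : ∀ d, |d| ≤ ρ →
      |A + (v + s * (y - x) - v₁) * d + (s - s₁) * (d ^ 2 / 2)| ≤ 9 * K * ρ ^ (2 + σ) := by
    intro d hd
    have e1 := abs_le.1 (h (2 * ρ) (by positivity) hρρ (y + d) τ
      (by rw [add_sub_right_comm]; exact (abs_add_le _ _).trans (by linarith))
      (hτ.trans (by nlinarith [sq_nonneg ρ])))
    have e2 := abs_le.1 (h₁ ρ hρ (by linarith) (y + d) τ (by simpa using hd)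
      (by simpa using sq_nonneg ρ))
    rw [abs_le, hA]
    constructor <;> linarith
  have q := quad_coeff_bound (A := A) (b := v + s * (y - x) - v₁) (c := s - s₁) hρ
    (by simpa using key 0 (by simpa using hρ.le)) (key ρ (abs_of_pos hρ).le)
    (by have := key (-ρ) (by rw [abs_neg, abs_of_pos hρ]); rwa [neg_sq] at this)
  constructor
  · have e : ρ ^ (2 + σ) = ρ ^ (1 + σ) * ρ := by
      rw [← Real.rpow_add_one hρ.ne']; congr 1; ring
    have e' : v₁ - v - s * (y - x) = -(v + s * (y - x) - v₁) := by ring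
    rw [e', abs_neg]
    refine le_of_mul_le_mul_right ?_ hρ
    have q1 := q.1
    rw [e] at q1
    linarith
  · have e : ρ ^ (2 + σ) = ρ ^ σ * ρ ^ 2 := by
      rw [← Real.rpow_two, ← Real.rpow_add hρ]; congr 1; ring
    rw [abs_sub_comm]
    refine le_of_mul_le_mul_right ?_ (pow_pos hρ 2)
    have q2 := q.2
    rw [e] at q2
    linarith

theorem hasDerivAt_space (h : ParabolicExpansion U σ K ρ₀ a₀ v s x t) (hρ₀ : 0 < ρ₀)
    (hK : 0 ≤ K) (hσ0 : 0 < σ) : HasDerivAt (fun y => U y t) v x := by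
  refine hasDerivAt_of_abs_le_rpow (K := |s| + K) (σ := 1) one_pos (lt_min hρ₀ one_pos) ?_
  intro y hy
  rcases (abs_nonneg (y - x)).eq_or_lt with h0 | h0
  · have : y = x := by linarith [abs_eq_zero.1 h0.symm]
    subst this
    simp
  have e := abs_le.1 (h |y - x| h0 (hy.trans (min_le_left _ _)) y t le_rfl
    (by simpa using sq_nonneg (y - x)))
  have e1 : |y - x| ^ (2 + σ) ≤ |y - x| ^ (2 : ℝ) :=
    Real.rpow_le_rpow_of_exponent_ge h0 (hy.trans (min_le_right _ _)) (by linarith)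
  have e2 : K * |y - x| ^ (2 + σ) ≤ K * |y - x| ^ (2 : ℝ) := by gcongr
  rw [Real.rpow_two, sq_abs] at e2
  norm_num
  simp only [sub_self, mul_zero, add_zero] at e
  have s1 := mul_le_mul_of_nonneg_right (le_abs_self s) (sq_nonneg (y - x))
  have s2 := mul_le_mul_of_nonneg_right (neg_abs_le s) (sq_nonneg (y - x))
  have s3 : 0 ≤ |s| * (y - x) ^ 2 := by positivity
  rw [abs_le]
  constructor <;> linarith

theorem hasDerivAt_time (h : ParabolicExpansion U σ K ρ₀ a₀ v s x t) (hρ₀ : 0 < ρ₀)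
    (hσ0 : 0 < σ) : HasDerivAt (fun τ => U x τ) (a₀ * s) t := by
  refine hasDerivAt_of_abs_le_rpow (K := K) (σ := σ / 2) (by positivity) (pow_pos hρ₀ 2) ?_
  intro τ hτ
  rcases (abs_nonneg (τ - t)).eq_or_lt with h0 | h0
  · have : τ = t := by linarith [abs_eq_zero.1 h0.symm]
    subst this
    simp [Real.zero_rpow (by positivity : 1 + σ / 2 ≠ 0)]
  have e := h √|τ - t| (Real.sqrt_pos.2 h0) (Real.sqrt_le_iff.2 ⟨hρ₀.le, hτ⟩) x τ (by simp)
    (by rw [Real.sq_sqrt h0.le])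
  have e1 : √|τ - t| ^ (2 + σ) = |τ - t| ^ (1 + σ / 2) := by
    rw [Real.sqrt_eq_rpow, ← Real.rpow_mul h0.le]; congr 1; ring
  rw [e1] at e
  convert e using 2
  simp only [sub_self]
  ring

end ParabolicExpansion

/-- The coefficients of the expansions at dyadic scales converge. -/
theorem exists_parabolicExpansion {K C σ : ℝ} (hK : 0 < K) (hC : 0 ≤ C) (hσ0 : 0 < σ)
    (hσ1 : σ ≤ 1) : ∃ K' : ℝ, 0 < K' ∧ ∀ (U : ℝ → ℝ → ℝ) (ρ₀ a₀ x t : ℝ), 0 < ρ₀ → |a₀| ≤ C →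
      (∀ ρ, 0 < ρ → ρ ≤ ρ₀ → ∃ c₀ c₁ c₂ : ℝ, ∀ y τ, |y - x| ≤ ρ → |τ - t| ≤ ρ ^ 2 →
        |U y τ - (c₀ + c₁ * (y - x) + c₂ * ((y - x) ^ 2 / 2 + a₀ * (τ - t)))|
          ≤ K * ρ ^ (2 + σ)) →
      ∃ v s, ParabolicExpansion U σ K' ρ₀ a₀ v s x t := by
  set q : ℝ := (1 / 2) ^ σ with hq
  have hq0 : 0 < q := by positivity
  have hq1 : q < 1 := Real.rpow_lt_one (by norm_num) (by norm_num) hσ0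
  have hq1' : 0 < 1 - q := by linarith
  set E : ℝ := 32 * K / (1 - q) with hE
  have hE0 : 0 < E := by positivity
  refine ⟨8 * (2 * K + E + E * (1 + C)), by positivity, ?_⟩
  intro U ρ₀ a₀ x t hρ₀ ha₀ hw
  set r : ℕ → ℝ := fun j => ρ₀ * (1 / 2) ^ j with hr
  have hr0 : ∀ j, 0 < r j := fun j => by positivity
  have hrle : ∀ j, r j ≤ ρ₀ := fun j => mul_le_of_le_one_right hρ₀.le
    (pow_le_one₀ (by norm_num) (by norm_num))
  have hrs : ∀ j, r (j + 1) = r j / 2 := fun j => by simp only [hr, pow_succ]; ring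
  have hrσ : ∀ j, r j ^ σ = ρ₀ ^ σ * q ^ j := fun j => by
    simp only [hr, hq]
    rw [Real.mul_rpow hρ₀.le (by positivity), ← Real.rpow_natCast, ← Real.rpow_natCast,
      ← Real.rpow_mul (by norm_num), ← Real.rpow_mul (by norm_num), mul_comm σ]
  choose c₀ c₁ c₂ hc using fun j => hw (r j) (hr0 j) (hrle j)
  have hmono : ∀ j, K * r (j + 1) ^ (2 + σ) ≤ K * r j ^ (2 + σ) := fun j => by
    have := hr0 j
    have : r (j + 1) ≤ r j := by rw [hrs]; linarith
    have := hr0 (j + 1)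
    gcongr
  have hdiff : ∀ j, |c₁ j - c₁ (j + 1)| ≤ 4 * K * r j ^ (1 + σ) ∧
      |c₂ j - c₂ (j + 1)| ≤ 32 * K * r j ^ σ := by
    intro j
    have hj := hr0 j
    have key : ∀ d, |d| ≤ r (j + 1) → |c₀ j - c₀ (j + 1) + (c₁ j - c₁ (j + 1)) * d
        + (c₂ j - c₂ (j + 1)) * (d ^ 2 / 2)| ≤ 2 * (K * r j ^ (2 + σ)) := by
      intro d hd
      have e1 := abs_le.1 (hc j (x + d) t (by simpa using hd.trans (by rw [hrs]; linarith))
        (by simpa using sq_nonneg (r j)))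
      have e2 := abs_le.1 (hc (j + 1) (x + d) t (by simpa using hd)
        (by simpa using sq_nonneg (r (j + 1))))
      have := hmono j
      simp only [sub_self, mul_zero, add_zero, add_sub_cancel_left] at e1 e2
      rw [abs_le]
      constructor <;> linarith
    have hd := hr0 (j + 1)
    have qb := quad_coeff_bound hd (by simpa using key 0 (by simpa using hd.le))
      (key _ (abs_of_pos hd).le)
      (by have := key (-r (j + 1)) (by rw [abs_neg, abs_of_pos hd]); rwa [neg_sq] at this)
    rw [hrs] at qb
    constructor
    · have e : r j ^ (2 + σ) = r j ^ (1 + σ) * r j := by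
        rw [← Real.rpow_add_one hj.ne']; congr 1; ring
      refine le_of_mul_le_mul_right ?_ hj
      have q1 := qb.1
      rw [e] at q1
      linarith
    · have e : r j ^ (2 + σ) = r j ^ σ * r j ^ 2 := by
        rw [← Real.rpow_two, ← Real.rpow_add hj]; congr 1; ring
      refine le_of_mul_le_mul_right ?_ (pow_pos hj 2)
      have q2 := qb.2
      rw [e] at q2
      linarith
  have tail : ∀ (j : ℕ) (f : ℕ → ℝ) (l B : ℝ), Tendsto f atTop (𝓝 l) → 0 ≤ B →
      (∀ k, j ≤ k → |f k - f (k + 1)| ≤ B * r k ^ σ) → |f j - l| ≤ B * r j ^ σ / (1 - q) := by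
    intro j f l B hf hB hd
    have := dist_le_of_le_geometric_of_tendsto₀ (r := q) (C := B * r j ^ σ) hq1
      (f := fun k => f (j + k)) (fun k => by
        rw [Real.dist_eq]
        refine (hd (j + k) (by omega)).trans_eq ?_
        rw [hrσ, hrσ, pow_add]; ring) ((tendsto_add_atTop_iff_nat j).2 hf |>.congr fun k => by
          rw [add_comm])
    rwa [Real.dist_eq] at this
  have conv : ∀ (f : ℕ → ℝ) (B : ℝ), 
      (∀ k, |f k - f (k + 1)| ≤ B * r k ^ σ) → ∃ l, Tendsto f atTop (𝓝 l) := by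
    intro f B hd
    refine cauchySeq_tendsto_of_complete (cauchySeq_of_le_geometric q (B * ρ₀ ^ σ) hq1 fun k => ?_)
    rw [Real.dist_eq]
    refine (hd k).trans_eq ?_
    rw [hrσ]; ring
  have hd1 : ∀ j k, j ≤ k → |c₁ k - c₁ (k + 1)| ≤ 32 * K * r j * r k ^ σ := by
    intro j k hjk
    refine (hdiff k).1.trans ?_
    have hk := hr0 k
    have hle : r k ≤ r j := by
      simp only [hr]
      exact mul_le_mul_of_nonneg_left (pow_le_pow_of_le_one (by norm_num) (by norm_num) hjk) hρ₀.le
    rw [Real.rpow_add hk, Real.rpow_one, ← mul_assoc]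
    gcongr
    norm_num
  obtain ⟨v, hv⟩ := conv c₁ (32 * K * r 0) (fun k => hd1 0 k (by omega))
  obtain ⟨s, hs⟩ := conv c₂ (32 * K) (fun k => (hdiff k).2)
  have hvt : ∀ j, |c₁ j - v| ≤ E * r j ^ (1 + σ) := fun j => by
    have hj := hr0 j
    refine (tail j c₁ v (32 * K * r j) hv (by positivity) (hd1 j)).trans_eq ?_
    rw [Real.rpow_add hj, Real.rpow_one, hE]; ring
  have hst : ∀ j, |c₂ j - s| ≤ E * r j ^ σ := fun j => by
    refine (tail j c₂ s (32 * K) hs (by positivity) (fun k _ => (hdiff k).2)).trans_eq ?_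
    rw [hE]; ring
  refine ⟨v, s, ?_⟩
  intro ρ hρ hρρ y τ hy hτ
  obtain ⟨j, hj1, hj2⟩ : ∃ j, r (j + 1) < ρ ∧ ρ ≤ r j := by
    have hlim : ∃ j, r j < ρ := by
      obtain ⟨j, hj⟩ := exists_pow_lt_of_lt_one (div_pos hρ hρ₀) (by norm_num : (1 / 2 : ℝ) < 1)
      refine ⟨j, ?_⟩
      rw [lt_div_iff₀ hρ₀] at hj
      simp only [hr]; linarith
    classical
    have hfind := Nat.find_spec hlim
    have hne : Nat.find hlim ≠ 0 := by
      intro h0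
      rw [h0] at hfind
      simp only [hr, pow_zero, mul_one] at hfind
      linarith
    obtain ⟨j, hj⟩ := Nat.exists_eq_succ_of_ne_zero hne
    refine ⟨j, by rwa [hj] at hfind, not_lt.1 (Nat.find_min hlim (by omega : j < _))⟩
  have hj := hr0 j
  rw [hrs] at hj1
  have hyj := hy.trans hj2
  have hτj : |τ - t| ≤ r j ^ 2 := hτ.trans (pow_le_pow_left₀ hρ.le hj2 2)
  have e1 := abs_le.1 (hc j y τ hyj hτj)
  have e0 := abs_le.1 (hc j x t (by simpa using hj.le) (by simpa using sq_nonneg (r j)))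
  simp only [sub_self, mul_zero, add_zero, ne_eq, OfNat.ofNat_ne_zero, not_false_eq_true, zero_pow,
    zero_div] at e0
  have p1 : r j ^ (2 + σ) = r j ^ (1 + σ) * r j := by
    rw [← Real.rpow_add_one hj.ne']; congr 1; ring
  have p2 : r j ^ (2 + σ) = r j ^ σ * r j ^ 2 := by
    rw [← Real.rpow_two, ← Real.rpow_add hj]; congr 1; ring
  have f1 : |(c₁ j - v) * (y - x)| ≤ E * r j ^ (2 + σ) := by
    rw [abs_mul, p1, ← mul_assoc]
    have := hvt j
    gcongr
  have f2 : |(c₂ j - s) * ((y - x) ^ 2 / 2 + a₀ * (τ - t))| ≤ E * (1 + C) * r j ^ (2 + σ) := by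
    have g : |(y - x) ^ 2 / 2 + a₀ * (τ - t)| ≤ (1 + C) * r j ^ 2 := by
      have g1 : |(y - x) ^ 2 / 2| ≤ r j ^ 2 := by
        rw [abs_of_nonneg (by positivity), ← sq_abs]
        have := pow_le_pow_left₀ (abs_nonneg _) hyj 2
        have := sq_nonneg |y - x|
        linarith
      have g2 : |a₀ * (τ - t)| ≤ C * r j ^ 2 := by rw [abs_mul]; gcongr
      have := abs_add_le ((y - x) ^ 2 / 2) (a₀ * (τ - t))
      linarith
    rw [abs_mul, p2]
    have := hst j
    calc _ ≤ E * r j ^ σ * ((1 + C) * r j ^ 2) := by gcongr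
      _ = _ := by ring
  have f3 : r j ^ (2 + σ) ≤ 8 * ρ ^ (2 + σ) := by
    calc r j ^ (2 + σ) ≤ (2 * ρ) ^ (2 + σ) := by gcongr; linarith
      _ = 2 ^ (2 + σ) * ρ ^ (2 + σ) := Real.mul_rpow (by norm_num) hρ.le
      _ ≤ 2 ^ (3 : ℝ) * ρ ^ (2 + σ) := by
        gcongr
        · norm_num
        · linarith
      _ = _ := by norm_num
  have f4 : (2 * K + E + E * (1 + C)) * r j ^ (2 + σ)
      ≤ (2 * K + E + E * (1 + C)) * (8 * ρ ^ (2 + σ)) := by gcongr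
  rw [abs_le] at f1 f2 ⊢
  constructor <;> linarith

/-- Comparison with a discrete supersolution on a strip. -/
theorem grid_comparison {u ψ a : ℕ → ℤ → ℝ} {m N : ℕ} {lam : ℝ}
    (h0 : ∀ i : ℤ, 0 ≤ i → i ≤ m → u 0 i ≤ ψ 0 i)
    (hl : ∀ n ≤ N, u n 0 ≤ ψ n 0) (hr : ∀ n ≤ N, u n m ≤ ψ n m)
    (ha : ∀ n < N, ∀ i : ℤ, 0 < i → i < m → 0 ≤ lam * a n i ∧ lam * a n i ≤ 1 / 2)
    (hs : ∀ n < N, ∀ i : ℤ, 0 < i → i < m → SchemeAt lam a u n i)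
    (hψ : ∀ n < N, ∀ i : ℤ, 0 < i → i < m →
      ψ n i + lam * a n i * lap (ψ n) i ≤ ψ (n + 1) i) :
    ∀ n ≤ N, ∀ i : ℤ, 0 ≤ i → i ≤ m → u n i ≤ ψ n i := by
  intro n hn i hi0 him
  have := grid_max_principle (N := N) (B := fun i _ => 0 ≤ i ∧ i ≤ m)
    (Z := fun n i _ => u n i - ψ n i) (fun i _ hi => by linarith [h0 i hi.1 hi.2])
    (fun n hn i j hi => by
      rcases hi.1.eq_or_lt with h | h
      · left; subst h; linarith [hl (n + 1) hn]
      rcases hi.2.eq_or_lt with h' | h'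
      · left; subst h'; linarith [hr (n + 1) hn]
      right
      refine ⟨⟨by omega, by omega⟩, ⟨by omega, by omega⟩, hi, hi, lam * a n i, 0,
        (ha n hn i h h').1, le_rfl, by linarith [(ha n hn i h h').2], ?_⟩
      have e1 := hs n hn i h h'
      have e2 := hψ n hn i h h'
      simp only [SchemeAt, lap] at e1 e2 ⊢
      linarith) n hn i 0 ⟨hi0, him⟩
  linarith

/-- Solutions of the scheme on a strip of `m` cells. -/
structure StripSolution (c C lam : ℝ) (m : ℕ) (u a : ℕ → ℤ → ℝ) : Prop where
  coeff : ∀ n i, c ≤ a n i ∧ a n i ≤ C ∧ lam * a n i ≤ 1 / 8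
  scheme : ∀ n, ∀ i : ℤ, 0 < i → i < m → SchemeAt lam a u n i

namespace StripSolution

variable {c C lam h : ℝ} {m : ℕ} {u a : ℕ → ℤ → ℝ}

theorem neg (hsol : StripSolution c C lam m u a) :
    StripSolution c C lam m (fun n i => -u n i) a := by
  refine ⟨hsol.coeff, fun n i h1 h2 => ?_⟩
  have := hsol.scheme n i h1 h2
  simp only [SchemeAt, lap] at this ⊢
  rw [this]; ring

theorem reflect (hsol : StripSolution c C lam m u a) :
    StripSolution c C lam m (fun n i => u n (m - i)) (fun n i => a n (m - i)) := by
  refine ⟨fun n i => hsol.coeff n _, fun n i h1 h2 => ?_⟩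
  have := hsol.scheme n (m - i) (by omega) (by omega)
  simp only [SchemeAt, lap] at this ⊢
  have e1 : (m : ℤ) - (i + 1) = m - i - 1 := by ring
  have e2 : (m : ℤ) - (i - 1) = m - i + 1 := by ring
  rw [e1, e2, this]; ring

theorem le_of_data (hsol : StripSolution c C lam m u a) (hc : 0 < c) (hlam : 0 < lam) {M : ℝ}
    (h0 : ∀ i : ℤ, 0 ≤ i → i ≤ m → u 0 i ≤ M) (hl : ∀ n, u n 0 ≤ M) (hr : ∀ n, u n m ≤ M) :
    ∀ n, ∀ i : ℤ, 0 ≤ i → i ≤ m → u n i ≤ M := fun n =>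
  grid_comparison (ψ := fun _ _ => M) (a := a) (N := n) h0 (fun n _ => hl n) (fun n _ => hr n)
    (fun n _ i _ _ => by
      obtain ⟨h1, _, h2⟩ := hsol.coeff n i
      exact ⟨mul_nonneg hlam.le (by linarith), by linarith⟩)
    (fun n _ i h1 h2 => hsol.scheme n i h1 h2) (fun n _ i _ _ => by simp [lap]; linarith) n le_rfl

theorem abs_le_of_data (hsol : StripSolution c C lam m u a) (hc : 0 < c) (hlam : 0 < lam) {M : ℝ}
    (h0 : ∀ i : ℤ, 0 ≤ i → i ≤ m → |u 0 i| ≤ M) (hl : ∀ n, |u n 0| ≤ M) (hr : ∀ n, |u n m| ≤ M) :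
    ∀ n, ∀ i : ℤ, 0 ≤ i → i ≤ m → |u n i| ≤ M := fun n i h1 h2 => by
  rw [abs_le]
  refine ⟨?_, hsol.le_of_data hc hlam (fun i h1 h2 => (abs_le.1 (h0 i h1 h2)).2)
    (fun n => (abs_le.1 (hl n)).2) (fun n => (abs_le.1 (hr n)).2) n i h1 h2⟩
  have := hsol.neg.le_of_data hc hlam (M := M)
    (fun i h1 h2 => by linarith [(abs_le.1 (h0 i h1 h2)).1])
    (fun n => by linarith [(abs_le.1 (hl n)).1]) (fun n => by linarith [(abs_le.1 (hr n)).1])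
    n i h1 h2
  linarith

/-- Barrier at a point of the initial slice. -/
theorem initial_barrier (hsol : StripSolution c C lam m u a) (hc : 0 < c) (hlam : 0 < lam)
    {E B y : ℝ} (hB : 0 ≤ B)
    (h0 : ∀ i : ℤ, 0 ≤ i → i ≤ m → u 0 i ≤ E + B * (h * i - y) ^ 2)
    (hl : ∀ n : ℕ, lam * h ^ 2 * n ≤ 1 → u n 0 ≤ E + B * ((0 - y) ^ 2 + lam * h ^ 2 * n))
    (hr : ∀ n : ℕ, lam * h ^ 2 * n ≤ 1 → u n m ≤ E + B * ((h * m - y) ^ 2 + lam * h ^ 2 * n)) :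
    ∀ n : ℕ, lam * h ^ 2 * n ≤ 1 → ∀ i : ℤ, 0 ≤ i → i ≤ m →
      u n i ≤ E + B * (h * i - y) ^ 2 + B * (1 + 2 * C) * (lam * h ^ 2 * n) := by
  have hC : 0 < C := by
    obtain ⟨h1, h2, _⟩ := hsol.coeff 0 0
    linarith
  intro n hn
  have hle : ∀ k ≤ n, lam * h ^ 2 * k ≤ 1 := fun k hk => by
    have : (k : ℝ) ≤ n := by exact_mod_cast hk
    refine le_trans ?_ hn
    gcongr
  have hK : ∀ k : ℕ, 0 ≤ B * (2 * C) * (lam * h ^ 2 * k) := fun k => by positivity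
  refine grid_comparison (ψ := fun n i => E + B * (h * i - y) ^ 2
    + B * (1 + 2 * C) * (lam * h ^ 2 * n)) (a := a) (N := n)
    (fun i h1 h2 => by simpa using h0 i h1 h2) (fun k hk => ?_) (fun k hk => ?_)
    (fun n _ i _ _ => by
      obtain ⟨h1, _, h2⟩ := hsol.coeff n i
      exact ⟨mul_nonneg hlam.le (by linarith), by linarith⟩)
    (fun n _ i h1 h2 => hsol.scheme n i h1 h2) (fun n _ i _ _ => ?_) n le_rfl
  · have := hl k (hle k hk)
    have := hK k
    push_cast
    rw [mul_zero]
    linarith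
  · have := hr k (hle k hk)
    have := hK k
    push_cast
    linarith
  · have e : lap (fun i : ℤ => E + B * (h * i - y) ^ 2 + B * (1 + 2 * C) * (lam * h ^ 2 * n)) i
        = 2 * B * h ^ 2 := by
      simp only [lap]
      push_cast
      ring
    rw [e]
    push_cast
    have h1 : lam * h ^ 2 * B * a n i ≤ lam * h ^ 2 * B * C :=
      mul_le_mul_of_nonneg_left (hsol.coeff n i).2.1 (by positivity)
    have h2 : 0 ≤ B * (lam * h ^ 2) := by positivity
    linarith

/-- Barrier at a point of the left lateral boundary. -/
theorem lateral_barrier (hsol : StripSolution c C lam m u a) (hc : 0 < c) (hlam : 0 < lam)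
    (hh : 0 < h) {E B t : ℝ} (hB : 0 ≤ B) (ht : 0 ≤ t)
    (h0 : ∀ i : ℤ, 0 ≤ i → i ≤ m → u 0 i ≤ E + B * ((h * i) ^ 2 + t ^ 2))
    (hl : ∀ n : ℕ, u n 0 ≤ E + B * (lam * h ^ 2 * n - t) ^ 2)
    (hr : ∀ n : ℕ, u n m ≤ E + B * ((h * m) ^ 2 + (lam * h ^ 2 * n - t) ^ 2)) :
    ∀ n : ℕ, ∀ i : ℤ, 0 ≤ i → i ≤ m →
      u n i ≤ E + B * (lam * h ^ 2 * n - t) ^ 2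
        + B * (1 + t / c) * (h * i * (2 * (h * m) - h * i)) := by
  set B' := B * (1 + t / c) with hB'
  have hB'B : B ≤ B' := le_mul_of_one_le_right hB (by linarith [div_nonneg ht hc.le])
  have hB'c : B * t ≤ B' * c := by
    have : B' * c = B * c + B * t := by rw [hB']; field_simp
    rw [this]; nlinarith
  have hq : ∀ i : ℤ, 0 ≤ i → i ≤ m →
      B * (h * i) ^ 2 ≤ B' * (h * i * (2 * (h * m) - h * i)) := by
    intro i h1 h2
    have r1 : (0 : ℝ) ≤ i := by exact_mod_cast h1
    have r2 : (i : ℝ) ≤ m := by exact_mod_cast h2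
    have r3 : h * i ≤ h * m := by gcongr
    have r4 : 0 ≤ h * i := by positivity
    refine mul_le_mul hB'B ?_ (by positivity) (by linarith)
    rw [sq]
    exact mul_le_mul_of_nonneg_left (by linarith) r4
  intro n
  refine grid_comparison (ψ := fun n i => E + B * (lam * h ^ 2 * n - t) ^ 2
    + B' * (h * i * (2 * (h * m) - h * i))) (a := a) (N := n)
    (fun i h1 h2 => ?_) (fun k hk => ?_) (fun k hk => ?_)
    (fun n _ i _ _ => by
      obtain ⟨h1, _, h2⟩ := hsol.coeff n i
      exact ⟨mul_nonneg hlam.le (by linarith), by linarith⟩)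
    (fun n _ i h1 h2 => hsol.scheme n i h1 h2) (fun n _ i _ _ => ?_) n le_rfl
  · have := h0 i h1 h2
    have := hq i h1 h2
    simp only [CharP.cast_eq_zero, mul_zero, zero_sub, neg_sq]
    linarith
  · simpa using hl k
  · have h1 := hr k
    have h2 := hq m (by omega) le_rfl
    push_cast at h2 ⊢
    linarith
  · have e : lap (fun i : ℤ => E + B * (lam * h ^ 2 * n - t) ^ 2
        + B' * (h * i * (2 * (h * m) - h * i))) i = -(2 * B' * h ^ 2) := by
      simp only [lap]
      push_cast
      ring
    rw [e]
    push_cast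
    have hp : 0 ≤ lam * h ^ 2 := by positivity
    have h1 : lam * h ^ 2 * (B' * c) ≤ lam * h ^ 2 * (B' * a n i) :=
      mul_le_mul_of_nonneg_left (mul_le_mul_of_nonneg_left (hsol.coeff n i).1 (by linarith)) hp
    have h2 : lam * h ^ 2 * (B * t) ≤ lam * h ^ 2 * (B' * c) := mul_le_mul_of_nonneg_left hB'c hp
    have h3 : 0 ≤ B * (lam * h ^ 2) * (2 * (lam * h ^ 2 * n) + lam * h ^ 2) := by positivity
    linarith

end StripSolution

theorem exists_quadratic_modulus {g : ℝ → ℝ → ℝ} (hg : Continuous fun z : ℝ × ℝ => g z.1 z.2)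
    {M : ℝ} (hM : ∀ x t, |g x t| ≤ M) (y t : ℝ) {ε : ℝ} (hε : 0 < ε) :
    ∃ B, 0 ≤ B ∧ ∀ y' t', |g y' t' - g y t| ≤ ε + B * ((y' - y) ^ 2 + (t' - t) ^ 2) := by
  have hM0 : 0 ≤ M := (abs_nonneg _).trans (hM 0 0)
  obtain ⟨δ, hδ, h⟩ := Metric.continuousAt_iff.1 (hg.continuousAt (x := (y, t))) ε hε
  refine ⟨2 * M / δ ^ 2, by positivity, fun y' t' => ?_⟩
  by_cases hd : dist (y', t') (y, t) < δ
  · have h1 := h hd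
    rw [Real.dist_eq] at h1
    have : 0 ≤ 2 * M / δ ^ 2 * ((y' - y) ^ 2 + (t' - t) ^ 2) := by positivity
    dsimp only at h1
    linarith
  · rw [not_lt, Prod.dist_eq, Real.dist_eq, Real.dist_eq, le_max_iff] at hd
    have h1 : δ ^ 2 ≤ (y' - y) ^ 2 + (t' - t) ^ 2 := by
      rw [← sq_abs (y' - y), ← sq_abs (t' - t)]
      rcases hd with hd | hd
      · have : δ ^ 2 ≤ |y' - y| ^ 2 := by gcongr
        nlinarith [sq_nonneg |t' - t|]
      · have : δ ^ 2 ≤ |t' - t| ^ 2 := by gcongr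
        nlinarith [sq_nonneg |y' - y|]
    have h2 : 2 * M ≤ 2 * M / δ ^ 2 * ((y' - y) ^ 2 + (t' - t) ^ 2) := by
      rw [div_mul_eq_mul_div, le_div_iff₀ (by positivity)]
      gcongr
    have h3 := abs_sub (g y' t') (g y t)
    linarith [hM y' t', hM y t]

/-- A solution of the scheme on `[0, L]` with boundary data `g`. -/
structure StripProblem (c C L : ℝ) (g : ℝ → ℝ → ℝ) (h lam : ℝ) (m : ℕ) (u a : ℕ → ℤ → ℝ) :
    Prop extends StripSolution c C lam m u a where
  h_pos : 0 < h
  lam_pos : 0 < lam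
  length : h * m = L
  initial : ∀ i : ℤ, 0 ≤ i → i ≤ m → u 0 i = g (h * i) 0
  left : ∀ n : ℕ, u n 0 = g 0 (lam * h ^ 2 * n)
  right : ∀ n : ℕ, u n m = g L (lam * h ^ 2 * n)

namespace StripProblem

variable {c C L h lam : ℝ} {g : ℝ → ℝ → ℝ} {m : ℕ} {u a : ℕ → ℤ → ℝ}

theorem neg (hp : StripProblem c C L g h lam m u a) :
    StripProblem c C L (fun x t => -g x t) h lam m (fun n i => -u n i) a where
  toStripSolution := hp.toStripSolution.neg
  h_pos := hp.h_pos
  lam_pos := hp.lam_pos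
  length := hp.length
  initial i h1 h2 := by rw [hp.initial i h1 h2]
  left n := by rw [hp.left]
  right n := by rw [hp.right]

theorem reflect (hp : StripProblem c C L g h lam m u a) :
    StripProblem c C L (fun x t => g (L - x) t) h lam m (fun n i => u n (m - i))
      (fun n i => a n (m - i)) where
  toStripSolution := hp.toStripSolution.reflect
  h_pos := hp.h_pos
  lam_pos := hp.lam_pos
  length := hp.length
  initial i h1 h2 := by
    rw [hp.initial _ (by omega) (by omega)]
    push_cast
    rw [mul_sub, hp.length]
  left n := by simp [hp.right]
  right n := by simp [hp.left]

theorem abs_le (hp : StripProblem c C L g h lam m u a) (hc : 0 < c) {M : ℝ}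
    (hM : ∀ x t, |g x t| ≤ M) (n : ℕ) (i : ℤ) (h1 : 0 ≤ i) (h2 : i ≤ m) : |u n i| ≤ M :=
  hp.abs_le_of_data hc hp.lam_pos (fun i h1 h2 => by rw [hp.initial i h1 h2]; exact hM _ _)
    (fun n => by rw [hp.left]; exact hM _ _) (fun n => by rw [hp.right]; exact hM _ _) n i h1 h2

theorem exists_initial_le (hg : Continuous fun z : ℝ × ℝ => g z.1 z.2) {M : ℝ}
    (hM : ∀ x t, |g x t| ≤ M) (hc : 0 < c) (hC : 0 ≤ C) {y ε : ℝ} (hε : 0 < ε) :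
    ∃ δ, 0 < δ ∧ ∀ h lam m u a, StripProblem c C L g h lam m u a → ∀ (n : ℕ) (i : ℤ),
      0 ≤ i → i ≤ m → |h * i - y| ≤ δ → lam * h ^ 2 * n ≤ δ → u n i ≤ g y 0 + ε := by
  obtain ⟨B, hB, hmod⟩ := exists_quadratic_modulus hg hM y 0 (half_pos hε)
  have hD : 0 < 2 * (B * (2 + 2 * C) + 1) := by positivity
  refine ⟨min 1 (ε / (2 * (B * (2 + 2 * C) + 1))), by positivity,
    fun h lam m u a hp n i h1 h2 h3 h4 => ?_⟩
  set δ := min 1 (ε / (2 * (B * (2 + 2 * C) + 1)))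
  have hδ1 : δ ≤ 1 := min_le_left _ _
  have hδ0 : 0 < δ := by positivity
  have hδ2 : (B * (2 + 2 * C) + 1) * δ ≤ ε / 2 := by
    have : δ * (2 * (B * (2 + 2 * C) + 1)) ≤ ε := (le_div_iff₀ hD).1 (min_le_right _ _)
    linarith
  have hτ : ∀ k : ℕ, 0 ≤ lam * h ^ 2 * k := fun k => by
    have := hp.lam_pos
    positivity
  have hsq : ∀ k : ℕ, lam * h ^ 2 * k ≤ 1 → (lam * h ^ 2 * k - 0) ^ 2 ≤ lam * h ^ 2 * k :=
    fun k hk => by rw [sub_zero, sq]; exact mul_le_of_le_one_left (hτ k) hk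
  have key := hp.initial_barrier (h := h) (E := g y 0 + ε / 2) (y := y) hc hp.lam_pos hB
    (fun i h1 h2 => by
      rw [hp.initial i h1 h2]
      have := (_root_.abs_le.1 (hmod (h * i) 0)).2
      simp only [sub_self, ne_eq, OfNat.ofNat_ne_zero, not_false_eq_true, zero_pow,
        add_zero] at this
      linarith)
    (fun k hk => by
      rw [hp.left]
      have := (_root_.abs_le.1 (hmod 0 (lam * h ^ 2 * k))).2
      have h5 := mul_le_mul_of_nonneg_left (hsq k hk) hB
      linarith)
    (fun k hk => by
      rw [hp.right, hp.length]
      have := (_root_.abs_le.1 (hmod L (lam * h ^ 2 * k))).2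
      have h5 := mul_le_mul_of_nonneg_left (hsq k hk) hB
      linarith) n (h4.trans hδ1) i h1 h2
  have e1 : (h * i - y) ^ 2 ≤ δ := by
    rw [← sq_abs, sq]
    calc _ ≤ δ * 1 := mul_le_mul h3 (h3.trans hδ1) (abs_nonneg _) hδ0.le
      _ = δ := mul_one _
  have e2 := mul_le_mul_of_nonneg_left e1 hB
  have e3 := mul_le_mul_of_nonneg_left h4 (show 0 ≤ B * (1 + 2 * C) by positivity)
  linarith

theorem exists_lateral_le (hL : 0 < L) (hg : Continuous fun z : ℝ × ℝ => g z.1 z.2) {M : ℝ}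
    (hM : ∀ x t, |g x t| ≤ M) (hc : 0 < c) {t ε : ℝ} (ht : 0 ≤ t) (hε : 0 < ε) :
    ∃ δ, 0 < δ ∧ ∀ h lam m u a, StripProblem c C L g h lam m u a → ∀ (n : ℕ) (i : ℤ),
      0 ≤ i → i ≤ m → h * i ≤ δ → |lam * h ^ 2 * n - t| ≤ δ → u n i ≤ g 0 t + ε := by
  obtain ⟨B, hB, hmod⟩ := exists_quadratic_modulus hg hM 0 t (half_pos hε)
  set D := B + B * (1 + t / c) * (2 * L) + 1 with hDdef
  have hD : 0 < 2 * D := by positivity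
  refine ⟨min 1 (ε / (2 * D)), by positivity, fun h lam m u a hp n i h1 h2 h3 h4 => ?_⟩
  set δ := min 1 (ε / (2 * D))
  have hδ1 : δ ≤ 1 := min_le_left _ _
  have hδ0 : 0 < δ := by positivity
  have hδ2 : D * δ ≤ ε / 2 := by
    have : δ * (2 * D) ≤ ε := (le_div_iff₀ hD).1 (min_le_right _ _)
    linarith
  have key := hp.lateral_barrier (h := h) (E := g 0 t + ε / 2) hc hp.lam_pos hp.h_pos hB ht
    (fun i h1 h2 => by
      rw [hp.initial i h1 h2]
      have := (_root_.abs_le.1 (hmod (h * i) 0)).2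
      rw [zero_sub, neg_sq, sub_zero] at this
      linarith)
    (fun k => by
      rw [hp.left]
      have := (_root_.abs_le.1 (hmod 0 (lam * h ^ 2 * k))).2
      rw [sub_self, zero_pow two_ne_zero, zero_add] at this
      linarith)
    (fun k => by
      rw [hp.right, hp.length]
      have := (_root_.abs_le.1 (hmod L (lam * h ^ 2 * k))).2
      rw [sub_zero] at this
      linarith) n i h1 h2
  have e1 : (lam * h ^ 2 * n - t) ^ 2 ≤ δ := by
    rw [← sq_abs, sq]
    calc _ ≤ δ * 1 := mul_le_mul h4 (h4.trans hδ1) (abs_nonneg _) hδ0.le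
      _ = δ := mul_one _
  have e2 := mul_le_mul_of_nonneg_left e1 hB
  have i0 : (0 : ℝ) ≤ i := by exact_mod_cast h1
  have hi0 : 0 ≤ h * i := mul_nonneg hp.h_pos.le i0
  have e4 : h * i * (2 * (h * m) - h * i) ≤ δ * (2 * L) := by
    rw [hp.length]
    have him : h * i ≤ L := by
      rw [← hp.length]
      have : (i : ℝ) ≤ m := by exact_mod_cast h2
      exact mul_le_mul_of_nonneg_left this hp.h_pos.le
    exact mul_le_mul h3 (by linarith) (by linarith) hδ0.le
  have e3 := mul_le_mul_of_nonneg_left e4 (show 0 ≤ B * (1 + t / c) by positivity)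
  have e5 : D * δ = B * δ + B * (1 + t / c) * (δ * (2 * L)) + δ := by rw [hDdef]; ring
  linarith

theorem exists_lateral_abs (hL : 0 < L) (hg : Continuous fun z : ℝ × ℝ => g z.1 z.2) {M : ℝ}
    (hM : ∀ x t, |g x t| ≤ M) (hc : 0 < c) {t ε : ℝ} (ht : 0 ≤ t) (hε : 0 < ε) :
    ∃ δ, 0 < δ ∧ ∀ h lam m u a, StripProblem c C L g h lam m u a → ∀ (n : ℕ) (i : ℤ),
      0 ≤ i → i ≤ m → h * i ≤ δ → |lam * h ^ 2 * n - t| ≤ δ → |u n i - g 0 t| ≤ ε := by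
  obtain ⟨δ₁, hδ₁, H₁⟩ := exists_lateral_le (C := C) hL hg hM hc ht hε
  obtain ⟨δ₂, hδ₂, H₂⟩ := exists_lateral_le (C := C) (g := fun x t => -g x t) hL hg.neg
    (fun x t => by rw [abs_neg]; exact hM x t) hc ht hε
  refine ⟨min δ₁ δ₂, lt_min hδ₁ hδ₂, fun h lam m u a hp n i h1 h2 h3 h4 => ?_⟩
  have e1 := H₁ h lam m u a hp n i h1 h2 (h3.trans (min_le_left _ _)) (h4.trans (min_le_left _ _))
  have e2 := H₂ h lam m _ a hp.neg n i h1 h2 (h3.trans (min_le_right _ _))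
    (h4.trans (min_le_right _ _))
  rw [_root_.abs_le]
  constructor <;> linarith

/-- Solutions of the scheme attain their boundary data, uniformly in the grid. -/
theorem exists_boundary_modulus (hL : 0 < L) (hg : Continuous fun z : ℝ × ℝ => g z.1 z.2) {M : ℝ}
    (hM : ∀ x t, |g x t| ≤ M) (hc : 0 < c) (hC : 0 ≤ C) {y t ε : ℝ}
    (hyt : t = 0 ∨ 0 ≤ t ∧ (y = 0 ∨ y = L)) (hε : 0 < ε) :
    ∃ δ, 0 < δ ∧ ∀ h lam m u a, StripProblem c C L g h lam m u a → ∀ (n : ℕ) (i : ℤ),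
      0 ≤ i → i ≤ m → |h * i - y| ≤ δ → |lam * h ^ 2 * n - t| ≤ δ → |u n i - g y t| ≤ ε := by
  rcases hyt with rfl | ⟨ht, rfl | rfl⟩
  · obtain ⟨δ₁, hδ₁, H₁⟩ := exists_initial_le (L := L) (y := y) hg hM hc hC hε
    obtain ⟨δ₂, hδ₂, H₂⟩ := exists_initial_le (L := L) (y := y) (g := fun x t => -g x t) hg.neg
      (fun x t => by rw [abs_neg]; exact hM x t) hc hC hε
    refine ⟨min δ₁ δ₂, lt_min hδ₁ hδ₂, fun h lam m u a hp n i h1 h2 h3 h4 => ?_⟩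
    rw [sub_zero] at h4
    have h4' := (le_abs_self _).trans h4
    have e1 := H₁ h lam m u a hp n i h1 h2 (h3.trans (min_le_left _ _))
      (h4'.trans (min_le_left _ _))
    have e2 := H₂ h lam m _ a hp.neg n i h1 h2 (h3.trans (min_le_right _ _))
      (h4'.trans (min_le_right _ _))
    rw [_root_.abs_le]
    constructor <;> linarith
  · obtain ⟨δ, hδ, H⟩ := exists_lateral_abs (C := C) hL hg hM hc ht hε
    refine ⟨δ, hδ, fun h lam m u a hp n i h1 h2 h3 h4 => H h lam m u a hp n i h1 h2 ?_ h4⟩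
    rw [sub_zero] at h3
    exact (le_abs_self _).trans h3
  · have hg' : Continuous fun z : ℝ × ℝ => g (y - z.1) z.2 :=
      hg.comp (f := fun z : ℝ × ℝ => (y - z.1, z.2)) (by fun_prop)
    obtain ⟨δ, hδ, H⟩ := exists_lateral_abs (C := C) (g := fun x t => g (y - x) t) hL hg'
      (fun x t => hM _ _) hc ht hε
    refine ⟨δ, hδ, fun h lam m u a hp n i h1 h2 h3 h4 => ?_⟩
    have := H h lam m _ _ hp.reflect n (m - i) (by omega) (by omega) (by
      push_cast
      rw [mul_sub, hp.length]
      rw [abs_sub_comm] at h3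
      exact (le_abs_self _).trans h3) h4
    simpa using this

end StripProblem

/-- The explicit finite difference scheme for `u_t = A(u_x, u, x, t) u_xx` on `[0, m h]`. -/
noncomputable def gridSol (A : ℝ → ℝ → ℝ → ℝ → ℝ) (g : ℝ → ℝ → ℝ) (h lam : ℝ) (m : ℕ) :
    ℕ → ℤ → ℝ
  | 0, i => g (h * i) 0
  | n + 1, i => if 0 < i ∧ i < m then
      gridSol A g h lam m n i + lam *
        A ((gridSol A g h lam m n (i + 1) - gridSol A g h lam m n i) / h)
          (gridSol A g h lam m n i) (h * i) (lam * h ^ 2 * n) * lap (gridSol A g h lam m n) i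
    else g (h * i) (lam * h ^ 2 * (n + 1 : ℕ))

noncomputable def gridCoeff (A : ℝ → ℝ → ℝ → ℝ → ℝ) (g : ℝ → ℝ → ℝ) (h lam : ℝ) (m : ℕ)
    (n : ℕ) (i : ℤ) : ℝ :=
  A ((gridSol A g h lam m n (i + 1) - gridSol A g h lam m n i) / h)
    (gridSol A g h lam m n i) (h * i) (lam * h ^ 2 * n)

theorem gridSol_stripProblem {A : ℝ → ℝ → ℝ → ℝ → ℝ} {g : ℝ → ℝ → ℝ} {c C L h lam : ℝ} {m : ℕ}
    (hA : ∀ p q x t, c ≤ A p q x t ∧ A p q x t ≤ C) (hh : 0 < h) (hlam : 0 < lam)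
    (hlC : lam * C ≤ 1 / 8) (hL : h * m = L) :
    StripProblem c C L g h lam m (gridSol A g h lam m) (gridCoeff A g h lam m) where
  coeff n i := ⟨(hA _ _ _ _).1, (hA _ _ _ _).2,
    (mul_le_mul_of_nonneg_left (hA _ _ _ _).2 hlam.le).trans hlC⟩
  scheme n i h1 h2 := by
    rw [SchemeAt, gridSol, if_pos ⟨h1, h2⟩, gridCoeff]
  h_pos := hh
  lam_pos := hlam
  length := hL
  initial i h1 h2 := by rw [gridSol]
  left n := by
    cases n <;> simp [gridSol]
  right n := by
    cases n <;> simp [gridSol, hL]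

/-- Points of `[0, L] × [0, ∞)` at distance at least `δ` from the parabolic boundary. -/
def InnerDomain (L δ x t : ℝ) : Prop := δ ≤ x ∧ x ≤ L - δ ∧ δ ≤ t

theorem InnerDomain.mono {L δ δ' x t : ℝ} (h : InnerDomain L δ x t) (hδ : δ' ≤ δ) :
    InnerDomain L δ' x t := ⟨hδ.trans h.1, by linarith [h.2.1], hδ.trans h.2.2⟩

/-- Bounds for a coefficient and its Hölder constants away from the parabolic boundary. -/
structure CoeffBounds (L δ α c C H : ℝ) (A : ℝ → ℝ → ℝ → ℝ → ℝ) : Prop where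
  bound : ∀ p q x t, InnerDomain L δ x t → c ≤ A p q x t ∧ A p q x t ≤ C
  holder : ∀ p q x t p' q' x' t', InnerDomain L δ x t → InnerDomain L δ x' t' →
    |A p q x t - A p' q' x' t'| ≤ H * (|p - p'| + |q - q'| + |x - x'| + |t - t'|) ^ α

theorem CoeffBounds.gridSolution {A : ℝ → ℝ → ℝ → ℝ → ℝ} {g : ℝ → ℝ → ℝ}
    {c C M α H L δ c' C' h lam : ℝ} {m R N n₀ : ℕ} {i₀ : ℤ} (hA : CoeffBounds L δ α c C H A)
    (hp : StripProblem c' C' L g h lam m (gridSol A g h lam m) (gridCoeff A g h lam m))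
    (hδ : 0 < δ) (hc' : 0 < c') (hM : ∀ x t, |g x t| ≤ M)
    (h1 : δ ≤ h * i₀ - h * (8 * R)) (h2 : h * i₀ + h * (8 * R) ≤ L - δ)
    (h3 : δ ≤ lam * h ^ 2 * n₀) :
    GridSolution c C M α H h lam R N (fun n i => gridSol A g h lam m (n₀ + n) (i₀ + i))
      (fun n i => gridCoeff A g h lam m (n₀ + n) (i₀ + i)) := by
  have hh := hp.h_pos
  have hlam := hp.lam_pos
  have hin : ∀ (n : ℕ) (i : ℤ), |i| ≤ 8 * R →
      InnerDomain L δ (h * (i₀ + i : ℤ)) (lam * h ^ 2 * (n₀ + n : ℕ)) := by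
    intro n i hi
    have hi' : |(i : ℝ)| ≤ 8 * R := by exact_mod_cast hi
    obtain ⟨a1, a2⟩ := abs_le.1 hi'
    have b1 := mul_le_mul_of_nonneg_left a1 hh.le
    have b2 := mul_le_mul_of_nonneg_left a2 hh.le
    have b3 : 0 ≤ lam * h ^ 2 * n := by positivity
    push_cast
    refine ⟨?_, ?_, ?_⟩ <;> linarith
  have hidx : ∀ i : ℤ, |i| ≤ 8 * R → 0 < i₀ + i ∧ i₀ + i < m := by
    intro i hi
    obtain ⟨a1, a2, -⟩ := hin 0 i hi
    constructor
    · have : 0 < h * ((i₀ + i : ℤ) : ℝ) := by linarith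
      exact_mod_cast (mul_pos_iff_of_pos_left hh).1 this
    · have : h * ((i₀ + i : ℤ) : ℝ) < h * m := by rw [hp.length]; linarith
      exact_mod_cast (mul_lt_mul_iff_right₀ hh).1 this
  refine ⟨fun n _ i hi => ?_, fun n _ i hi => ?_, fun n _ i hi => ?_, fun n _ i hi n' _ i' hi' => ?_⟩
  · exact hp.abs_le hc' hM _ _ (hidx i hi).1.le (hidx i hi).2.le
  · exact ⟨(hA.bound _ _ _ _ (hin n i hi)).1, (hA.bound _ _ _ _ (hin n i hi)).2,
      (hp.coeff _ _).2.2⟩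
  · exact (hp.scheme _ _ (hidx i hi).1 (hidx i hi).2).shift
  · have := hA.holder ((gridSol A g h lam m (n₀ + n) (i₀ + i + 1)
      - gridSol A g h lam m (n₀ + n) (i₀ + i)) / h) (gridSol A g h lam m (n₀ + n) (i₀ + i)) _ _
      ((gridSol A g h lam m (n₀ + n') (i₀ + i' + 1)
      - gridSol A g h lam m (n₀ + n') (i₀ + i')) / h) (gridSol A g h lam m (n₀ + n') (i₀ + i'))
      _ _ (hin n i hi) (hin n' i' hi')
    simp only [gridCoeff, ← add_assoc]
    refine this.trans (le_of_eq ?_)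
    congr 3
    · rw [← sub_div, abs_div, abs_of_pos hh]
      congr 1
      rw [← mul_sub, abs_mul, abs_of_pos hh]
      push_cast
      ring_nf
    · rw [← mul_sub, abs_mul, abs_of_pos (by positivity)]
      push_cast
      ring_nf

set_option maxHeartbeats 1000000 in
/-- Interior estimates for the finite difference scheme in terms of grid-independent
constants. -/
theorem gridSol_interior_expansion {c C M α H δ L : ℝ} (hc : 0 < c) (hcC : c ≤ C) (hM : 0 ≤ M)
    (hα0 : 0 < α) (hα1 : α ≤ 1) (hH : 0 ≤ H) (hδ : 0 < δ) :
    ∃ S K ρ₀ : ℝ, 0 < S ∧ 0 < K ∧ 0 < ρ₀ ∧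
    ∀ (A : ℝ → ℝ → ℝ → ℝ → ℝ) (g : ℝ → ℝ → ℝ) (c' C' h lam : ℝ) (m n₀ : ℕ) (i₀ : ℤ),
      CoeffBounds L (δ / 2) α c C H A →
      StripProblem c' C' L g h lam m (gridSol A g h lam m) (gridCoeff A g h lam m) →
      0 < c' → (∀ x t, |g x t| ≤ M) → lam ≤ 1 → h ≤ ρ₀ →
      InnerDomain L (3 * δ / 4) (h * i₀) (lam * h ^ 2 * n₀) →
      (∀ i : ℤ, h * |(i : ℝ)| ≤ ρ₀ →
        |gridSol A g h lam m n₀ (i₀ + i + 1) - gridSol A g h lam m n₀ (i₀ + i)| ≤ S * h ∧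
        |lap (gridSol A g h lam m n₀) (i₀ + i)| ≤ S * h ^ 2) ∧
      ∀ ρ, h ≤ ρ → ρ ≤ ρ₀ → ∃ c₀ c₁ c₂ : ℝ, ∀ (n : ℕ) (i : ℤ),
        |lam * h ^ 2 * n - lam * h ^ 2 * n₀| ≤ ρ ^ 2 → |h * i - h * i₀| ≤ ρ →
        |gridSol A g h lam m n i - (c₀ + c₁ * (h * i - h * i₀) + c₂ * ((h * i - h * i₀) ^ 2 / 2
          + gridCoeff A g h lam m n₀ i₀ * (lam * h ^ 2 * n - lam * h ^ 2 * n₀)))|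
        ≤ K * ρ ^ (2 + α / (3 + α)) := by
  set r₀ := min δ 1 / 64 with hr₀def
  have hr₀ : 0 < r₀ := by positivity
  have hr₀1 : r₀ ≤ 1 / 64 := by rw [hr₀def]; linarith [min_le_right δ 1]
  have hr₀δ : r₀ ≤ δ / 64 := by rw [hr₀def]; linarith [min_le_left δ 1]
  obtain ⟨S, K, ρ₀, hS, hK, hρ₀, -, main⟩ := grid_interior_expansion hc hcC hM hα0 hα1 hH hr₀
  refine ⟨S, K, min ρ₀ r₀, hS, hK, lt_min hρ₀ hr₀, ?_⟩
  intro A g c' C' h lam m n₀ i₀ hA hp hc' hgM hlam1 hhρ hin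
  have hh := hp.h_pos
  have hlam := hp.lam_pos
  have hhr : h ≤ r₀ := hhρ.trans (min_le_right _ _)
  set R := ⌈r₀ / h⌉₊ with hRdef
  set N₁ := ⌈(R : ℝ) ^ 2 / lam⌉₊ with hNdef
  have hR1 : r₀ ≤ h * R := by
    have := Nat.le_ceil (r₀ / h)
    rw [div_le_iff₀ hh] at this
    linarith
  have hR2 : h * R ≤ 2 * r₀ := by
    have := Nat.ceil_lt_add_one (div_pos hr₀ hh).le
    have h1 := mul_le_mul_of_nonneg_left this.le hh.le
    have h2 : h * (r₀ / h) = r₀ := by field_simp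
    rw [mul_add, h2, mul_one] at h1
    linarith
  have hR : 1 ≤ R := Nat.one_le_ceil_iff.2 (by positivity)
  have hN1 : (R : ℝ) ^ 2 ≤ lam * N₁ := by
    have := Nat.le_ceil ((R : ℝ) ^ 2 / lam)
    rw [div_le_iff₀ hlam] at this
    linarith
  have hN2 : lam * N₁ ≤ (R : ℝ) ^ 2 + lam := by
    have := Nat.ceil_lt_add_one (div_nonneg (sq_nonneg (R : ℝ)) hlam.le)
    have h1 := mul_le_mul_of_nonneg_left this.le hlam.le
    have h2 : lam * ((R : ℝ) ^ 2 / lam) = (R : ℝ) ^ 2 := by field_simp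
    rw [mul_add, h2, mul_one] at h1
    exact h1
  have hR3 : h ^ 2 * (R : ℝ) ^ 2 ≤ 4 * r₀ ^ 2 := by
    have : (h * R) ^ 2 ≤ (2 * r₀) ^ 2 := by gcongr
    linarith [mul_pow h (R : ℝ) 2, mul_pow 2 r₀ 2]
  have hT : lam * h ^ 2 * N₁ ≤ 5 * r₀ ^ 2 := by
    have h1 := mul_le_mul_of_nonneg_left hN2 (sq_nonneg h)
    have h2 : h ^ 2 * lam ≤ r₀ ^ 2 * 1 := by gcongr
    linarith
  have hT' : r₀ ^ 2 ≤ lam * h ^ 2 * N₁ := by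
    have h1 := mul_le_mul_of_nonneg_left hN1 (sq_nonneg h)
    have : r₀ ^ 2 ≤ (h * R) ^ 2 := by gcongr
    linarith [mul_pow h (R : ℝ) 2]
  have hr₀sq : r₀ ^ 2 ≤ r₀ / 64 := by
    have := mul_le_mul_of_nonneg_left hr₀1 hr₀.le
    linarith [sq r₀]
  obtain ⟨d1, d2, d3⟩ := hin
  have hle : 4 * N₁ ≤ n₀ := by
    have : lam * h ^ 2 * ((4 * N₁ : ℕ) : ℝ) ≤ lam * h ^ 2 * n₀ := by push_cast; linarith
    exact_mod_cast (mul_le_mul_iff_right₀ (show 0 < lam * h ^ 2 by positivity)).1 this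
  obtain ⟨n₁, rfl⟩ : ∃ n₁, n₀ = n₁ + 4 * N₁ := ⟨n₀ - 4 * N₁, by omega⟩
  have hGS := hA.gridSolution (R := R) (N := 5 * N₁) (n₀ := n₁) (i₀ := i₀) hp (half_pos hδ) hc' hgM
    (by linarith) (by linarith) (by push_cast at d3; linarith)
  obtain ⟨grad, expan⟩ := main _ _ h lam R N₁ hh hlam hlam1 hR hR1 hR2 hN1 hGS
  refine ⟨fun i hi => ?_, fun ρ hρ1 hρ2 => ?_⟩
  · have hi' : |i| ≤ 4 * R := by
      have h1 : h * |(i : ℝ)| ≤ h * R := hi.trans ((min_le_right _ _).trans hR1)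
      have h2 : |(i : ℝ)| ≤ R := (mul_le_mul_iff_right₀ hh).1 h1
      have h3 : |i| ≤ R := by exact_mod_cast h2
      omega
    have := grad (4 * N₁) (by omega) (by omega) i hi'
    simp only [← add_assoc] at this
    rwa [lap_shift (fun k => gridSol A g h lam m (n₁ + 4 * N₁) k)] at this
  · obtain ⟨c₀, c₁, c₂, hex⟩ := expan ρ hρ1 (hρ2.trans (min_le_left _ _))
    refine ⟨c₀, c₁, c₂, fun n i hn hi => ?_⟩
    have hρr : ρ ^ 2 ≤ r₀ ^ 2 := by
      have := hρ2.trans (min_le_right _ _)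
      have : 0 ≤ ρ := by linarith
      gcongr
    have hnle : n₁ ≤ n := by
      have h1 := (abs_le.1 hn).1
      push_cast at h1
      have h2 : 0 ≤ lam * h ^ 2 * N₁ := by positivity
      have : lam * h ^ 2 * (n₁ : ℝ) ≤ lam * h ^ 2 * n := by linarith
      exact_mod_cast (mul_le_mul_iff_right₀ (show 0 < lam * h ^ 2 by positivity)).1 this
    obtain ⟨k, rfl⟩ : ∃ k, n = n₁ + k := ⟨n - n₁, by omega⟩
    have e1 : lam * h ^ 2 * ((n₁ + k : ℕ) : ℝ) - lam * h ^ 2 * ((n₁ + 4 * N₁ : ℕ) : ℝ)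
        = h ^ 2 * (lam * ((k : ℝ) - (4 * N₁ : ℕ))) := by push_cast; ring
    have e2 : h * (i : ℝ) - h * i₀ = h * ((i - i₀ : ℤ) : ℝ) := by push_cast; ring
    rw [e1] at hn ⊢
    rw [e2] at hi ⊢
    have := hex k (i - i₀) (by
      rw [abs_mul, abs_mul, abs_of_pos hlam, abs_of_pos (pow_pos hh 2)] at hn
      exact hn) (by
      rw [abs_mul, abs_of_pos hh] at hi
      exact hi)
    simp only [add_sub_cancel, add_zero] at this
    exact this

/-- The limit of a sequence along a fixed nonprincipal ultrafilter. -/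
noncomputable def ulim (f : ℕ → ℝ) : ℝ := limUnder (hyperfilter ℕ : Filter ℕ) f

theorem tendsto_ulim {f : ℕ → ℝ} {B : ℝ} (h : ∀ᶠ m in (hyperfilter ℕ : Filter ℕ), |f m| ≤ B) :
    Tendsto f (hyperfilter ℕ) (𝓝 (ulim f)) := by
  refine tendsto_nhds_limUnder ?_
  obtain ⟨x, -, hx⟩ := (isCompact_Icc (a := -B) (b := B)).ultrafilter_le_nhds
    ((hyperfilter ℕ).map f) (by
      rw [Ultrafilter.coe_map, le_principal_iff, mem_map]
      filter_upwards [h] with m hm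
      exact abs_le.1 hm)
  exact ⟨x, hx⟩

theorem eventually_hyperfilter {p : ℕ → Prop} (h : ∀ᶠ m in atTop, p m) :
    ∀ᶠ m in (hyperfilter ℕ : Filter ℕ), p m := Nat.hyperfilter_le_atTop h

theorem abs_le_of_tendsto {f : ℕ → ℝ} {a B : ℝ} (hf : Tendsto f (hyperfilter ℕ) (𝓝 a))
    (h : ∀ᶠ m in (hyperfilter ℕ : Filter ℕ), |f m| ≤ B) : |a| ≤ B :=
  le_of_tendsto hf.abs h

noncomputable def mesh (L : ℝ) (m : ℕ) : ℝ := L / (m + 1)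

noncomputable def spaceIdx (h x : ℝ) : ℤ := ⌊x / h⌋

noncomputable def timeIdx (lam h t : ℝ) : ℕ := ⌊t / (lam * h ^ 2)⌋₊

theorem mesh_pos {L : ℝ} (hL : 0 < L) (m : ℕ) : 0 < mesh L m := by
  unfold mesh; positivity

theorem mesh_mul {L : ℝ} (m : ℕ) : mesh L m * (m + 1 : ℕ) = L := by
  unfold mesh
  push_cast
  field_simp

theorem tendsto_mesh (L : ℝ) : Tendsto (mesh L) (hyperfilter ℕ) (𝓝 0) := by
  have h1 : Tendsto (mesh L) atTop (𝓝 0) := by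
    have := tendsto_one_div_add_atTop_nhds_zero_nat (𝕜 := ℝ) |>.const_mul L
    simp only [mul_zero, mul_one_div] at this
    exact this
  exact h1.mono_left Nat.hyperfilter_le_atTop

theorem abs_spaceIdx {h : ℝ} (hh : 0 < h) (x : ℝ) : |h * spaceIdx h x - x| ≤ h := by
  have h1 := Int.floor_le (x / h)
  have h2 := (Int.lt_floor_add_one (x / h)).le
  have e : h * (x / h) = x := by field_simp
  have h3 := mul_le_mul_of_nonneg_left h1 hh.le
  have h4 := mul_le_mul_of_nonneg_left h2 hh.le
  rw [e] at h3
  rw [mul_add, e] at h4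
  rw [abs_le]
  unfold spaceIdx
  constructor <;> linarith

theorem abs_timeIdx {lam h : ℝ} (hh : 0 < h) (hlam : 0 < lam) {t : ℝ} (ht : 0 ≤ t) :
    |lam * h ^ 2 * timeIdx lam h t - t| ≤ lam * h ^ 2 := by
  have hp : 0 < lam * h ^ 2 := by positivity
  have h1 := Nat.floor_le (div_nonneg ht hp.le)
  have h2 := (Nat.lt_floor_add_one (t / (lam * h ^ 2))).le
  have e : lam * h ^ 2 * (t / (lam * h ^ 2)) = t := by field_simp
  have h3 := mul_le_mul_of_nonneg_left h1 hp.le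
  have h4 := mul_le_mul_of_nonneg_left h2 hp.le
  rw [e] at h3
  rw [mul_add, e] at h4
  rw [abs_le]
  unfold timeIdx
  constructor <;> linarith

theorem spaceIdx_mem {L x : ℝ} (hL : 0 < L) (h0 : 0 ≤ x) (h1 : x ≤ L) (m : ℕ) :
    0 ≤ spaceIdx (mesh L m) x ∧ spaceIdx (mesh L m) x ≤ (m + 1 : ℕ) := by
  constructor
  · exact Int.floor_nonneg.2 (div_nonneg h0 (mesh_pos hL m).le)
  · have : x / mesh L m ≤ ((m + 1 : ℕ) : ℝ) := by
      rw [div_le_iff₀ (mesh_pos hL m), mul_comm, mesh_mul]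
      exact h1
    exact_mod_cast (Int.floor_le _).trans this

theorem tendsto_of_abs_sub_le {f e : ℕ → ℝ} {a : ℝ} {l : Filter ℕ} (h : ∀ m, |f m - a| ≤ e m)
    (he : Tendsto e l (𝓝 0)) : Tendsto f l (𝓝 a) := by
  rw [tendsto_iff_dist_tendsto_zero]
  exact squeeze_zero (fun _ => dist_nonneg) (fun m => by rw [Real.dist_eq]; exact h m) he

theorem tendsto_spaceIdx {L : ℝ} (hL : 0 < L) (x : ℝ) :
    Tendsto (fun m => mesh L m * spaceIdx (mesh L m) x) (hyperfilter ℕ) (𝓝 x) :=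
  tendsto_of_abs_sub_le (fun m => abs_spaceIdx (mesh_pos hL m) x) (tendsto_mesh L)

theorem tendsto_timeIdx {L lam : ℝ} (hL : 0 < L) (hlam : 0 < lam) {t : ℝ} (ht : 0 ≤ t) :
    Tendsto (fun m => lam * mesh L m ^ 2 * timeIdx lam (mesh L m) t) (hyperfilter ℕ) (𝓝 t) :=
  tendsto_of_abs_sub_le (fun m => abs_timeIdx (mesh_pos hL m) hlam ht) (by
    simpa using ((tendsto_mesh L).pow 2).const_mul lam)

/-- The solution of the scheme with `m + 1` cells, read at the point `(x, t)`. -/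
noncomputable def gridVal (A : ℝ → ℝ → ℝ → ℝ → ℝ) (g : ℝ → ℝ → ℝ) (L lam x t : ℝ) (m : ℕ) : ℝ :=
  gridSol A g (mesh L m) lam (m + 1) (timeIdx lam (mesh L m) t) (spaceIdx (mesh L m) x)

/-- The difference quotient of the solution of the scheme with `m + 1` cells. -/
noncomputable def gridSlope (A : ℝ → ℝ → ℝ → ℝ → ℝ) (g : ℝ → ℝ → ℝ) (L lam x t : ℝ) (m : ℕ) : ℝ :=
  (gridSol A g (mesh L m) lam (m + 1) (timeIdx lam (mesh L m) t) (spaceIdx (mesh L m) x + 1)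
    - gridSol A g (mesh L m) lam (m + 1) (timeIdx lam (mesh L m) t) (spaceIdx (mesh L m) x))
    / mesh L m

noncomputable def gridLimit (A : ℝ → ℝ → ℝ → ℝ → ℝ) (g : ℝ → ℝ → ℝ) (L lam x t : ℝ) : ℝ :=
  ulim (gridVal A g L lam x t)

section

variable {A : ℝ → ℝ → ℝ → ℝ → ℝ} {g : ℝ → ℝ → ℝ} {L lam c C M : ℝ}

theorem mesh_stripProblem (hL : 0 < L) (hlam : 0 < lam)
    (hA : ∀ p q x t, c ≤ A p q x t ∧ A p q x t ≤ C) (hlC : lam * C ≤ 1 / 8) (m : ℕ) :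
    StripProblem c C L g (mesh L m) lam (m + 1) (gridSol A g (mesh L m) lam (m + 1))
      (gridCoeff A g (mesh L m) lam (m + 1)) :=
  gridSol_stripProblem hA (mesh_pos hL m) hlam hlC (mesh_mul m)

theorem abs_gridVal_le (hL : 0 < L) (hlam : 0 < lam) (hc : 0 < c)
    (hA : ∀ p q x t, c ≤ A p q x t ∧ A p q x t ≤ C) (hlC : lam * C ≤ 1 / 8)
    (hM : ∀ x t, |g x t| ≤ M) {x : ℝ} (h0 : 0 ≤ x) (h1 : x ≤ L) (t : ℝ) (m : ℕ) :
    |gridVal A g L lam x t m| ≤ M :=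
  (mesh_stripProblem hL hlam hA hlC m).abs_le hc hM _ _ (spaceIdx_mem hL h0 h1 m).1
    (spaceIdx_mem hL h0 h1 m).2

theorem tendsto_gridVal (hL : 0 < L) (hlam : 0 < lam) (hc : 0 < c)
    (hA : ∀ p q x t, c ≤ A p q x t ∧ A p q x t ≤ C) (hlC : lam * C ≤ 1 / 8)
    (hM : ∀ x t, |g x t| ≤ M) {x : ℝ} (h0 : 0 ≤ x) (h1 : x ≤ L) (t : ℝ) :
    Tendsto (gridVal A g L lam x t) (hyperfilter ℕ) (𝓝 (gridLimit A g L lam x t)) :=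
  tendsto_ulim (Eventually.of_forall (abs_gridVal_le hL hlam hc hA hlC hM h0 h1 t))

theorem gridLimit_boundary (hL : 0 < L) (hlam : 0 < lam) (hc : 0 < c)
    (hA : ∀ p q x t, c ≤ A p q x t ∧ A p q x t ≤ C) (hlC : lam * C ≤ 1 / 8)
    (hM : ∀ x t, |g x t| ≤ M) (hg : Continuous fun z : ℝ × ℝ => g z.1 z.2) {y s ε : ℝ}
    (hys : s = 0 ∨ 0 ≤ s ∧ (y = 0 ∨ y = L)) (hε : 0 < ε) :
    ∃ δ, 0 < δ ∧ ∀ x t, 0 ≤ x → x ≤ L → 0 ≤ t → |x - y| < δ → |t - s| < δ →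
      |gridLimit A g L lam x t - g y s| ≤ ε := by
  have hC : 0 ≤ C := hc.le.trans ((hA 0 0 0 0).1.trans (hA 0 0 0 0).2)
  obtain ⟨δ, hδ, H⟩ := StripProblem.exists_boundary_modulus hL hg hM hc hC hys hε
  refine ⟨δ, hδ, fun x t h0 h1 ht hx htt => ?_⟩
  refine abs_le_of_tendsto ((tendsto_gridVal hL hlam hc hA hlC hM h0 h1 t).sub_const _) ?_
  filter_upwards [((tendsto_spaceIdx hL x).sub_const y).abs.eventually_lt_const hx,
    ((tendsto_timeIdx hL hlam ht).sub_const s).abs.eventually_lt_const htt] with m e1 e2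
  exact H _ _ _ _ _ (mesh_stripProblem hL hlam hA hlC m) _ _ (spaceIdx_mem hL h0 h1 m).1
    (spaceIdx_mem hL h0 h1 m).2 e1.le e2.le

theorem abs_gridSlope_le {S ρ₀ x t : ℝ} (hL : 0 < L) (hρ₀ : 0 ≤ ρ₀)
    (hS : ∀ᶠ m in (hyperfilter ℕ : Filter ℕ), ∀ i : ℤ, mesh L m * |(i : ℝ)| ≤ ρ₀ →
      |gridSol A g (mesh L m) lam (m + 1) (timeIdx lam (mesh L m) t)
          (spaceIdx (mesh L m) x + i + 1)
        - gridSol A g (mesh L m) lam (m + 1) (timeIdx lam (mesh L m) t)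
          (spaceIdx (mesh L m) x + i)| ≤ S * mesh L m ∧
      |lap (gridSol A g (mesh L m) lam (m + 1) (timeIdx lam (mesh L m) t))
          (spaceIdx (mesh L m) x + i)| ≤ S * mesh L m ^ 2) :
    ∀ᶠ m in (hyperfilter ℕ : Filter ℕ), |gridSlope A g L lam x t m| ≤ S := by
  filter_upwards [hS] with m hm
  have := (hm 0 (by simpa using hρ₀)).1
  rw [gridSlope, abs_div, abs_of_pos (mesh_pos hL m), div_le_iff₀ (mesh_pos hL m)]
  simpa using this

theorem gridLimit_hasDerivAt {S ρ₀ x t v : ℝ} (hL : 0 < L) (hlam : 0 < lam) (hc : 0 < c)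
    (hA : ∀ p q x t, c ≤ A p q x t ∧ A p q x t ≤ C) (hlC : lam * C ≤ 1 / 8)
    (hM : ∀ x t, |g x t| ≤ M) (hρ₀ : 0 < ρ₀) (hx0 : ρ₀ ≤ x) (hxL : x ≤ L - ρ₀) (hS0 : 0 ≤ S)
    (hS : ∀ᶠ m in (hyperfilter ℕ : Filter ℕ), ∀ i : ℤ, mesh L m * |(i : ℝ)| ≤ ρ₀ →
      |gridSol A g (mesh L m) lam (m + 1) (timeIdx lam (mesh L m) t)
          (spaceIdx (mesh L m) x + i + 1)
        - gridSol A g (mesh L m) lam (m + 1) (timeIdx lam (mesh L m) t)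
          (spaceIdx (mesh L m) x + i)| ≤ S * mesh L m ∧
      |lap (gridSol A g (mesh L m) lam (m + 1) (timeIdx lam (mesh L m) t))
          (spaceIdx (mesh L m) x + i)| ≤ S * mesh L m ^ 2)
    (hv : Tendsto (gridSlope A g L lam x t) (hyperfilter ℕ) (𝓝 v)) :
    HasDerivAt (fun y => gridLimit A g L lam y t) v x := by
  refine hasDerivAt_of_abs_le_rpow (K := S) (σ := 1) (δ := ρ₀ / 2) one_pos (by positivity)
    fun y hy => ?_
  have hy' := abs_le.1 hy
  have tY := tendsto_spaceIdx hL y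
  have tX := tendsto_spaceIdx hL x
  have tD := tY.sub tX
  have l1 := ((tendsto_gridVal hL hlam hc hA hlC hM (x := y) (by linarith) (by linarith) t).sub
    (tendsto_gridVal hL hlam hc hA hlC hM (x := x) (by linarith) (by linarith) t)).sub
    (hv.mul tD)
  have l2 := (tD.pow 2).const_mul S
  have e : |y - x| ^ ((1 : ℝ) + 1) = (y - x) ^ 2 := by
    rw [one_add_one_eq_two, Real.rpow_two, sq_abs]
  rw [e]
  refine le_of_tendsto_of_tendsto l1.abs l2 ?_
  have hev : ∀ᶠ m in (hyperfilter ℕ : Filter ℕ),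
      |mesh L m * spaceIdx (mesh L m) y - mesh L m * spaceIdx (mesh L m) x| < ρ₀ :=
    tD.abs.eventually_lt_const (by linarith)
  filter_upwards [hS, hev] with m hm hd
  have hh := mesh_pos hL m
  set h := mesh L m with hhdef
  set w := gridSol A g h lam (m + 1) (timeIdx lam h t) with hw
  set i₀ := spaceIdx h x with hi₀
  set j := spaceIdx h y with hj
  have hslope : gridSlope A g L lam x t m * h = w (i₀ + 1) - w i₀ := by
    rw [gridSlope, ← hhdef, ← hw, ← hi₀]
    field_simp
  have hlapw : ∀ i, lap (fun i => w (i₀ + i) - w i₀ - i * (w (i₀ + 1) - w i₀)) i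
      = lap w (i₀ + i) := by
    intro i
    simp only [lap]
    push_cast
    rw [← add_assoc, ← add_sub_assoc]
    ring_nf
  have key := abs_le_of_lap (w := fun i => w (i₀ + i) - w i₀ - i * (w (i₀ + 1) - w i₀))
    (m := |j - i₀|) (ε := S * h ^ 2) (by simp) (by
      have : (0 : ℝ) ≤ S * h ^ 2 := by positivity
      simpa using this) (by
      have := (hm 0 (by simpa using hρ₀.le)).2
      rw [add_zero, lap] at this
      convert this using 2
      push_cast
      rw [← sub_eq_add_neg]
      ring_nf) (fun i hi => by
      rw [hlapw]
      refine (hm i ?_).2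
      have h1 : |(i : ℝ)| ≤ |((j - i₀ : ℤ) : ℝ)| := by exact_mod_cast hi
      rw [← mul_sub, abs_mul, abs_of_pos hh] at hd
      push_cast at h1
      exact (mul_le_mul_of_nonneg_left h1 hh.le).trans hd.le) (j - i₀) le_rfl
  rw [add_sub_cancel] at key
  have e1 : gridVal A g L lam y t m = w j := rfl
  have e2 : gridVal A g L lam x t m = w i₀ := rfl
  rw [e1, e2]
  have e3 : gridSlope A g L lam x t m * (h * j - h * i₀)
      = ((j - i₀ : ℤ) : ℝ) * (w (i₀ + 1) - w i₀) := by
    rw [← hslope]; push_cast; ring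
  rw [e3]
  refine key.trans (le_of_eq ?_)
  push_cast
  ring

theorem tendsto_gridCoeff {α c' C' H δ x t v : ℝ} (hL : 0 < L) (hlam : 0 < lam) (hc : 0 < c)
    (hA : ∀ p q x t, c ≤ A p q x t ∧ A p q x t ≤ C) (hlC : lam * C ≤ 1 / 8)
    (hM : ∀ x t, |g x t| ≤ M) (hα0 : 0 < α) (hB : CoeffBounds L δ α c' C' H A) (hδ : 0 < δ)
    (hin : InnerDomain L δ x t)
    (hev : ∀ᶠ m in (hyperfilter ℕ : Filter ℕ), InnerDomain L δ
      (mesh L m * spaceIdx (mesh L m) x) (lam * mesh L m ^ 2 * timeIdx lam (mesh L m) t))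
    (hv : Tendsto (gridSlope A g L lam x t) (hyperfilter ℕ) (𝓝 v)) :
    Tendsto (fun m => gridCoeff A g (mesh L m) lam (m + 1) (timeIdx lam (mesh L m) t)
      (spaceIdx (mesh L m) x)) (hyperfilter ℕ) (𝓝 (A v (gridLimit A g L lam x t) x t)) := by
  obtain ⟨h1, h2, h3⟩ := hin
  rw [tendsto_iff_dist_tendsto_zero]
  have t1 := (hv.sub_const v).abs
  have t2 := ((tendsto_gridVal hL hlam hc hA hlC hM (x := x) (by linarith) (by linarith) t).sub_const
    (gridLimit A g L lam x t)).abs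
  have t3 := ((tendsto_spaceIdx hL x).sub_const x).abs
  have t4 := ((tendsto_timeIdx hL hlam (t := t) (by linarith)).sub_const t).abs
  have t5 := (((t1.add t2).add t3).add t4).rpow_const (p := α) (Or.inr hα0.le) |>.const_mul H
  simp only [sub_self, abs_zero, add_zero, Real.zero_rpow hα0.ne', mul_zero] at t5
  refine tendsto_of_tendsto_of_tendsto_of_le_of_le' tendsto_const_nhds t5
    (Eventually.of_forall fun _ => dist_nonneg) ?_
  filter_upwards [hev] with m hm
  rw [Real.dist_eq]
  exact hB.holder _ _ _ _ _ _ _ _ hm ⟨h1, h2, h3⟩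

set_option maxHeartbeats 1000000 in
theorem gridLimit_quadratic_approx {K σ ρ₀ δ x t a₀ ρ : ℝ} (hL : 0 < L) (hlam : 0 < lam)
    (hc : 0 < c) (hA : ∀ p q x t, c ≤ A p q x t ∧ A p q x t ≤ C) (hlC : lam * C ≤ 1 / 8)
    (hM : ∀ x t, |g x t| ≤ M) (hK : 0 < K) (hσ1 : σ ≤ 1)
    (hin : InnerDomain L δ x t) (hρ : 0 < ρ) (hρρ₀ : 2 * ρ ≤ ρ₀) (hρ1 : ρ ≤ 1) (hρδ : ρ ≤ δ / 2)
    (hE : ∀ᶠ m in (hyperfilter ℕ : Filter ℕ), ∀ ρ, mesh L m ≤ ρ → ρ ≤ ρ₀ →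
      ∃ c₀ c₁ c₂ : ℝ, ∀ (n : ℕ) (i : ℤ),
        |lam * mesh L m ^ 2 * n - lam * mesh L m ^ 2 * timeIdx lam (mesh L m) t| ≤ ρ ^ 2 →
        |mesh L m * i - mesh L m * spaceIdx (mesh L m) x| ≤ ρ →
        |gridSol A g (mesh L m) lam (m + 1) n i
          - (c₀ + c₁ * (mesh L m * i - mesh L m * spaceIdx (mesh L m) x)
          + c₂ * ((mesh L m * i - mesh L m * spaceIdx (mesh L m) x) ^ 2 / 2
          + gridCoeff A g (mesh L m) lam (m + 1) (timeIdx lam (mesh L m) t)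
            (spaceIdx (mesh L m) x)
            * (lam * mesh L m ^ 2 * n - lam * mesh L m ^ 2 * timeIdx lam (mesh L m) t)))|
        ≤ K * ρ ^ (2 + σ))
    (ha₀ : Tendsto (fun m => gridCoeff A g (mesh L m) lam (m + 1) (timeIdx lam (mesh L m) t)
      (spaceIdx (mesh L m) x)) (hyperfilter ℕ) (𝓝 a₀)) :
    ∃ c₀ c₁ c₂, ∀ y τ, |y - x| ≤ ρ → |τ - t| ≤ ρ ^ 2 →
      |gridLimit A g L lam y τ - (c₀ + c₁ * (y - x) + c₂ * ((y - x) ^ 2 / 2 + a₀ * (τ - t)))|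
        ≤ 8 * K * ρ ^ (2 + σ) := by
  obtain ⟨h1, h2, h3⟩ := hin
  have hevh : ∀ᶠ m in (hyperfilter ℕ : Filter ℕ), mesh L m < ρ / 2 :=
    (tendsto_mesh L).eventually_lt_const (by positivity)
  have hex := (hE.and hevh).mono fun m hm => hm.1 (2 * ρ) (by linarith [hm.2]) hρρ₀
  simp only [skolem] at hex
  obtain ⟨c₀, c₁, c₂, hE'⟩ := hex
  set B := M + K * (2 * ρ) ^ (2 + σ) with hBdef
  have hcb : ∀ᶠ m in (hyperfilter ℕ : Filter ℕ),
      |c₀ m| ≤ B ∧ |c₁ m| ≤ 2 * B / ρ ∧ |c₂ m| ≤ 16 * B / ρ ^ 2 := by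
    filter_upwards [hE', hevh, (tendsto_spaceIdx hL x).eventually_const_lt
      (show 3 * δ / 4 < x by linarith), (tendsto_spaceIdx hL x).eventually_lt_const
      (show x < L - 3 * δ / 4 by linarith)] with m hm hh hX1 hX2
    have hh0 := mesh_pos hL m
    set h := mesh L m with hhdef
    set d := ⌊ρ / h⌋₊ with hd
    have eρ : h * (ρ / h) = ρ := by field_simp
    have hd1 : h * d ≤ ρ := by
      have := mul_le_mul_of_nonneg_left (Nat.floor_le (div_pos hρ hh0).le) hh0.le
      rwa [eρ] at this
    have hd2 : ρ / 2 ≤ h * d := by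
      have := mul_le_mul_of_nonneg_left (Nat.lt_floor_add_one (ρ / h)).le hh0.le
      rw [eρ] at this
      linarith
    have hd0 : 0 < h * d := by linarith
    have key : ∀ i : ℤ, |h * i - h * spaceIdx h x| ≤ ρ →
        |c₀ m + c₁ m * (h * i - h * spaceIdx h x) + c₂ m * ((h * i - h * spaceIdx h x) ^ 2 / 2)|
          ≤ B := by
      intro i hi
      have e1 := hm (timeIdx lam h t) i (by simp; positivity) (by linarith)
      rw [sub_self, mul_zero, add_zero] at e1
      obtain ⟨i1, i2⟩ := abs_le.1 hi
      have e2 := (mesh_stripProblem hL hlam hA hlC m).abs_le hc hM (timeIdx lam h t) i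
        (by
          have : 0 < h * (i : ℝ) := by linarith
          exact_mod_cast ((mul_pos_iff_of_pos_left hh0).1 this).le)
        (by
          have : h * (i : ℝ) ≤ h * (m + 1 : ℕ) := by rw [mesh_mul]; linarith
          exact_mod_cast (mul_le_mul_iff_right₀ hh0).1 this)
      rw [← hhdef] at e2
      rw [abs_le] at e1 e2 ⊢
      constructor <;> linarith
    have k0 := key (spaceIdx h x) (by simp [hρ.le])
    have k1 := key (spaceIdx h x + d) (by push_cast; rw [mul_add, add_sub_cancel_left, abs_of_pos hd0]; exact hd1)
    have k2 := key (spaceIdx h x - d) (by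
      push_cast; rw [mul_sub, sub_sub_cancel_left, abs_neg, abs_of_pos hd0]; exact hd1)
    push_cast at k1 k2
    rw [mul_add, add_sub_cancel_left] at k1
    rw [mul_sub h, sub_sub_cancel_left, neg_sq] at k2
    simp only [sub_self, mul_zero, ne_eq, OfNat.ofNat_ne_zero, not_false_eq_true, zero_pow,
      zero_div, add_zero] at k0
    obtain ⟨q1, q2⟩ := quad_coeff_bound hd0 k0 k1 k2
    refine ⟨k0, ?_, ?_⟩
    · rw [le_div_iff₀ hρ]
      have := mul_le_mul_of_nonneg_left hd2 (abs_nonneg (c₁ m))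
      linarith
    · rw [le_div_iff₀ (by positivity)]
      have : (ρ / 2) ^ 2 ≤ (h * d) ^ 2 := by gcongr
      have := mul_le_mul_of_nonneg_left this (abs_nonneg (c₂ m))
      linarith
  have t0 := tendsto_ulim (hcb.mono fun m h => h.1)
  have t1 := tendsto_ulim (hcb.mono fun m h => h.2.1)
  have t2 := tendsto_ulim (hcb.mono fun m h => h.2.2)
  refine ⟨ulim c₀, ulim c₁, ulim c₂, fun y τ hy hτ => ?_⟩
  have hρsq : ρ ^ 2 ≤ ρ := by rw [sq]; exact mul_le_of_le_one_left hρ.le hρ1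
  obtain ⟨y1, y2⟩ := abs_le.1 hy
  obtain ⟨τ1, τ2⟩ := abs_le.1 hτ
  have tY := (tendsto_spaceIdx hL y).sub (tendsto_spaceIdx hL x)
  have tT := (tendsto_timeIdx hL hlam (t := τ) (by linarith)).sub
    (tendsto_timeIdx hL hlam (t := t) (by linarith))
  have tU := tendsto_gridVal hL hlam hc hA hlC hM (x := y) (by linarith) (by linarith) τ
  have tot := (tU.sub ((t0.add (t1.mul tY)).add (t2.mul (((tY.pow 2).div_const 2).add
    (ha₀.mul tT))))).abs
  have hpow : K * (2 * ρ) ^ (2 + σ) ≤ 8 * K * ρ ^ (2 + σ) := by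
    rw [Real.mul_rpow (by norm_num) hρ.le]
    have : (2 : ℝ) ^ (2 + σ) ≤ 8 := by
      calc (2 : ℝ) ^ (2 + σ) ≤ 2 ^ (3 : ℝ) :=
            Real.rpow_le_rpow_of_exponent_le (by norm_num) (by linarith)
        _ = 8 := by norm_num
    have h5 : 0 ≤ K * ρ ^ (2 + σ) := by positivity
    have := mul_le_mul_of_nonneg_left this h5
    linarith
  refine (le_of_tendsto tot ?_).trans hpow
  have eT : ∀ᶠ m in (hyperfilter ℕ : Filter ℕ), |lam * mesh L m ^ 2 * timeIdx lam (mesh L m) τ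
      - lam * mesh L m ^ 2 * timeIdx lam (mesh L m) t| < (2 * ρ) ^ 2 :=
    tT.abs.eventually_lt_const (by
      have : 0 < ρ ^ 2 := by positivity
      have : (2 * ρ) ^ 2 = 4 * ρ ^ 2 := by ring
      linarith)
  have eY : ∀ᶠ m in (hyperfilter ℕ : Filter ℕ), |mesh L m * spaceIdx (mesh L m) y
      - mesh L m * spaceIdx (mesh L m) x| < 2 * ρ :=
    tY.abs.eventually_lt_const (by linarith)
  filter_upwards [hE', eT, eY] with m hm h4 h5
  exact hm _ _ h4.le h5.le

/-- Interior expansions of the limits of the finite difference scheme. -/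
theorem gridLimit_parabolicExpansion {α H δ : ℝ} (hL : 0 < L) (hc : 0 < c) (hcC : c ≤ C)
    (hM0 : 0 ≤ M) (hα0 : 0 < α) (hα1 : α ≤ 1) (hH : 0 ≤ H) (hδ : 0 < δ) :
    ∃ K ρ₀ : ℝ, 0 < K ∧ 0 < ρ₀ ∧ ρ₀ ≤ 1 ∧ ρ₀ ≤ δ / 2 ∧
    ∀ (A : ℝ → ℝ → ℝ → ℝ → ℝ) (g : ℝ → ℝ → ℝ) (c' C' lam : ℝ),
      CoeffBounds L (δ / 2) α c C H A → 0 < c' → (∀ p q x t, c' ≤ A p q x t ∧ A p q x t ≤ C') →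
      0 < lam → lam ≤ 1 → lam * C' ≤ 1 / 8 → (∀ x t, |g x t| ≤ M) →
      ∀ x t, InnerDomain L δ x t → ∃ v s, ParabolicExpansion (gridLimit A g L lam) (α / (3 + α)) K ρ₀
        (A v (gridLimit A g L lam x t) x t) v s x t := by
  have hσ0 : 0 < α / (3 + α) := by positivity
  have hσ1 : α / (3 + α) ≤ 1 := by rw [div_le_one (by positivity)]; linarith
  obtain ⟨S, K₀, ρ₀, hS, hK₀, hρ₀, main⟩ := gridSol_interior_expansion (L := L) hc hcC hM0 hα0 hα1
    hH hδ
  obtain ⟨K, hK, hexp⟩ := exists_parabolicExpansion (K := 8 * K₀) (by positivity)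
    (hc.le.trans hcC) hσ0 hσ1
  set ρ₁ := min (ρ₀ / 2) (min 1 (δ / 2)) with hρ₁
  have r1 : ρ₁ ≤ ρ₀ / 2 := min_le_left _ _
  have r2 : ρ₁ ≤ 1 := (min_le_right _ _).trans (min_le_left _ _)
  have r3 : ρ₁ ≤ δ / 2 := (min_le_right _ _).trans (min_le_right _ _)
  have r0 : 0 < ρ₁ := by positivity
  refine ⟨K, ρ₁, hK, r0, r2, r3, ?_⟩
  intro A g c' C' lam hB hc' hA hlam hlam1 hlC hM x t hin
  have hin2 := hin.mono (show δ / 2 ≤ δ by linarith)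
  have hin' := hin
  obtain ⟨h1, h2, h3⟩ := hin'
  have hev : ∀ᶠ m in (hyperfilter ℕ : Filter ℕ), InnerDomain L (3 * δ / 4)
      (mesh L m * spaceIdx (mesh L m) x) (lam * mesh L m ^ 2 * timeIdx lam (mesh L m) t) := by
    filter_upwards [(tendsto_spaceIdx hL x).eventually_const_lt
      (show 3 * δ / 4 < x by linarith), (tendsto_spaceIdx hL x).eventually_lt_const
      (show x < L - 3 * δ / 4 by linarith), (tendsto_timeIdx hL hlam
      (show 0 ≤ t by linarith)).eventually_const_lt (show 3 * δ / 4 < t by linarith)]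
      with m e1 e2 e3
    exact ⟨e1.le, e2.le, e3.le⟩
  have hh : ∀ᶠ m in (hyperfilter ℕ : Filter ℕ), mesh L m < ρ₀ :=
    (tendsto_mesh L).eventually_lt_const hρ₀
  have hmain := (hev.and hh).mono fun m e =>
    main A g c' C' (mesh L m) lam (m + 1) _ _ hB (mesh_stripProblem hL hlam hA hlC m) hc' hM
      hlam1 e.2.le e.1
  have hSl := hmain.mono fun m h => h.1
  have hv := tendsto_ulim (abs_gridSlope_le hL hρ₀.le hSl)
  have ha₀ := tendsto_gridCoeff hL hlam hc' hA hlC hM hα0 hB (by positivity) hin2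
    (hev.mono fun m h => h.mono (by linarith)) hv
  obtain ⟨v', s, hvs⟩ := hexp (gridLimit A g L lam) ρ₁ _ x t r0
    (by
      have := hB.bound (ulim (gridSlope A g L lam x t)) (gridLimit A g L lam x t) x t hin2
      rw [abs_of_pos (hc.trans_le this.1)]
      exact this.2)
    (fun ρ hρ hρ1 => gridLimit_quadratic_approx hL hlam hc' hA hlC hM hK₀ hσ1 hin hρ
      (by linarith) (by linarith) (by linarith) (hmain.mono fun m h => h.2) ha₀)
  have hd := gridLimit_hasDerivAt (ρ₀ := min ρ₀ δ) hL hlam hc' hA hlC hM (lt_min hρ₀ hδ)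
    ((min_le_right _ _).trans h1) (by linarith [min_le_right ρ₀ δ]) hS.le
    (hSl.mono fun m h i hi => h i (hi.trans (min_le_left _ _))) hv
  have hd' := hvs.hasDerivAt_space r0 hK.le hσ0
  have hvv := hd.unique hd'
  refine ⟨v', s, ?_⟩
  rw [← hvv] at hvs ⊢
  exact hvs

end

namespace ParabolicExpansion

variable {U : ℝ → ℝ → ℝ} {σ K ρ₀ a₀ v s x t : ℝ}

theorem continuousAt (h : ParabolicExpansion U σ K ρ₀ a₀ v s x t) (hρ₀ : 0 < ρ₀) (hσ0 : 0 < σ) :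
    ContinuousAt (fun z : ℝ × ℝ => U z.1 z.2) (x, t) := by
  set Q : ℝ × ℝ → ℝ :=
    fun z => U x t + v * (z.1 - x) + s * ((z.1 - x) ^ 2 / 2 + a₀ * (z.2 - t)) with hQ
  have hQc : Continuous Q := by fun_prop
  have hQ0 : Q (x, t) = U x t := by simp [hQ]
  have hlim : Tendsto (fun ρ : ℝ => K * ρ ^ (2 + σ)) (𝓝[>] 0) (𝓝 0) := by
    have h1 : ContinuousAt (fun ρ : ℝ => K * ρ ^ (2 + σ)) 0 :=
      (Real.continuousAt_rpow_const _ _ (Or.inr (by linarith))).const_mul K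
    have h2 := h1.tendsto
    rw [Real.zero_rpow (by linarith), mul_zero] at h2
    exact h2.mono_left nhdsWithin_le_nhds
  rw [Metric.continuousAt_iff']
  intro ε hε
  obtain ⟨ρ, hρ1, hρ2, hρ3⟩ := ((hlim.eventually_lt_const (half_pos hε)).and
    ((Ioc_mem_nhdsGT hρ₀ : Set.Ioc 0 ρ₀ ∈ 𝓝[>] (0 : ℝ)))).exists
  have n1 : ∀ᶠ z : ℝ × ℝ in 𝓝 (x, t), |z.1 - x| < ρ := by
    have : Continuous fun z : ℝ × ℝ => |z.1 - x| := by fun_prop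
    exact this.tendsto' _ 0 (by simp) |>.eventually_lt_const hρ2
  have n2 : ∀ᶠ z : ℝ × ℝ in 𝓝 (x, t), |z.2 - t| < ρ ^ 2 := by
    have : Continuous fun z : ℝ × ℝ => |z.2 - t| := by fun_prop
    exact this.tendsto' _ 0 (by simp) |>.eventually_lt_const (by positivity)
  have n3 := Metric.continuousAt_iff'.1 (hQc.continuousAt (x := (x, t))) (ε / 2) (half_pos hε)
  filter_upwards [n1, n2, n3] with z h1 h2 h3
  have h4 := h ρ hρ2 hρ3 z.1 z.2 h1.le h2.le
  rw [hQ0, Real.dist_eq] at h3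
  rw [Real.dist_eq]
  calc |U z.1 z.2 - U x t| ≤ |U z.1 z.2 - Q z| + |Q z - U x t| := abs_sub_le _ _ _
    _ < ε := by linarith

end ParabolicExpansion

/-- Solutions of `u_t = A(u_x, u, x, t) u_xx` on `[0, L] × [0, ∞)` with boundary data `g`, together
with quantitative expansions away from the parabolic boundary. -/
structure ExpansionSolution (L M σ : ℝ) (K ρ : ℝ → ℝ) (A : ℝ → ℝ → ℝ → ℝ → ℝ) (g : ℝ → ℝ → ℝ)
    (U v s : ℝ → ℝ → ℝ) : Prop where
  cont : ContinuousOn (fun z : ℝ × ℝ => U z.1 z.2) (Set.Icc 0 L ×ˢ Set.Ici 0)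
  bound : ∀ x t, 0 ≤ x → x ≤ L → 0 ≤ t → |U x t| ≤ M
  data : ∀ x t, 0 ≤ x → x ≤ L → t = 0 ∨ 0 ≤ t ∧ (x = 0 ∨ x = L) → U x t = g x t
  expansion : ∀ δ, 0 < δ → ∀ x t, InnerDomain L δ x t →
    ParabolicExpansion U σ (K δ) (ρ δ) (A (v x t) (U x t) x t) (v x t) (s x t) x t

theorem exists_innerDomain {L x t : ℝ} (h0 : 0 < x) (h1 : x < L) (ht : 0 < t) :
    ∃ δ, 0 < δ ∧ InnerDomain L δ x t := by
  have h2 : 0 < L - x := by linarith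
  refine ⟨min x (min (L - x) t), by positivity, min_le_left _ _, ?_, ?_⟩
  · have : min x (min (L - x) t) ≤ L - x := (min_le_right _ _).trans (min_le_left _ _)
    linarith
  · exact (min_le_right _ _).trans (min_le_right _ _)

/-- A function which is continuous in the interior and attains its data on the parabolic boundary
is continuous. -/
theorem continuousOn_of_boundary {L : ℝ} {U g : ℝ → ℝ → ℝ}
    (hint : ∀ x t, 0 < x → x < L → 0 < t → ContinuousAt (fun z : ℝ × ℝ => U z.1 z.2) (x, t))
    (hdata : ∀ x t, 0 ≤ x → x ≤ L → t = 0 ∨ 0 ≤ t ∧ (x = 0 ∨ x = L) → U x t = g x t)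
    (hbd : ∀ y s, 0 ≤ y → y ≤ L → s = 0 ∨ 0 ≤ s ∧ (y = 0 ∨ y = L) → ∀ ε > 0, ∃ δ > 0, ∀ x t,
      0 ≤ x → x ≤ L → 0 ≤ t → |x - y| < δ → |t - s| < δ → |U x t - g y s| ≤ ε) :
    ContinuousOn (fun z : ℝ × ℝ => U z.1 z.2) (Set.Icc 0 L ×ˢ Set.Ici 0) := by
  rintro ⟨y, s⟩ ⟨⟨hy0, hyL⟩, hs⟩
  dsimp only at hy0 hyL
  have hs' : 0 ≤ s := hs
  by_cases hb : s = 0 ∨ 0 ≤ s ∧ (y = 0 ∨ y = L)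
  · rw [Metric.continuousWithinAt_iff]
    intro ε hε
    obtain ⟨δ, hδ, H⟩ := hbd y s hy0 hyL hb (ε / 2) (half_pos hε)
    refine ⟨δ, hδ, ?_⟩
    rintro ⟨x, t⟩ ⟨⟨hx0, hxL⟩, ht⟩ hd
    rw [Prod.dist_eq, max_lt_iff, Real.dist_eq, Real.dist_eq] at hd
    rw [Real.dist_eq]
    have := H x t hx0 hxL ht hd.1 hd.2
    dsimp only
    rw [hdata y s hy0 hyL hb]
    linarith
  · push Not at hb
    obtain ⟨h1, h2⟩ := hb
    have h3 := h2 hs'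
    exact (hint y s (lt_of_le_of_ne hy0 (Ne.symm h3.1)) (lt_of_le_of_ne hyL h3.2)
      (lt_of_le_of_ne hs' (Ne.symm h1))).continuousWithinAt

set_option maxHeartbeats 400000 in
/-- Existence for coefficients which are bounded above and below, with estimates depending only on
the local bounds for the coefficient. -/
theorem exists_expansionSolution {L M α : ℝ} (hL : 0 < L) (hM : 0 ≤ M) (hα0 : 0 < α) (hα1 : α ≤ 1)
    {c C H : ℝ → ℝ} (hc : ∀ δ, 0 < δ → 0 < c δ) (hcC : ∀ δ, 0 < δ → c δ ≤ C δ)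
    (hH : ∀ δ, 0 < δ → 0 ≤ H δ) :
    ∃ K ρ : ℝ → ℝ, (∀ δ, 0 < δ → 0 < K δ ∧ 0 < ρ δ ∧ ρ δ ≤ 1 ∧ ρ δ ≤ δ / 2) ∧
    ∀ (A : ℝ → ℝ → ℝ → ℝ → ℝ) (g : ℝ → ℝ → ℝ) (c' C' : ℝ),
      (∀ δ, 0 < δ → CoeffBounds L δ α (c δ) (C δ) (H δ) A) → 0 < c' →
      (∀ p q x t, c' ≤ A p q x t ∧ A p q x t ≤ C') →
      (Continuous fun z : ℝ × ℝ => g z.1 z.2) → (∀ x t, |g x t| ≤ M) →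
      ∃ U v s, ExpansionSolution L M (α / (3 + α)) K ρ A g U v s := by
  have hσ0 : 0 < α / (3 + α) := by positivity
  have main := fun δ : {δ : ℝ // 0 < δ} => gridLimit_parabolicExpansion (L := L) (M := M)
    (c := c (δ.1 / 2)) (C := C (δ.1 / 2)) (H := H (δ.1 / 2)) (δ := δ.1) hL
    (hc _ (half_pos δ.2)) (hcC _ (half_pos δ.2)) hM hα0 hα1 (hH _ (half_pos δ.2)) δ.2
  choose K ρ hK hρ hρ1 hρδ main using main
  classical
  refine ⟨fun δ => if h : 0 < δ then K ⟨δ, h⟩ else 0, fun δ => if h : 0 < δ then ρ ⟨δ, h⟩ else 0,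
    fun δ hδ => by simp only [hδ, dif_pos]; exact ⟨hK _, hρ _, hρ1 _, hρδ _⟩, ?_⟩
  intro A g c' C' hB hc' hA hg hgM
  have hC' : 0 < C' := hc'.trans_le ((hA 0 0 0 0).1.trans (hA 0 0 0 0).2)
  set lam := min 1 (1 / (8 * C')) with hlamdef
  have hlam : 0 < lam := by positivity
  have hlam1 : lam ≤ 1 := min_le_left _ _
  have hlC : lam * C' ≤ 1 / 8 := by
    have : lam ≤ 1 / (8 * C') := min_le_right _ _
    rw [le_div_iff₀ (by positivity)] at this
    linarith
  set U := gridLimit A g L lam with hU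
  have hexp : ∀ (δ : ℝ) (hδ : 0 < δ) (x t : ℝ), InnerDomain L δ x t →
      ∃ v s, ParabolicExpansion U (α / (3 + α)) (K ⟨δ, hδ⟩) (ρ ⟨δ, hδ⟩) (A v (U x t) x t) v s x t :=
    fun δ hδ x t hin => main ⟨δ, hδ⟩ A g c' C' lam (hB _ (half_pos hδ)) hc' hA hlam hlam1 hlC hgM
      x t hin
  have hbd : ∀ y s, 0 ≤ y → y ≤ L → s = 0 ∨ 0 ≤ s ∧ (y = 0 ∨ y = L) → ∀ ε > 0, ∃ δ > 0, ∀ x t,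
      0 ≤ x → x ≤ L → 0 ≤ t → |x - y| < δ → |t - s| < δ → |U x t - g y s| ≤ ε :=
    fun y s _ _ hys ε hε => gridLimit_boundary hL hlam hc' hA hlC hgM hg hys hε
  have hdata : ∀ x t, 0 ≤ x → x ≤ L → t = 0 ∨ 0 ≤ t ∧ (x = 0 ∨ x = L) → U x t = g x t := by
    intro x t h0 h1 hb
    have ht : 0 ≤ t := by rcases hb with h | h; exacts [h.ge, h.1]
    rw [← sub_eq_zero, ← abs_nonpos_iff]
    refine le_of_forall_pos_le_add fun ε hε => ?_
    obtain ⟨δ, hδ, H⟩ := hbd x t h0 h1 hb ε hε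
    have := H x t h0 h1 ht (by simpa using hδ) (by simpa using hδ)
    linarith
  refine ⟨U, fun x t => deriv (fun y => U y t) x, fun x t => deriv (fun τ => U x τ) t
    / A (deriv (fun y => U y t) x) (U x t) x t, ?_, ?_, hdata, ?_⟩
  · refine continuousOn_of_boundary ?_ hdata hbd
    intro x t h0 h1 ht
    obtain ⟨δ, hδ, hin⟩ := exists_innerDomain h0 h1 ht
    obtain ⟨v, s, h⟩ := hexp δ hδ x t hin
    exact h.continuousAt (hρ _) hσ0
  · exact fun x t h0 h1 ht => abs_le_of_tendsto
      (tendsto_gridVal hL hlam hc' hA hlC hgM h0 h1 t)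
      (Eventually.of_forall (abs_gridVal_le hL hlam hc' hA hlC hgM h0 h1 t))
  · intro δ hδ x t hin
    simp only [hδ, dif_pos]
    obtain ⟨v, s, h⟩ := hexp δ hδ x t hin
    have hv := (h.hasDerivAt_space (hρ _) (hK _).le hσ0).deriv
    have hs := (h.hasDerivAt_time (hρ _) hσ0).deriv
    have hpos : A v (U x t) x t ≠ 0 := (hc'.trans_le (hA _ _ _ _).1).ne'
    rw [hv, hs, mul_div_cancel_left₀ _ hpos]
    exact h

/-- Left derivative at a left-sided local maximum. -/
theorem HasDerivAt.nonneg_of_left_max {f : ℝ → ℝ} {f' t : ℝ} (hf : HasDerivAt f f' t)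
    (hmax : ∀ᶠ τ in 𝓝[<] t, f τ ≤ f t) : 0 ≤ f' := by
  have h1 := (hasDerivAt_iff_tendsto_slope_left_right.1 hf).1
  refine ge_of_tendsto h1 ?_
  filter_upwards [hmax, self_mem_nhdsWithin] with τ h2 h3
  have h4 : τ < t := h3
  rw [slope_def_field]
  exact div_nonneg_of_nonpos (by linarith) (by linarith)

/-- A quadratic polynomial which is nonpositive near the origin up to `o(z ^ 2)` errors. -/
theorem coeff_nonpos_of_local_le {p q σ K K₁ : ℝ} (hσ : 0 < σ)
    (h : ∀ᶠ z in 𝓝 (0 : ℝ), p * z + q * z ^ 2 / 2 ≤ K * |z| ^ (2 + σ) + K₁ * |z| ^ 3) :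
    p = 0 ∧ q ≤ 0 := by
  have herr : ∀ e : ℝ, 0 < e → Tendsto (fun z : ℝ => K * |z| ^ e + K₁ * |z|) (𝓝 0) (𝓝 0) := by
    intro e he
    have h1 : Continuous fun z : ℝ => K * |z| ^ e + K₁ * |z| := by
      have : Continuous fun z : ℝ => |z| ^ e := continuous_abs.rpow_const fun _ => Or.inr he.le
      fun_prop
    exact h1.tendsto' _ _ (by simp [Real.zero_rpow he.ne'])
  have hp : p = 0 := by
    by_contra hne
    have hsgn : ∀ e : ℝ, e = 1 ∨ e = -1 → e * p ≤ 0 := by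
      intro e he
      have hlim : Tendsto (fun z : ℝ => K * |z| ^ (1 + σ) + K₁ * |z| * |z| - e * q * z / 2 * e)
          (𝓝[>] 0) (𝓝 0) := by
        have h1 : Continuous fun z : ℝ =>
            K * |z| ^ (1 + σ) + K₁ * |z| * |z| - e * q * z / 2 * e := by
          have : Continuous fun z : ℝ => |z| ^ (1 + σ) :=
            continuous_abs.rpow_const fun _ => Or.inr (by linarith)
          fun_prop
        exact (h1.tendsto' 0 0 (by simp [Real.zero_rpow (by linarith : (1 + σ) ≠ 0)])).mono_left
          nhdsWithin_le_nhds
      refine ge_of_tendsto hlim ?_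
      have h2 : Tendsto (fun z : ℝ => e * z) (𝓝[>] 0) (𝓝 0) := by
        have : Continuous fun z : ℝ => e * z := by fun_prop
        exact (this.tendsto' 0 0 (by simp)).mono_left nhdsWithin_le_nhds
      filter_upwards [h2.eventually h, self_mem_nhdsWithin] with z h3 h4
      have hz : 0 < z := h4
      have ha : |e * z| = z := by
        rcases he with rfl | rfl <;> simp [abs_of_pos hz]
      have he2 : e ^ 2 = 1 := by rcases he with rfl | rfl <;> norm_num
      rw [ha, show (2 : ℝ) + σ = (1 + σ) + 1 by ring, Real.rpow_add_one hz.ne'] at h3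
      rw [abs_of_pos hz]
      have h5 : (e * p) * z ≤ (K * z ^ (1 + σ) + K₁ * z * z - e * q * z / 2 * e) * z := by
        have : e * q * z / 2 * e * z = q * (e * z) ^ 2 / 2 := by ring
        linarith
      exact le_of_mul_le_mul_right h5 hz
    rcases lt_or_gt_of_ne hne with h1 | h1
    · have := hsgn (-1) (Or.inr rfl)
      linarith
    · have := hsgn 1 (Or.inl rfl)
      linarith
  refine ⟨hp, ?_⟩
  subst hp
  have h1 : q / 2 ≤ 0 := by
    refine ge_of_tendsto ((herr σ hσ).mono_left (nhdsWithin_le_nhds (s := Set.Ioi 0))) ?_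
    filter_upwards [h.filter_mono nhdsWithin_le_nhds, self_mem_nhdsWithin] with z h3 h4
    have hz : 0 < z := h4
    rw [abs_of_pos hz, show (2 : ℝ) + σ = σ + 1 + 1 by ring, Real.rpow_add_one hz.ne',
      Real.rpow_add_one hz.ne'] at h3
    rw [abs_of_pos hz]
    have h5 : q / 2 * (z * z) ≤ (K * z ^ σ + K₁ * z) * (z * z) := by
      linarith [show 0 * z + q * z ^ 2 / 2 = q / 2 * (z * z) by ring,
        show K * (z ^ σ * z * z) + K₁ * z ^ 3 = (K * z ^ σ + K₁ * z) * (z * z) by ring]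
    exact le_of_mul_le_mul_right h5 (by positivity)
  linarith

namespace ParabolicExpansion

variable {U : ℝ → ℝ → ℝ} {σ K ρ₀ a₀ v s x t : ℝ}

/-- First and second order conditions where a function is touched from above. -/
theorem touch_space (h : ParabolicExpansion U σ K ρ₀ a₀ v s x t) (hρ₀ : 0 < ρ₀) (hσ0 : 0 < σ)
    {p q K₁ : ℝ} (hmax : ∀ᶠ y in 𝓝 x,
      U y t ≤ U x t + p * (y - x) + q * (y - x) ^ 2 / 2 + K₁ * |y - x| ^ 3) :
    v = p ∧ s ≤ q := by
  have key : v - p = 0 ∧ s - q ≤ 0 := by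
    refine coeff_nonpos_of_local_le (K := K) (K₁ := K₁) hσ0 ?_
    have h1 : Tendsto (fun z : ℝ => x + z) (𝓝 0) (𝓝 x) := by
      have : Continuous fun z : ℝ => x + z := by fun_prop
      exact this.tendsto' _ _ (by simp)
    have h2 : ∀ᶠ z : ℝ in 𝓝 0, |z| < ρ₀ :=
      (continuous_abs.tendsto' (0 : ℝ) 0 (by simp)).eventually_lt_const hρ₀
    filter_upwards [h1.eventually hmax, h2] with z hz hzρ
    rcases eq_or_ne z 0 with rfl | hne
    · simp [Real.zero_rpow (by linarith : 2 + σ ≠ 0)]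
    have h3 := h |z| (abs_pos.2 hne) hzρ.le (x + z) t (by simp) (by simp [sq_nonneg])
    simp only [add_sub_cancel_left, sub_self, mul_zero, add_zero] at h3 hz
    have h4 := (abs_le.1 h3).1
    linarith
  exact ⟨by linarith [key.1], by linarith [key.2]⟩

theorem touch_time (h : ParabolicExpansion U σ K ρ₀ a₀ v s x t) (hρ₀ : 0 < ρ₀) (hσ0 : 0 < σ)
    {η : ℝ → ℝ} {r : ℝ} (hη : HasDerivAt η r t)
    (hmax : ∀ᶠ τ in 𝓝[<] t, U x τ - η τ ≤ U x t - η t) : r ≤ a₀ * s := by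
  have := ((h.hasDerivAt_time hρ₀ hσ0).sub hη).nonneg_of_left_max hmax
  linarith

theorem neg (h : ParabolicExpansion U σ K ρ₀ a₀ v s x t) :
    ParabolicExpansion (fun y τ => -U y τ) σ K ρ₀ a₀ (-v) (-s) x t := by
  intro ρ h0 h1 y τ hy hτ
  have h2 := h ρ h0 h1 y τ hy hτ
  rw [← abs_neg] at h2
  refine le_trans (le_of_eq ?_) h2
  congr 1
  ring

theorem reflect {L : ℝ} (h : ParabolicExpansion U σ K ρ₀ a₀ v s (L - x) t) :
    ParabolicExpansion (fun y τ => U (L - y) τ) σ K ρ₀ a₀ (-v) s x t := by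
  intro ρ h0 h1 y τ hy hτ
  have h2 := h ρ h0 h1 (L - y) τ (by rw [← abs_neg]; convert hy using 2; ring) hτ
  refine le_trans (le_of_eq ?_) h2
  congr 1
  ring

end ParabolicExpansion

/-- Classical solutions of `u_t = b u_xx` on `[0, L] × [0, ∞)` with data `g`, whose coefficient
satisfies `b u_x ^ 2 ≥ A` where `|u_x| ≥ P` and is at most `N p` where `|u_x| ≤ p`. -/
structure ControlledSolution (L M A P : ℝ) (N : ℝ → ℝ) (g U b v s : ℝ → ℝ → ℝ) : Prop where
  cont : ContinuousOn (fun z : ℝ × ℝ => U z.1 z.2) (Set.Icc 0 L ×ˢ Set.Ici 0)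
  bound : ∀ x t, 0 ≤ x → x ≤ L → 0 ≤ t → |U x t| ≤ M
  data : ∀ x t, 0 ≤ x → x ≤ L → t = 0 ∨ 0 ≤ t ∧ (x = 0 ∨ x = L) → U x t = g x t
  expansion : ∀ x t, 0 < x → x < L → 0 < t → ∃ σ K ρ, 0 < σ ∧ 0 < ρ ∧
    ParabolicExpansion U σ K ρ (b x t) (v x t) (s x t) x t
  pos : ∀ x t, 0 < x → x < L → 0 < t → 0 < b x t
  degen : ∀ x t, 0 < x → x < L → 0 < t → P ≤ |v x t| → A ≤ b x t * v x t ^ 2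
  upper : ∀ x t p, 0 < x → x < L → 0 < t → |v x t| ≤ p → b x t ≤ N p

namespace ControlledSolution

variable {L M A P : ℝ} {N : ℝ → ℝ} {g U b v s : ℝ → ℝ → ℝ}

theorem neg (h : ControlledSolution L M A P N g U b v s) :
    ControlledSolution L M A P N (fun x t => -g x t) (fun x t => -U x t) b (fun x t => -v x t)
      (fun x t => -s x t) where
  cont := h.cont.neg
  bound x t h0 h1 ht := by rw [abs_neg]; exact h.bound x t h0 h1 ht
  data x t h0 h1 ht := by rw [h.data x t h0 h1 ht]
  expansion x t h0 h1 ht := by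
    obtain ⟨σ, K, ρ, hσ, hρ, he⟩ := h.expansion x t h0 h1 ht
    exact ⟨σ, K, ρ, hσ, hρ, he.neg⟩
  pos := h.pos
  degen x t h0 h1 ht hp := by
    rw [neg_sq]
    exact h.degen x t h0 h1 ht (by rwa [abs_neg] at hp)
  upper x t p h0 h1 ht hp := h.upper x t p h0 h1 ht (by rwa [abs_neg] at hp)

theorem reflect (h : ControlledSolution L M A P N g U b v s) :
    ControlledSolution L M A P N (fun x t => g (L - x) t) (fun x t => U (L - x) t)
      (fun x t => b (L - x) t) (fun x t => -v (L - x) t) (fun x t => s (L - x) t) where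
  cont := by
    have h1 : ContinuousOn (fun z : ℝ × ℝ => (L - z.1, z.2)) (Set.Icc 0 L ×ˢ Set.Ici 0) := by
      fun_prop
    refine h.cont.comp h1 ?_
    rintro ⟨x, t⟩ ⟨⟨h0, h1⟩, ht⟩
    dsimp only at h0 h1
    exact ⟨⟨by dsimp only; linarith, by dsimp only; linarith⟩, ht⟩
  bound x t h0 h1 ht := h.bound _ t (by linarith) (by linarith) ht
  data x t h0 h1 ht := by
    refine h.data _ t (by linarith) (by linarith) (ht.imp_right fun h2 => ⟨h2.1, ?_⟩)
    rcases h2.2 with rfl | rfl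
    · exact Or.inr (by ring)
    · exact Or.inl (by ring)
  expansion x t h0 h1 ht := by
    obtain ⟨σ, K, ρ, hσ, hρ, he⟩ := h.expansion (L - x) t (by linarith) (by linarith) ht
    exact ⟨σ, K, ρ, hσ, hρ, he.reflect⟩
  pos x t h0 h1 ht := h.pos _ t (by linarith) (by linarith) ht
  degen x t h0 h1 ht hp := by
    rw [neg_sq]
    exact h.degen _ t (by linarith) (by linarith) ht (by rwa [abs_neg] at hp)
  upper x t p h0 h1 ht hp :=
    h.upper _ t p (by linarith) (by linarith) ht (by rwa [abs_neg] at hp)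

/-- Comparison with a strict supersolution `φ x + η t`. -/
theorem le_barrier (h : ControlledSolution L M A P N g U b v s) {ℓ τ : ℝ} (hℓ : 0 < ℓ)
    (hℓL : ℓ ≤ L) (hτ : 0 ≤ τ) {φ η p q η' : ℝ → ℝ} (hφ : ContinuousOn φ (Set.Icc 0 ℓ))
    (hη : ∀ t, HasDerivAt η (η' t) t)
    (hφ2 : ∀ x, 0 < x → x < ℓ → ∃ K₁, ∀ᶠ y in 𝓝 x,
      φ y ≤ φ x + p x * (y - x) + q x * (y - x) ^ 2 / 2 + K₁ * |y - x| ^ 3)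
    (hsup : ∀ x t, 0 < x → x < ℓ → 0 < t → t ≤ τ → v x t = p x → b x t * q x < η' t)
    (hinit : ∀ x, 0 ≤ x → x ≤ ℓ → U x 0 ≤ φ x + η 0)
    (hleft : ∀ t, 0 ≤ t → t ≤ τ → U 0 t ≤ φ 0 + η t)
    (hright : ∀ t, 0 ≤ t → t ≤ τ → U ℓ t ≤ φ ℓ + η t) {x t : ℝ} (hx0 : 0 ≤ x) (hxℓ : x ≤ ℓ)
    (ht0 : 0 ≤ t) (htτ : t ≤ τ) : U x t ≤ φ x + η t := by
  set R : Set (ℝ × ℝ) := Set.Icc 0 ℓ ×ˢ Set.Icc 0 τ with hR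
  have hRc : IsCompact R := isCompact_Icc.prod isCompact_Icc
  have hcont : ContinuousOn (fun z : ℝ × ℝ => U z.1 z.2 - (φ z.1 + η z.2)) R := by
    refine (h.cont.mono ?_).sub ((hφ.comp continuousOn_fst fun z hz => hz.1).add ?_)
    · exact Set.prod_mono (Set.Icc_subset_Icc_right hℓL) Set.Icc_subset_Ici_self
    · have : Continuous η := continuous_iff_continuousAt.2 fun t => (hη t).continuousAt
      exact (this.comp continuous_snd).continuousOn
  obtain ⟨⟨y, r⟩, ⟨⟨hy0, hyℓ⟩, hr0, hrτ⟩, hmax⟩ :=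
    hRc.exists_isMaxOn ⟨(0, 0), ⟨le_rfl, hℓ.le⟩, le_rfl, hτ⟩ hcont
  dsimp only at hy0 hyℓ hr0 hrτ
  have hmax' : ∀ x t, 0 ≤ x → x ≤ ℓ → 0 ≤ t → t ≤ τ →
      U x t - (φ x + η t) ≤ U y r - (φ y + η r) :=
    fun x t h0 h1 h2 h3 => hmax (⟨⟨h0, h1⟩, h2, h3⟩ : (x, t) ∈ R)
  suffices U y r ≤ φ y + η r by linarith [hmax' x t hx0 hxℓ ht0 htτ]
  rcases hr0.eq_or_lt with rfl | hr
  · exact hinit y hy0 hyℓ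
  rcases hy0.eq_or_lt with rfl | hy
  · exact hleft r hr0 hrτ
  rcases hyℓ.eq_or_lt with rfl | hyl
  · exact hright r hr0 hrτ
  exfalso
  obtain ⟨σ, K, ρ, hσ, hρ, he⟩ := h.expansion y r hy (hyl.trans_le hℓL) hr
  obtain ⟨K₁, hK₁⟩ := hφ2 y hy hyl
  have hs := he.touch_space hρ hσ (p := p y) (q := q y) (K₁ := K₁) (by
    filter_upwards [hK₁, Icc_mem_nhds hy hyl] with z hz hz2
    linarith [hmax' z r hz2.1 hz2.2 hr0 hrτ])
  have hb := h.pos y r hy (hyl.trans_le hℓL) hr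
  have ht := he.touch_time hρ hσ (hη r) (by
    filter_upwards [Ioo_mem_nhdsLT hr] with z hz
    linarith [hmax' y z hy0 hyℓ hz.1.le (hz.2.le.trans hrτ)])
  have h1 := hsup y r hy hyl hr hrτ hs.1
  have h2 := mul_le_mul_of_nonneg_left hs.2 hb.le
  linarith

end ControlledSolution

/-- The concave barrier whose derivative is `1 / (δ + B y)`. -/
noncomputable def logBarrier (B δ y : ℝ) : ℝ := Real.log (1 + B * y / δ) / B

section LogBarrier

variable {B δ : ℝ}

theorem logBarrier_nonneg (hB : 0 < B) (hδ : 0 < δ) {y : ℝ} (hy : 0 ≤ y) :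
    0 ≤ logBarrier B δ y :=
  div_nonneg (Real.log_nonneg (by linarith [show 0 ≤ B * y / δ by positivity])) hB.le

theorem logBarrier_le (hB : 0 < B) (hδ : 0 < δ) {y : ℝ} (hy : 0 ≤ y) :
    logBarrier B δ y ≤ y / δ := by
  have h0 : 0 ≤ B * y / δ := by positivity
  have h1 := Real.log_le_sub_one_of_pos (by linarith : 0 < 1 + B * y / δ)
  rw [logBarrier, div_le_iff₀ hB]
  have : y / δ * B = B * y / δ := by ring
  linarith

theorem continuousOn_logBarrier (hB : 0 < B) (hδ : 0 < δ) :
    ContinuousOn (logBarrier B δ) (Set.Ici 0) := by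
  unfold logBarrier
  refine ContinuousOn.div_const (ContinuousOn.log (by fun_prop) ?_) _
  intro y hy
  have hy' : 0 ≤ y := hy
  positivity

theorem logBarrier_expansion (hB : 0 < B) (hδ : 0 < δ) {x : ℝ} (hx : 0 ≤ x) :
    ∃ K₁, ∀ᶠ y in 𝓝 x, logBarrier B δ y ≤ logBarrier B δ x + 1 / (δ + B * x) * (y - x)
      + -B * (1 / (δ + B * x)) ^ 2 * (y - x) ^ 2 / 2 + K₁ * |y - x| ^ 3 := by
  have hd : 0 < δ + B * x := by positivity
  set p := 1 / (δ + B * x) with hp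
  have hp0 : 0 < p := by positivity
  refine ⟨2 * B ^ 2 * p ^ 3, ?_⟩
  have hz : ∀ᶠ y in 𝓝 x, |B * p * (y - x)| < 1 / 2 := by
    have : Continuous fun y : ℝ => |B * p * (y - x)| := by fun_prop
    exact (this.tendsto' x 0 (by simp)).eventually_lt_const (by norm_num)
  filter_upwards [hz] with y hy
  set z := B * p * (y - x) with hzdef
  have hz1 := (abs_lt.1 hy).1
  have h1 : 1 + B * y / δ = (1 + B * x / δ) * (1 + z) := by
    rw [hzdef, hp]
    field_simp
    ring
  have h2 : logBarrier B δ y = logBarrier B δ x + Real.log (1 + z) / B := by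
    have : 0 < 1 + B * x / δ := by positivity
    rw [logBarrier, h1, Real.log_mul this.ne' (by linarith), add_div, logBarrier]
  have h3 := Real.abs_log_sub_add_sum_range_le (x := -z) (by rw [abs_neg]; linarith) 2
  rw [abs_neg, sub_neg_eq_add] at h3
  have h4 : |z| ^ (2 + 1) / (1 - |z|) ≤ 2 * |z| ^ 3 := by
    rw [div_le_iff₀ (by linarith)]
    have : 0 ≤ |z| ^ 3 * (1 / 2 - |z|) := mul_nonneg (by positivity) (by linarith)
    rw [show 2 * |z| ^ 3 * (1 - |z|) = |z| ^ (2 + 1) + 2 * (|z| ^ 3 * (1 / 2 - |z|)) by ring]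
    exact le_add_of_nonneg_right (by linarith)
  have h5 : Real.log (1 + z) ≤ z - z ^ 2 / 2 + 2 * |z| ^ 3 := by
    have h6 := (abs_le.1 (h3.trans h4)).2
    simp only [Finset.sum_range_succ, Finset.sum_range_zero] at h6
    norm_num at h6
    linarith
  have h7 : |z| = B * p * |y - x| := by
    rw [hzdef, abs_mul, abs_of_pos (by positivity)]
  rw [h2]
  have h8 : Real.log (1 + z) / B ≤ (z - z ^ 2 / 2 + 2 * |z| ^ 3) / B :=
    div_le_div_of_nonneg_right h5 hB.le
  refine le_trans (add_le_add_right h8 _) (le_of_eq ?_)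
  rw [h7, hzdef]
  field_simp
  ring

/-- The height of the barrier can be prescribed by taking `δ` small. -/
theorem le_logBarrier (hB : 0 < B) {ℓ m : ℝ} (hℓ : 0 < ℓ) :
    m ≤ logBarrier B (B * ℓ * Real.exp (-(m * B))) ℓ := by
  rw [logBarrier, le_div_iff₀ hB, ← Real.log_exp (m * B)]
  refine Real.log_le_log (Real.exp_pos _) ?_
  have : B * ℓ / (B * ℓ * Real.exp (-(Real.log (Real.exp (m * B)))) ) = Real.exp (m * B) := by
    rw [Real.log_exp, Real.exp_neg]
    field_simp
  rw [this]
  linarith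

end LogBarrier

namespace ControlledSolution

variable {L M A P : ℝ} {N : ℝ → ℝ} {g : ℝ → ℝ → ℝ}

/-- Upper barrier at the initial time. -/
theorem exists_initial_le (hL : 0 < L) (hg : Continuous fun z : ℝ × ℝ => g z.1 z.2)
    (hM : ∀ x t, |g x t| ≤ M) (ξ : ℝ) (h0 : 0 ≤ ξ) (h1 : ξ ≤ L) {ε : ℝ} (hε : 0 < ε) :
    ∃ B, 0 ≤ B ∧ ∀ U b v s, ControlledSolution L M A P N g U b v s → ∀ x t, 0 ≤ x → x ≤ L →
      0 ≤ t → U x t ≤ g ξ 0 + ε + B * (x - ξ) ^ 2 + B * t + B * t ^ 2 := by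
  obtain ⟨B, hB, hmod⟩ := exists_quadratic_modulus hg hM ξ 0 hε
  set K := 2 * B * |N (2 * B * L)| + 1 with hK
  have hK0 : 0 ≤ 2 * B * |N (2 * B * L)| := by positivity
  refine ⟨B + K, by linarith, ?_⟩
  intro U b v s h x t hx0 hxL ht
  have hmod' : ∀ y r, g y r ≤ g ξ 0 + ε + B * (y - ξ) ^ 2 + B * r ^ 2 := by
    intro y r
    have := (abs_le.1 (hmod y r)).2
    rw [sub_zero] at this
    linarith
  have key := h.le_barrier (ℓ := L) (τ := t) hL le_rfl ht
    (φ := fun y => g ξ 0 + ε + B * (y - ξ) ^ 2) (η := fun r => K * r + B * r ^ 2)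
    (p := fun y => 2 * B * (y - ξ)) (q := fun _ => 2 * B) (η' := fun r => K + 2 * B * r)
    (by fun_prop)
    (fun r => by
      have h2 := ((hasDerivAt_id r).const_mul K).add (((hasDerivAt_id r).pow 2).const_mul B)
      refine h2.congr_deriv ?_
      simp only [id]
      norm_num
      ring)
    (fun y _ _ => ⟨0, Eventually.of_forall fun z => le_of_eq (by ring)⟩)
    (fun y r hy0 hyL hr0 _ hv => by
      have h2 : |v y r| ≤ 2 * B * L := by
        rw [hv, abs_mul, abs_of_nonneg (by positivity : 0 ≤ 2 * B)]
        exact mul_le_mul_of_nonneg_left (abs_le.2 ⟨by linarith, by linarith⟩) (by positivity)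
      have h3 := (h.upper y r _ hy0 hyL hr0 h2).trans (le_abs_self _)
      have h4 := mul_le_mul_of_nonneg_right h3 (by positivity : 0 ≤ 2 * B)
      have h5 : 0 ≤ 2 * B * r := by positivity
      linarith)
    (fun y hy0 hyL => by
      rw [h.data y 0 hy0 hyL (Or.inl rfl)]
      have := hmod' y 0
      linarith)
    (fun r hr0 _ => by
      rw [h.data 0 r le_rfl hL.le (Or.inr ⟨hr0, Or.inl rfl⟩)]
      have := hmod' 0 r
      have : 0 ≤ K * r := mul_nonneg (by linarith) hr0
      linarith)
    (fun r hr0 _ => by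
      rw [h.data L r hL.le le_rfl (Or.inr ⟨hr0, Or.inr rfl⟩)]
      have := hmod' L r
      have : 0 ≤ K * r := mul_nonneg (by linarith) hr0
      linarith)
    hx0 hxL ht le_rfl
  have e1 : 0 ≤ K * (x - ξ) ^ 2 := mul_nonneg (by linarith) (sq_nonneg _)
  have e2 : 0 ≤ K * t ^ 2 := mul_nonneg (by linarith) (sq_nonneg _)
  have e3 : 0 ≤ B * t := by positivity
  linarith

set_option maxHeartbeats 1000000 in
/-- Upper barrier at the left lateral boundary. -/
theorem exists_lateral_le (hL : 0 < L) (hA : 0 < A) (hP : 0 < P)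
    (hg : Continuous fun z : ℝ × ℝ => g z.1 z.2)
    (hM : ∀ x t, |g x t| ≤ M) (t₁ : ℝ) (ht₁ : 0 ≤ t₁) {ε : ℝ} (hε : 0 < ε) :
    ∃ B ℓ, 0 ≤ B ∧ 0 < ℓ ∧ ∀ U b v s, ControlledSolution L M A P N g U b v s → ∀ x t, 0 ≤ x →
      x ≤ ℓ → 0 ≤ t → t ≤ t₁ + 1 →
      U x t ≤ g 0 t₁ + ε + B * x + B * x ^ 2 + B * (t - t₁) ^ 2 := by
  obtain ⟨C, hC, hmod⟩ := exists_quadratic_modulus hg hM 0 t₁ hε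
  set Q := P + 2 * C * L + 4 * C + 1 with hQ
  have hCL : 0 ≤ 2 * C * L := by positivity
  have hQ1 : 1 ≤ Q := by linarith
  set B := 1 + 16 * C * t₁ / A + 1 / L with hB
  have hBA : 0 ≤ 16 * C * t₁ / A := by positivity
  have hBL : 0 < 1 / L := by positivity
  have hB1 : 1 ≤ B := by linarith
  have hB0 : 0 < B := by linarith
  have hQ0 : 0 < Q := by linarith
  set ℓ := 1 / (2 * B * Q) with hℓ
  have hℓ0 : 0 < ℓ := by positivity
  have hBℓ : B * ℓ = 1 / (2 * Q) := by rw [hℓ]; field_simp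
  have hℓL : ℓ ≤ L := by
    rw [hℓ, div_le_iff₀ (by positivity)]
    have h1 : 1 ≤ L * B := by
      have : L * (1 / L) = 1 := by field_simp
      have h2 := mul_le_mul_of_nonneg_left (by linarith : 1 / L ≤ B) hL.le
      linarith
    have h2 : L * B ≤ L * B * Q := le_mul_of_one_le_right (by positivity) hQ1
    have h3 : L * (2 * B * Q) = 2 * (L * B * Q) := by ring
    linarith
  set δ := B * ℓ * Real.exp (-(2 * M * B)) with hδ
  have hδ0 : 0 < δ := by positivity
  have hM0 : 0 ≤ M := (abs_nonneg _).trans (hM 0 0)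
  have hδℓ : δ ≤ B * ℓ := by
    refine mul_le_of_le_one_right (by positivity) (Real.exp_le_one_iff.2 ?_)
    have : 0 ≤ 2 * M * B := by positivity
    linarith
  have htop : 2 * M ≤ logBarrier B δ ℓ := le_logBarrier hB0 hℓ0
  have hmod' : ∀ y r, g y r ≤ g 0 t₁ + ε + C * y ^ 2 + C * (r - t₁) ^ 2 := by
    intro y r
    have := (abs_le.1 (hmod y r)).2
    rw [sub_zero] at this
    linarith
  refine ⟨1 / δ + C, ℓ, by positivity, hℓ0, ?_⟩
  intro U b v s h x t hx0 hxℓ ht0 ht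
  have key := h.le_barrier (ℓ := ℓ) (τ := t₁ + 1) hℓ0 hℓL (by linarith)
    (φ := fun y => g 0 t₁ + ε + C * y ^ 2 + logBarrier B δ y) (η := fun r => C * (r - t₁) ^ 2)
    (p := fun y => 2 * C * y + 1 / (δ + B * y))
    (q := fun y => 2 * C - B * (1 / (δ + B * y)) ^ 2) (η' := fun r => 2 * C * (r - t₁))
    (ContinuousOn.add (by fun_prop) ((continuousOn_logBarrier hB0 hδ0).mono
      Set.Icc_subset_Ici_self))
    (fun r => by
      have h2 := (((hasDerivAt_id r).sub_const t₁).pow 2).const_mul C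
      refine h2.congr_deriv ?_
      simp only [id]
      norm_num
      ring)
    (fun y hy _ => by
      obtain ⟨K₁, hK₁⟩ := logBarrier_expansion hB0 hδ0 hy.le
      refine ⟨K₁, hK₁.mono fun z hz => ?_⟩
      linarith [show C * z ^ 2 = C * y ^ 2 + 2 * C * y * (z - y) + 2 * C * (z - y) ^ 2 / 2 by ring])
    (fun y r hy0 hyℓ hr0 _ hv => by
      have hyL := hyℓ.trans_le hℓL
      set w := 1 / (δ + B * y) with hw
      have hwQ : Q ≤ w := by
        rw [hw, le_div_iff₀ (by positivity)]
        have h2 : B * y ≤ B * ℓ := by gcongr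
        have h3 : Q * (δ + B * y) ≤ Q * (2 * (B * ℓ)) := by gcongr; linarith
        have h4 : Q * (2 * (B * ℓ)) = 1 := by rw [hBℓ]; field_simp
        linarith
      have hCy : 2 * C * y ≤ 2 * C * L := by gcongr
      have hCy0 : 0 ≤ 2 * C * y := by positivity
      have hv1 : w ≤ v y r := by rw [hv]; linarith
      have hv2 : v y r ≤ 2 * w := by rw [hv]; linarith
      have hw0 : 0 < w := by linarith
      have hv3 : P ≤ |v y r| := by
        rw [abs_of_pos (by linarith)]
        linarith
      have hb := h.pos y r hy0 hyL hr0
      have h5 := h.degen y r hy0 hyL hr0 hv3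
      have h6 : v y r ^ 2 ≤ 4 * w ^ 2 := by
        have := pow_le_pow_left₀ (by linarith) hv2 2
        linarith [show (2 * w) ^ 2 = 4 * w ^ 2 by ring]
      have h7 : A ≤ b y r * (4 * w ^ 2) := h5.trans (mul_le_mul_of_nonneg_left h6 hb.le)
      have h8 : 4 * C ≤ B * w ^ 2 := by
        have e1 : w ≤ w ^ 2 := by
          rw [sq]
          exact le_mul_of_one_le_left hw0.le (by linarith)
        have e2 : w ^ 2 ≤ B * w ^ 2 := le_mul_of_one_le_left (by positivity) hB1
        linarith
      have h9 : b y r * (2 * C - B * w ^ 2) ≤ b y r * (-(B * w ^ 2 / 2)) :=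
        mul_le_mul_of_nonneg_left (by linarith) hb.le
      have h10 : B * A ≤ B * (b y r * (4 * w ^ 2)) := mul_le_mul_of_nonneg_left h7 hB0.le
      have h11 : A + 16 * C * t₁ ≤ B * A := by
        have : 16 * C * t₁ / A * A = 16 * C * t₁ := by field_simp
        have e2 := mul_le_mul_of_nonneg_right
          (by linarith : 1 + 16 * C * t₁ / A ≤ B) hA.le
        linarith
      have h12 : 0 ≤ C * r := by positivity
      linarith [show b y r * (-(B * w ^ 2 / 2)) = -(B * (b y r * (4 * w ^ 2))) / 8 by ring])
    (fun y hy0 hyℓ => by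
      rw [h.data y 0 hy0 (hyℓ.trans hℓL) (Or.inl rfl)]
      have := hmod' y 0
      have := logBarrier_nonneg hB0 hδ0 hy0
      linarith)
    (fun r hr0 _ => by
      rw [h.data 0 r le_rfl hL.le (Or.inr ⟨hr0, Or.inl rfl⟩)]
      have := hmod' 0 r
      have := logBarrier_nonneg hB0 hδ0 le_rfl
      linarith)
    (fun r hr0 _ => by
      have e1 := (abs_le.1 (h.bound ℓ r hℓ0.le hℓL hr0)).2
      have e2 := (abs_le.1 (hM 0 t₁)).1
      have e3 : 0 ≤ C * ℓ ^ 2 := by positivity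
      have e4 : 0 ≤ C * (r - t₁) ^ 2 := by positivity
      linarith)
    hx0 hxℓ ht0 ht
  have e1 := logBarrier_le hB0 hδ0 hx0
  have e2 : x / δ = 1 / δ * x := by ring
  have e3 : 0 ≤ C * x := by positivity
  have e4 : 0 ≤ 1 / δ * x ^ 2 := by positivity
  have e5 : 0 ≤ 1 / δ * (t - t₁) ^ 2 := by positivity
  linarith

theorem exists_small_quadratic {B ε : ℝ} (hB : 0 ≤ B) (hε : 0 < ε) :
    ∃ δ, 0 < δ ∧ δ ≤ 1 ∧ ∀ x t, |x| ≤ δ → |t| ≤ δ →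
      B * |x| + B * x ^ 2 + B * |t| + B * t ^ 2 ≤ ε := by
  refine ⟨min 1 (ε / (4 * (B + 1))), by positivity, min_le_left _ _, ?_⟩
  intro x t hx ht
  have h1 : (B + 1) * (ε / (4 * (B + 1))) = ε / 4 := by field_simp
  have key : ∀ y : ℝ, |y| ≤ min 1 (ε / (4 * (B + 1))) → B * |y| ≤ ε / 4 ∧ B * y ^ 2 ≤ ε / 4 := by
    intro y hy
    have h2 : B * |y| ≤ (B + 1) * (ε / (4 * (B + 1))) :=
      mul_le_mul (by linarith) (hy.trans (min_le_right _ _)) (abs_nonneg _) (by linarith)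
    have h3 : y ^ 2 ≤ |y| := by
      rw [← sq_abs, sq]
      exact mul_le_of_le_one_left (abs_nonneg _) (hy.trans (min_le_left _ _))
    exact ⟨by linarith, by linarith [mul_le_mul_of_nonneg_left h3 hB]⟩
  linarith [key x hx, key t ht]

theorem exists_initial_modulus (hL : 0 < L) (hg : Continuous fun z : ℝ × ℝ => g z.1 z.2)
    (hM : ∀ x t, |g x t| ≤ M) (ξ : ℝ) (h0 : 0 ≤ ξ) (h1 : ξ ≤ L) {ε : ℝ} (hε : 0 < ε) :
    ∃ δ, 0 < δ ∧ ∀ U b v s, ControlledSolution L M A P N g U b v s → ∀ x t, 0 ≤ x → x ≤ L →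
      0 ≤ t → |x - ξ| < δ → |t| < δ → U x t ≤ g ξ 0 + ε := by
  obtain ⟨B, hB, H⟩ := exists_initial_le (A := A) (P := P) (N := N) hL hg hM ξ h0 h1 (half_pos hε)
  obtain ⟨δ, hδ, hδ1, hs⟩ := exists_small_quadratic hB (half_pos hε)
  refine ⟨δ, hδ, fun U b v s h x t hx0 hxL ht hx ht' => ?_⟩
  have e1 := H U b v s h x t hx0 hxL ht
  have e2 := hs (x - ξ) t hx.le ht'.le
  rw [abs_of_nonneg ht] at e2
  have e3 : 0 ≤ B * |x - ξ| := by positivity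
  linarith

theorem exists_lateral_modulus (hL : 0 < L) (hA : 0 < A) (hP : 0 < P)
    (hg : Continuous fun z : ℝ × ℝ => g z.1 z.2)
    (hM : ∀ x t, |g x t| ≤ M) (t₁ : ℝ) (ht₁ : 0 ≤ t₁) {ε : ℝ} (hε : 0 < ε) :
    ∃ δ, 0 < δ ∧ ∀ U b v s, ControlledSolution L M A P N g U b v s → ∀ x t, 0 ≤ x → x ≤ L →
      0 ≤ t → |x| < δ → |t - t₁| < δ → U x t ≤ g 0 t₁ + ε := by
  obtain ⟨B, ℓ, hB, hℓ, H⟩ := exists_lateral_le (N := N) hL hA hP hg hM t₁ ht₁ (half_pos hε)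
  obtain ⟨δ, hδ, hδ1, hs⟩ := exists_small_quadratic hB (half_pos hε)
  refine ⟨min δ ℓ, lt_min hδ hℓ, fun U b v s h x t hx0 hxL ht hx ht' => ?_⟩
  have hxd := hx.trans_le (min_le_left _ _)
  have htd := ht'.trans_le (min_le_left _ _)
  have e1 := H U b v s h x t hx0 ((le_abs_self x).trans (hx.le.trans (min_le_right _ _))) ht
    (by linarith [(abs_lt.1 htd).2])
  have e2 := hs x (t - t₁) hxd.le htd.le
  rw [abs_of_nonneg hx0] at e2
  have e3 : 0 ≤ B * |t - t₁| := by positivity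
  linarith

/-- Controlled solutions attain their boundary data uniformly. -/
theorem exists_boundary_modulus (hL : 0 < L) (hA : 0 < A) (hP : 0 < P)
    (hg : Continuous fun z : ℝ × ℝ => g z.1 z.2) (hM : ∀ x t, |g x t| ≤ M) {y r : ℝ}
    (hy0 : 0 ≤ y) (hyL : y ≤ L) (hyr : r = 0 ∨ 0 ≤ r ∧ (y = 0 ∨ y = L)) {ε : ℝ} (hε : 0 < ε) :
    ∃ δ, 0 < δ ∧ ∀ U b v s, ControlledSolution L M A P N g U b v s → ∀ x t, 0 ≤ x → x ≤ L →
      0 ≤ t → |x - y| < δ → |t - r| < δ → |U x t - g y r| ≤ ε := by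
  have upper : ∀ g : ℝ → ℝ → ℝ, (Continuous fun z : ℝ × ℝ => g z.1 z.2) → (∀ x t, |g x t| ≤ M) →
      ∃ δ, 0 < δ ∧ ∀ U b v s, ControlledSolution L M A P N g U b v s → ∀ x t, 0 ≤ x → x ≤ L →
        0 ≤ t → |x - y| < δ → |t - r| < δ → U x t ≤ g y r + ε := by
    intro g hg hM
    rcases hyr with rfl | ⟨ht, rfl | rfl⟩
    · obtain ⟨δ, hδ, H⟩ := exists_initial_modulus (A := A) (P := P) (N := N) hL hg hM y hy0 hyL hε
      refine ⟨δ, hδ, fun U b v s h x t h0 h1 h2 h3 h4 => H U b v s h x t h0 h1 h2 h3 ?_⟩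
      rwa [sub_zero] at h4
    · obtain ⟨δ, hδ, H⟩ := exists_lateral_modulus (N := N) hL hA hP hg hM r ht hε
      refine ⟨δ, hδ, fun U b v s h x t h0 h1 h2 h3 h4 => H U b v s h x t h0 h1 h2 ?_ h4⟩
      rwa [sub_zero] at h3
    · have hg' : Continuous fun z : ℝ × ℝ => g (y - z.1) z.2 :=
        hg.comp (f := fun z : ℝ × ℝ => (y - z.1, z.2)) (by fun_prop)
      obtain ⟨δ, hδ, H⟩ := exists_lateral_modulus (N := N) (g := fun x t => g (y - x) t) hL hA hP
        hg' (fun x t => hM _ _) r ht hε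
      refine ⟨δ, hδ, fun U b v s h x t h0 h1 h2 h3 h4 => ?_⟩
      have := H _ _ _ _ h.reflect (y - x) t (by linarith) (by linarith) h2
        (by rwa [abs_sub_comm] at h3) h4
      simpa using this
  obtain ⟨δ₁, hδ₁, H₁⟩ := upper g hg hM
  obtain ⟨δ₂, hδ₂, H₂⟩ := upper (fun x t => -g x t) hg.neg
    (fun x t => by rw [abs_neg]; exact hM x t)
  refine ⟨min δ₁ δ₂, lt_min hδ₁ hδ₂, fun U b v s h x t h0 h1 h2 h3 h4 => ?_⟩
  have e1 := H₁ U b v s h x t h0 h1 h2 (h3.trans_le (min_le_left _ _))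
    (h4.trans_le (min_le_left _ _))
  have e2 := H₂ _ _ _ _ h.neg x t h0 h1 h2 (h3.trans_le (min_le_right _ _))
    (h4.trans_le (min_le_right _ _))
  rw [abs_le]
  constructor <;> linarith

end ControlledSolution

theorem ParabolicExpansion.nonneg {U : ℝ → ℝ → ℝ} {σ K ρ₀ a₀ v s x t : ℝ}
    (h : ParabolicExpansion U σ K ρ₀ a₀ v s x t) (hρ₀ : 0 < ρ₀) : 0 ≤ K := by
  have h1 := (abs_nonneg _).trans (h ρ₀ hρ₀ le_rfl x t (by simpa using hρ₀.le)
    (by simpa using sq_nonneg ρ₀))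
  exact nonneg_of_mul_nonneg_left h1 (by positivity)

/-- A bound for the gradient at distance `d` from the parabolic boundary. -/
noncomputable def gradBound (M A P d : ℝ) : ℝ :=
  2 * (2 * P + 8 * M / d + 8 * M / d ^ 2 + 1) * Real.exp (2 * M * (1 + 8 * M / d / A))

namespace ControlledSolution

variable {L M A P : ℝ} {N : ℝ → ℝ} {g U b v s : ℝ → ℝ → ℝ}

/-- Effect of the degeneracy condition at a point where the gradient is comparable to `w`. -/
theorem mul_le_of_gradient (h : ControlledSolution L M A P N g U b v s) {x t B C w : ℝ}
    (hx0 : 0 < x) (hxL : x < L) (ht : 0 < t) (hB : 0 ≤ B) (hCw : 4 * C ≤ B * w ^ 2)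
    (hP : 2 * P ≤ w) (hw : 0 ≤ w) (hv : |v x t - w| ≤ w / 2) :
    b x t * (-B * w ^ 2 + 2 * C) ≤ -(B * A / 8) := by
  have h1 := abs_le.1 hv
  have h2 : P ≤ |v x t| := by
    rw [abs_of_nonneg (by linarith)]
    linarith
  have hb := h.pos x t hx0 hxL ht
  have h3 := h.degen x t hx0 hxL ht h2
  have h4 : v x t ^ 2 ≤ 4 * w ^ 2 := by
    have := pow_le_pow_left₀ (by linarith) (by linarith : v x t ≤ 2 * w) 2
    linarith [show (2 * w) ^ 2 = 4 * w ^ 2 by ring]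
  have h5 : A ≤ b x t * (4 * w ^ 2) := h3.trans (mul_le_mul_of_nonneg_left h4 hb.le)
  have h6 := mul_le_mul_of_nonneg_left h5 hB
  have h7 : b x t * (-B * w ^ 2 + 2 * C) ≤ b x t * (-(B * w ^ 2 / 2)) :=
    mul_le_mul_of_nonneg_left (by linarith) hb.le
  linarith [show b x t * (-(B * w ^ 2 / 2)) = -(B * (b x t * (4 * w ^ 2))) / 8 by ring]

set_option maxHeartbeats 1000000 in
/-- Doubling of variables: a modulus of continuity in space. -/
theorem doubling (h : ControlledSolution L M A P N g U b v s) {d x₁ t₁ B C K δ ℓ : ℝ}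
    (hd : 0 < d) (hin : InnerDomain L d x₁ t₁) (hB : 0 < B) (hC : 0 ≤ C) (hCM : 2 * M ≤ C * d ^ 2)
    (hKM : 2 * M ≤ K * d) (hK : 0 ≤ K) (hKB : K < B * A / 4) (hδ : 0 < δ) (hℓ : 0 < ℓ)
    (htop : 2 * M ≤ logBarrier B δ ℓ) (hw : ∀ z, 0 < z → z < ℓ → 2 * P ≤ 1 / (δ + B * z) ∧
      4 * C ≤ B * (1 / (δ + B * z)) ^ 2 ∧ 4 * C * d ≤ 1 / (δ + B * z))
    {y : ℝ} (hy : y ≤ x₁) (hyd : x₁ - y ≤ d) (hyℓ : x₁ - y ≤ ℓ) :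
    U x₁ t₁ - U y t₁ ≤ logBarrier B δ (x₁ - y) + C * (y - x₁) ^ 2 := by
  obtain ⟨hin1, hin2, hin3⟩ := hin
  set S : Set (ℝ × ℝ × ℝ) := (Set.Icc (x₁ - d) (x₁ + d) ×ˢ Set.Icc (x₁ - d) (x₁ + d) ×ˢ
    Set.Icc (t₁ - d) t₁) ∩ {z | 0 ≤ z.1 - z.2.1 ∧ z.1 - z.2.1 ≤ ℓ} with hS
  have hSc : IsCompact S := by
    refine (isCompact_Icc.prod (isCompact_Icc.prod isCompact_Icc)).inter_right ?_
    have h1 : Continuous fun z : ℝ × ℝ × ℝ => z.1 - z.2.1 := by fun_prop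
    exact (isClosed_le continuous_const h1).inter (isClosed_le h1 continuous_const)
  have hcont : ContinuousOn (fun z : ℝ × ℝ × ℝ => U z.1 z.2.2 - U z.2.1 z.2.2
      - logBarrier B δ (z.1 - z.2.1) - C * ((z.1 - x₁) ^ 2 + (z.2.1 - x₁) ^ 2)
      - K * (t₁ - z.2.2)) S := by
    refine ContinuousOn.sub (ContinuousOn.sub (ContinuousOn.sub (ContinuousOn.sub ?_ ?_) ?_)
      (by fun_prop)) (by fun_prop)
    · refine h.cont.comp (f := fun z : ℝ × ℝ × ℝ => (z.1, z.2.2)) (by fun_prop) ?_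
      rintro ⟨x, y, t⟩ ⟨⟨⟨h1, h2⟩, ⟨h3, h4⟩, h5, h6⟩, -⟩
      dsimp only at h1 h2 h3 h4 h5 h6
      exact ⟨⟨by dsimp only; linarith, by dsimp only; linarith⟩, show 0 ≤ t by linarith⟩
    · refine h.cont.comp (f := fun z : ℝ × ℝ × ℝ => (z.2.1, z.2.2)) (by fun_prop) ?_
      rintro ⟨x, y, t⟩ ⟨⟨⟨h1, h2⟩, ⟨h3, h4⟩, h5, h6⟩, -⟩
      dsimp only at h1 h2 h3 h4 h5 h6
      exact ⟨⟨by dsimp only; linarith, by dsimp only; linarith⟩, show 0 ≤ t by linarith⟩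
    · exact (continuousOn_logBarrier hB hδ).comp (f := fun z : ℝ × ℝ × ℝ => z.1 - z.2.1)
        (by fun_prop) fun z hz => hz.2.1
  obtain ⟨⟨a, c, t⟩, ⟨⟨⟨ha1, ha2⟩, ⟨hc1, hc2⟩, ht1, ht2⟩, hac1, hac2⟩, hmax⟩ :=
    hSc.exists_isMaxOn ⟨(x₁, x₁, t₁), ⟨⟨by dsimp only; linarith, by dsimp only; linarith⟩,
      ⟨by dsimp only; linarith, by dsimp only; linarith⟩, by dsimp only; linarith, le_rfl⟩,
      by simp [hℓ.le]⟩ hcont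
  dsimp only at ha1 ha2 hc1 hc2 ht1 ht2 hac1 hac2
  have hmax' : ∀ x y τ, x₁ - d ≤ x → x ≤ x₁ + d → x₁ - d ≤ y → y ≤ x₁ + d → t₁ - d ≤ τ →
      τ ≤ t₁ → 0 ≤ x - y → x - y ≤ ℓ →
      U x τ - U y τ - logBarrier B δ (x - y) - C * ((x - x₁) ^ 2 + (y - x₁) ^ 2) - K * (t₁ - τ)
      ≤ U a t - U c t - logBarrier B δ (a - c) - C * ((a - x₁) ^ 2 + (c - x₁) ^ 2)
        - K * (t₁ - t) :=
    fun x y τ h1 h2 h3 h4 h5 h6 h7 h8 =>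
      hmax (⟨⟨⟨h1, h2⟩, ⟨h3, h4⟩, h5, h6⟩, h7, h8⟩ : (x, y, τ) ∈ S)
  suffices hle : U a t - U c t - logBarrier B δ (a - c) - C * ((a - x₁) ^ 2 + (c - x₁) ^ 2)
      - K * (t₁ - t) ≤ 0 by
    have := hmax' x₁ y t₁ (by linarith) (by linarith) (by linarith) (by linarith) (by linarith)
      le_rfl (by linarith) (by linarith)
    simp only [sub_self] at this
    linarith
  have ba := abs_le.1 (h.bound a t (by linarith) (by linarith) (by linarith))
  have bc := abs_le.1 (h.bound c t (by linarith) (by linarith) (by linarith))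
  have n1 : 0 ≤ C * (a - x₁) ^ 2 := by positivity
  have n2 : 0 ≤ C * (c - x₁) ^ 2 := by positivity
  have n3 : 0 ≤ K * (t₁ - t) := mul_nonneg hK (by linarith)
  have n4 := logBarrier_nonneg hB hδ hac1
  rcases hac1.eq_or_lt with e | hac1
  · have : a = c := by linarith
    subst this
    linarith
  rcases hac2.eq_or_lt with e | hac2
  · rw [e] at n4 ⊢
    linarith
  rcases ht1.eq_or_lt with e | ht1
  · have : K * (t₁ - t) = K * d := by rw [← e]; ring
    linarith
  rcases ha1.eq_or_lt with e | ha1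
  · have : C * (a - x₁) ^ 2 = C * d ^ 2 := by rw [← e]; ring
    linarith
  rcases ha2.eq_or_lt with e | ha2
  · have : C * (a - x₁) ^ 2 = C * d ^ 2 := by rw [e]; ring
    linarith
  rcases hc1.eq_or_lt with e | hc1
  · have : C * (c - x₁) ^ 2 = C * d ^ 2 := by rw [← e]; ring
    linarith
  rcases hc2.eq_or_lt with e | hc2
  · have : C * (c - x₁) ^ 2 = C * d ^ 2 := by rw [e]; ring
    linarith
  exfalso
  have ha0 : 0 < a := by linarith
  have haL : a < L := by linarith
  have hc0 : 0 < c := by linarith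
  have hcL : c < L := by linarith
  have ht0 : 0 < t := by linarith
  obtain ⟨σ₁, K₁, ρ₁, hσ₁, hρ₁, E₁⟩ := h.expansion a t ha0 haL ht0
  obtain ⟨σ₂, K₂, ρ₂, hσ₂, hρ₂, E₂⟩ := h.expansion c t hc0 hcL ht0
  obtain ⟨k, hk⟩ := logBarrier_expansion hB hδ hac1.le
  obtain ⟨w1, w2, w3⟩ := hw (a - c) hac1 hac2
  set w := 1 / (δ + B * (a - c)) with hwdef
  have hw0 : 0 < w := by rw [hwdef]; positivity
  have T₁ := E₁.touch_space hρ₁ hσ₁ (p := w + 2 * C * (a - x₁)) (q := -B * w ^ 2 + 2 * C)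
    (K₁ := k) (by
      have c1 : Tendsto (fun z => z - c) (𝓝 a) (𝓝 (a - c)) :=
        (continuous_sub_right c).tendsto a
      filter_upwards [c1.eventually hk, Icc_mem_nhds ha1 ha2,
        c1.eventually (Icc_mem_nhds hac1 hac2)] with z hz1 hz2 hz3
      have := hmax' z c t hz2.1 hz2.2 hc1.le hc2.le ht1.le ht2 hz3.1 hz3.2
      rw [show z - c - (a - c) = z - a by ring] at hz1
      linarith [show C * (z - x₁) ^ 2 = C * (a - x₁) ^ 2 + 2 * C * (a - x₁) * (z - a)
        + 2 * C * (z - a) ^ 2 / 2 by ring])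
  have T₂ := E₂.neg.touch_space hρ₂ hσ₂ (p := -w + 2 * C * (c - x₁)) (q := -B * w ^ 2 + 2 * C)
    (K₁ := k) (by
      have c1 : Tendsto (fun z => a - z) (𝓝 c) (𝓝 (a - c)) :=
        (continuous_sub_left a).tendsto c
      filter_upwards [c1.eventually hk, Icc_mem_nhds hc1 hc2,
        c1.eventually (Icc_mem_nhds hac1 hac2)] with z hz1 hz2 hz3
      have := hmax' a z t ha1.le ha2.le hz2.1 hz2.2 ht1.le ht2 hz3.1 hz3.2
      rw [show a - z - (a - c) = -(z - c) by ring, abs_neg] at hz1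
      linarith [show C * (z - x₁) ^ 2 = C * (c - x₁) ^ 2 + 2 * C * (c - x₁) * (z - c)
        + 2 * C * (z - c) ^ 2 / 2 by ring])
  have Tt : 0 ≤ b a t * s a t - b c t * s c t + K * 1 := by
    refine (((E₁.hasDerivAt_time hρ₁ hσ₁).sub (E₂.hasDerivAt_time hρ₂ hσ₂)).add
      ((hasDerivAt_id t).const_mul K)).nonneg_of_left_max ?_
    filter_upwards [Ioo_mem_nhdsLT ht1] with τ hτ
    have := hmax' a c τ ha1.le ha2.le hc1.le hc2.le hτ.1.le (hτ.2.le.trans ht2) hac1.le hac2.le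
    simp only [Pi.add_apply, Pi.sub_apply, id]
    linarith
  have Cd : ∀ z, x₁ - d < z → z < x₁ + d → |2 * C * (z - x₁)| ≤ w / 2 := by
    intro z h1 h2
    rw [abs_mul, abs_of_nonneg (by positivity : 0 ≤ 2 * C)]
    have h3 : |z - x₁| ≤ d := abs_le.2 ⟨by linarith, by linarith⟩
    have := mul_le_mul_of_nonneg_left h3 (by positivity : 0 ≤ 2 * C)
    linarith
  have G₁ := h.mul_le_of_gradient ha0 haL ht0 hB.le w2 w1 hw0.le (by
    rw [T₁.1, add_sub_cancel_left]
    exact Cd a ha1 ha2)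
  have G₂ := h.mul_le_of_gradient hc0 hcL ht0 hB.le w2 w1 hw0.le (by
    rw [show v c t - w = -(2 * C * (c - x₁)) by linarith [T₂.1], abs_neg]
    exact Cd c hc1 hc2)
  have F₁ := mul_le_mul_of_nonneg_left T₁.2 (h.pos a t ha0 haL ht0).le
  have F₂ := mul_le_mul_of_nonneg_left T₂.2 (h.pos c t hc0 hcL ht0).le
  linarith

theorem gradient_le (hA : 0 < A) (hP : 0 < P)
    (h : ControlledSolution L M A P N g U b v s) {d x t : ℝ} (hd : 0 < d) (hM : 0 ≤ M)
    (hin : InnerDomain L d x t) : v x t ≤ gradBound M A P d := by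
  set C := 2 * M / d ^ 2 with hC
  set K := 2 * M / d with hK
  set B := 1 + 8 * M / d / A with hB
  set Q := 2 * P + 8 * M / d + 8 * M / d ^ 2 + 1 with hQ
  have e1 : 0 ≤ 8 * M / d := by positivity
  have e2 : 0 ≤ 8 * M / d ^ 2 := by positivity
  have e3 : 0 ≤ 8 * M / d / A := by positivity
  have hQ1 : 1 ≤ Q := by linarith
  have hB1 : 1 ≤ B := by linarith
  have hB0 : 0 < B := by linarith
  have hQ0 : 0 < Q := by linarith
  have hC0 : 0 ≤ C := by positivity
  set ℓ := 1 / (2 * B * Q) with hℓ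
  have hℓ0 : 0 < ℓ := by positivity
  have hBℓ : B * ℓ = 1 / (2 * Q) := by rw [hℓ]; field_simp
  set δ := B * ℓ * Real.exp (-(2 * M * B)) with hδ
  have hδ0 : 0 < δ := by positivity
  have hδℓ : δ ≤ B * ℓ := by
    refine mul_le_of_le_one_right (by positivity) (Real.exp_le_one_iff.2 ?_)
    have : 0 ≤ 2 * M * B := by positivity
    linarith
  have hδΓ : 1 / δ = gradBound M A P d := by
    rw [gradBound, ← hQ, ← hB, hδ, hBℓ, Real.exp_neg]
    field_simp
  have hCd : 4 * C * d = 8 * M / d := by rw [hC]; field_simp; ring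
  have hC4 : 4 * C = 8 * M / d ^ 2 := by rw [hC]; ring
  have key := fun y => h.doubling (B := B) (C := C) (K := K) (δ := δ) (ℓ := ℓ) (y := y) hd hin hB0
    hC0 (by rw [hC, div_mul_cancel₀ _ (by positivity)]) (by rw [hK, div_mul_cancel₀ _ hd.ne'])
    (by positivity) (by
      have : B * A / 4 = A / 4 + K := by rw [hB, hK]; field_simp; ring
      linarith) hδ0 hℓ0 (le_logBarrier hB0 hℓ0) (fun z hz0 hzℓ => by
      have hwQ : Q ≤ 1 / (δ + B * z) := by
        rw [le_div_iff₀ (by positivity)]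
        have h2 : B * z ≤ B * ℓ := by gcongr
        have h3 : Q * (δ + B * z) ≤ Q * (2 * (B * ℓ)) := by gcongr; linarith
        have h4 : Q * (2 * (B * ℓ)) = 1 := by rw [hBℓ]; field_simp
        linarith
      set w := 1 / (δ + B * z)
      have i1 : w ≤ w ^ 2 := by
        rw [sq]
        exact le_mul_of_one_le_left (by linarith) (by linarith)
      have i2 : w ^ 2 ≤ B * w ^ 2 := le_mul_of_one_le_left (by positivity) hB1
      exact ⟨by linarith, by linarith, by linarith⟩)
  obtain ⟨h1, h2, h3⟩ := hin
  obtain ⟨σ, k, ρ, hσ, hρ, E⟩ := h.expansion x t (by linarith) (by linarith) (by linarith)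
  have hder : HasDerivAt (fun y => U y t) (v x t) x := E.hasDerivAt_space hρ (E.nonneg hρ) hσ
  have hf := ((hder.neg.add ((hasDerivAt_id x).const_mul (1 / δ))).sub
    ((((hasDerivAt_id x).sub_const x).pow 2).const_mul C)).nonneg_of_left_max (by
      filter_upwards [Ioo_mem_nhdsLT (show x - min d ℓ < x by linarith [lt_min hd hℓ0])] with y hy
      have m1 := min_le_left d ℓ
      have m2 := min_le_right d ℓ
      have := key y hy.2.le (by linarith [hy.1]) (by linarith [hy.1])
      have i1 := logBarrier_le hB0 hδ0 (by linarith [hy.2] : 0 ≤ x - y)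
      simp only [Pi.add_apply, Pi.sub_apply, Pi.neg_apply, Pi.pow_apply, id]
      have i2 : (x - y) / δ = 1 / δ * x - 1 / δ * y := by ring
      linarith [show C * (x - x) ^ 2 = 0 by ring])
  simp only [id, sub_self] at hf
  norm_num at hf
  rw [one_div] at hδΓ
  linarith

theorem abs_gradient_le (hA : 0 < A) (hP : 0 < P)
    (h : ControlledSolution L M A P N g U b v s) {d x t : ℝ} (hd : 0 < d) (hM : 0 ≤ M)
    (hin : InnerDomain L d x t) : |v x t| ≤ gradBound M A P d :=
  abs_le.2 ⟨by linarith [h.neg.gradient_le hA hP hd hM hin], h.gradient_le hA hP hd hM hin⟩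

end ControlledSolution

/-- Positive, locally Hölder continuous coefficients on `ℝ × ℝ × [0, L] × [0, T]` with
`a p ^ 2 ≥ A` for `|p| ≥ P`. -/
structure AdmissibleCoeff (L T α A P : ℝ) (a : ℝ → ℝ → ℝ → ℝ → ℝ) : Prop where
  pos : ∀ p q x t, 0 ≤ x → x ≤ L → 0 ≤ t → t ≤ T → 0 < a p q x t
  degen : ∀ p q x t, 0 ≤ x → x ≤ L → 0 ≤ t → t ≤ T → P ≤ |p| → A ≤ a p q x t * p ^ 2
  holder : ∀ R, ∃ H, 0 ≤ H ∧ ∀ p q x t p' q' x' t', |p| ≤ R → |q| ≤ R → |p'| ≤ R → |q'| ≤ R →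
    0 ≤ x → x ≤ L → 0 ≤ t → t ≤ T → 0 ≤ x' → x' ≤ L → 0 ≤ t' → t' ≤ T →
    |a p q x t - a p' q' x' t'| ≤ H * (|p - p'| + |q - q'| + |x - x'| + |t - t'|) ^ α

/-- The bounded part of the domain of a coefficient. -/
def coeffBox (L T R : ℝ) : Set (ℝ × ℝ × ℝ × ℝ) :=
  Set.Icc (-R) R ×ˢ Set.Icc (-R) R ×ˢ Set.Icc 0 L ×ˢ Set.Icc 0 T

namespace AdmissibleCoeff

variable {L T α A P : ℝ} {a : ℝ → ℝ → ℝ → ℝ → ℝ}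

theorem continuousOn (h : AdmissibleCoeff L T α A P a) (hα : 0 < α) (R : ℝ) :
    ContinuousOn (fun z : ℝ × ℝ × ℝ × ℝ => a z.1 z.2.1 z.2.2.1 z.2.2.2) (coeffBox L T R) := by
  obtain ⟨H, hH, hh⟩ := h.holder R
  rintro ⟨p, q, x, t⟩ ⟨hp, hq, hx, ht⟩
  rw [ContinuousWithinAt, tendsto_iff_dist_tendsto_zero]
  have hlim : Tendsto (fun z : ℝ × ℝ × ℝ × ℝ =>
      H * (|z.1 - p| + |z.2.1 - q| + |z.2.2.1 - x| + |z.2.2.2 - t|) ^ α)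
      (𝓝[coeffBox L T R] (p, q, x, t)) (𝓝 0) := by
    have h1 : Continuous fun z : ℝ × ℝ × ℝ × ℝ =>
        H * (|z.1 - p| + |z.2.1 - q| + |z.2.2.1 - x| + |z.2.2.2 - t|) ^ α := by
      refine continuous_const.mul (Continuous.rpow_const (by fun_prop) fun _ => Or.inr hα.le)
    exact (h1.tendsto' _ _ (by simp [Real.zero_rpow hα.ne'])).mono_left nhdsWithin_le_nhds
  refine squeeze_zero' (Eventually.of_forall fun _ => dist_nonneg) ?_ hlim
  filter_upwards [self_mem_nhdsWithin] with z hz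
  obtain ⟨hp', hq', hx', ht'⟩ := hz
  rw [Real.dist_eq]
  exact hh _ _ _ _ _ _ _ _ (abs_le.2 hp') (abs_le.2 hq') (abs_le.2 hp) (abs_le.2 hq) hx'.1 hx'.2
    ht'.1 ht'.2 hx.1 hx.2 ht.1 ht.2

theorem exists_bounds (h : AdmissibleCoeff L T α A P a) (hα : 0 < α) (hL : 0 < L) (hT : 0 < T)
    (R : ℝ) : ∃ c C, 0 < c ∧ c ≤ C ∧ ∀ p q x t, |p| ≤ R → |q| ≤ R → 0 ≤ x → x ≤ L → 0 ≤ t → t ≤ T →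
      c ≤ a p q x t ∧ a p q x t ≤ C := by
  have hcomp : IsCompact (coeffBox L T R) :=
    isCompact_Icc.prod (isCompact_Icc.prod (isCompact_Icc.prod isCompact_Icc))
  rcases lt_or_ge R 0 with hR | hR
  · exact ⟨1, 1, one_pos, le_rfl, fun p q x t hp => absurd ((abs_nonneg p).trans hp) (by linarith)⟩
  have hne : (coeffBox L T R).Nonempty :=
    ⟨(0, 0, 0, 0), ⟨by simpa using hR, hR⟩, ⟨by simpa using hR, hR⟩, ⟨le_rfl, hL.le⟩, le_rfl, hT.le⟩
  obtain ⟨z, hz, hmin⟩ := hcomp.exists_isMinOn hne (h.continuousOn hα R)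
  obtain ⟨w, hw, hmax⟩ := hcomp.exists_isMaxOn hne (h.continuousOn hα R)
  refine ⟨_, _, h.pos z.1 z.2.1 z.2.2.1 z.2.2.2 hz.2.2.1.1 hz.2.2.1.2 hz.2.2.2.1 hz.2.2.2.2,
    hmin hw, ?_⟩
  intro p q x t hp hq hx0 hx1 ht0 ht1
  have hmem : ((p, q, x, t) : ℝ × ℝ × ℝ × ℝ) ∈ coeffBox L T R :=
    ⟨abs_le.1 hp, abs_le.1 hq, ⟨hx0, hx1⟩, ht0, ht1⟩
  exact ⟨hmin hmem, hmax hmem⟩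

end AdmissibleCoeff

/-- Truncation of `p` to `[-G, G]`. -/
noncomputable def clip (G p : ℝ) : ℝ := max (-G) (min G p)

section Clip

variable {G p : ℝ}

theorem abs_clip_le (hG : 0 ≤ G) : |clip G p| ≤ G :=
  abs_le.2 ⟨le_max_left _ _, max_le (by linarith) (min_le_left _ _)⟩

theorem clip_of_abs_le (h : |p| ≤ G) : clip G p = p := by
  rw [clip, min_eq_right (abs_le.1 h).2, max_eq_right (abs_le.1 h).1]

theorem abs_clip_of_le (hG : 0 ≤ G) (h : G ≤ |p|) : |clip G p| = G := by
  rcases le_abs.1 h with h1 | h1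
  · rw [clip, min_eq_left h1, max_eq_right (by linarith), abs_of_nonneg hG]
  · rw [clip, min_eq_right (by linarith), max_eq_left (by linarith), abs_neg, abs_of_nonneg hG]

theorem abs_clip_le_abs (hG : 0 ≤ G) : |clip G p| ≤ |p| := by
  rcases le_total |p| G with h | h
  · rw [clip_of_abs_le h]
  · rw [abs_clip_of_le hG h]
    exact h

theorem abs_clip_sub_le (G p G' p' : ℝ) : |clip G p - clip G' p'| ≤ |G - G'| + |p - p'| := by
  refine (abs_max_sub_max_le_max _ _ _ _).trans (max_le ?_ ?_)
  · rw [neg_sub_neg, abs_sub_comm]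
    linarith [abs_nonneg (p - p')]
  · exact (abs_min_sub_min_le_max _ _ _ _).trans (max_le (by linarith [abs_nonneg (p - p')])
      (by linarith [abs_nonneg (G - G')]))

/-- Projection of `x` onto `[0, L]`. -/
noncomputable def proj (L x : ℝ) : ℝ := max 0 (min L x)

theorem proj_mem {L : ℝ} (hL : 0 ≤ L) (x : ℝ) : 0 ≤ proj L x ∧ proj L x ≤ L :=
  ⟨le_max_left _ _, max_le hL (min_le_left _ _)⟩

theorem proj_of_mem {L x : ℝ} (h0 : 0 ≤ x) (h1 : x ≤ L) : proj L x = x := by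
  rw [proj, min_eq_right h1, max_eq_right h0]

theorem abs_proj_sub_le (L x y : ℝ) : |proj L x - proj L y| ≤ |x - y| := by
  refine (abs_max_sub_max_le_max _ _ _ _).trans (max_le (by simp) ?_)
  exact (abs_min_sub_min_le_max _ _ _ _).trans (max_le (by simp) le_rfl)

end Clip

/-- Distance to the parabolic boundary of `[0, L] × [0, ∞)`. -/
noncomputable def boundaryDist (L x t : ℝ) : ℝ := min x (min (L - x) t)

theorem innerDomain_boundaryDist (L x t : ℝ) : InnerDomain L (boundaryDist L x t) x t := by
  refine ⟨min_le_left _ _, ?_, (min_le_right _ _).trans (min_le_right _ _)⟩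
  have : boundaryDist L x t ≤ L - x := (min_le_right _ _).trans (min_le_left _ _)
  linarith

theorem InnerDomain.le_boundaryDist {L δ x t : ℝ} (h : InnerDomain L δ x t) :
    δ ≤ boundaryDist L x t :=
  le_min h.1 (le_min (by linarith [h.2.1]) h.2.2)

theorem abs_boundaryDist_sub_le (L x t x' t' : ℝ) :
    |boundaryDist L x t - boundaryDist L x' t'| ≤ |x - x'| + |t - t'| := by
  have h1 := abs_nonneg (x - x')
  have h2 := abs_nonneg (t - t')
  refine (abs_min_sub_min_le_max _ _ _ _).trans (max_le (by linarith) ?_)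
  refine (abs_min_sub_min_le_max _ _ _ _).trans (max_le ?_ (by linarith))
  rw [sub_sub_sub_cancel_left, abs_sub_comm]
  linarith

section GradBound

variable {M A P : ℝ}

theorem gradBound_anti (hM : 0 ≤ M) (hA : 0 < A) (hP : 0 < P) {d d' : ℝ} (hd : 0 < d)
    (h : d ≤ d') : gradBound M A P d' ≤ gradBound M A P d := by
  have hd' : 0 < d' := hd.trans_le h
  unfold gradBound
  gcongr

theorem le_gradBound (hM : 0 ≤ M) (hA : 0 < A) (hP : 0 < P) {d : ℝ} (hd : 0 < d) :
    P ≤ gradBound M A P d := by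
  unfold gradBound
  have h1 : 0 ≤ 8 * M / d := by positivity
  have h2 : 0 ≤ 8 * M / d ^ 2 := by positivity
  have h3 : 1 ≤ Real.exp (2 * M * (1 + 8 * M / d / A)) := Real.one_le_exp (by positivity)
  have h4 := le_mul_of_one_le_right
    (by positivity : 0 ≤ 2 * (2 * P + 8 * M / d + 8 * M / d ^ 2 + 1)) h3
  linarith

theorem exists_lipschitz_gradBound (M A P : ℝ) {δ : ℝ} (hδ : 0 < δ) (D : ℝ) :
    ∃ Λ, 0 ≤ Λ ∧ ∀ d d', δ ≤ d → d ≤ D → δ ≤ d' → d' ≤ D →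
      |gradBound M A P d - gradBound M A P d'| ≤ Λ * |d - d'| := by
  have hl : LocallyLipschitzOn (Set.Icc δ D) (gradBound M A P) := by
    intro d hd
    have hd0 : d ≠ 0 := (hδ.trans_le hd.1).ne'
    have hc : ContDiffAt ℝ 1 (gradBound M A P) d := by
      unfold gradBound
      have h1 : ContDiffAt ℝ 1 (fun d : ℝ => 8 * M / d) d := contDiffAt_const.div contDiffAt_id hd0
      have h2 : ContDiffAt ℝ 1 (fun d : ℝ => 8 * M / d ^ 2) d :=
        contDiffAt_const.div (contDiffAt_id.pow 2) (pow_ne_zero 2 hd0)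
      exact (contDiffAt_const.mul (((contDiffAt_const.add h1).add h2).add contDiffAt_const)).mul
        (contDiffAt_const.mul (contDiffAt_const.add (h1.div_const A))).exp
    obtain ⟨K, s, hs, hK⟩ := hc.exists_lipschitzOnWith
    exact ⟨K, s, mem_nhdsWithin_of_mem_nhds hs, hK⟩
  obtain ⟨K, hK⟩ := hl.exists_lipschitzOnWith_of_compact isCompact_Icc
  refine ⟨K, K.2, fun d d' h1 h2 h3 h4 => ?_⟩
  have := hK.dist_le_mul d ⟨h1, h2⟩ d' ⟨h3, h4⟩
  rwa [Real.dist_eq, Real.dist_eq] at this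

end GradBound

/-- The level at which the gradient argument is truncated. -/
noncomputable def clipLevel (L M A P : ℝ) (k : ℕ) (x t : ℝ) : ℝ :=
  max P (min (gradBound M A P (boundaryDist L x t)) k)

/-- The coefficient with truncated arguments. -/
noncomputable def clipCoeff (L T M A P : ℝ) (a : ℝ → ℝ → ℝ → ℝ → ℝ) (k : ℕ) (p q x t : ℝ) : ℝ :=
  a (clip (clipLevel L M A P k x t) p) (clip M q) (proj L x) (proj T t)

namespace AdmissibleCoeff

variable {L T α A P M : ℝ} {a : ℝ → ℝ → ℝ → ℝ → ℝ}

theorem clipLevel_pos (hP : 0 < P) (k : ℕ) (x t : ℝ) : 0 < clipLevel L M A P k x t :=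
  hP.trans_le (le_max_left _ _)

theorem clipLevel_le_nat (k : ℕ) (x t : ℝ) : clipLevel L M A P k x t ≤ max P k :=
  max_le_max_left _ (min_le_right _ _)

theorem clipLevel_le (hM : 0 ≤ M) (hA : 0 < A) (hP : 0 < P) {δ x t : ℝ} (hδ : 0 < δ)
    (hin : InnerDomain L δ x t) (k : ℕ) : clipLevel L M A P k x t ≤ gradBound M A P δ :=
  max_le (le_gradBound hM hA hP hδ)
    ((min_le_left _ _).trans (gradBound_anti hM hA hP hδ hin.le_boundaryDist))

theorem le_clipLevel {x t : ℝ} {k : ℕ} (hk : gradBound M A P (boundaryDist L x t) ≤ k) :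
    gradBound M A P (boundaryDist L x t) ≤ clipLevel L M A P k x t := by
  rw [clipLevel, min_eq_left hk]
  exact le_max_right _ _

theorem exists_global_bounds (h : AdmissibleCoeff L T α A P a) (hα : 0 < α) (hL : 0 < L)
    (hT : 0 < T) (hP : 0 < P) (hM : 0 ≤ M) (k : ℕ) : ∃ c C, 0 < c ∧ ∀ p q x t,
      c ≤ clipCoeff L T M A P a k p q x t ∧ clipCoeff L T M A P a k p q x t ≤ C := by
  obtain ⟨c, C, hc, -, hb⟩ := h.exists_bounds hα hL hT (max M (max P k))
  refine ⟨c, C, hc, fun p q x t => ?_⟩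
  exact hb _ _ _ _ ((abs_clip_le (clipLevel_pos hP k x t).le).trans
    ((clipLevel_le_nat k x t).trans (le_max_right _ _)))
    ((abs_clip_le hM).trans (le_max_left _ _)) (proj_mem hL.le x).1 (proj_mem hL.le x).2
    (proj_mem hT.le t).1 (proj_mem hT.le t).2

/-- Truncated coefficients satisfy interior bounds which do not depend on the truncation. -/
theorem exists_coeffBounds (h : AdmissibleCoeff L T α A P a) (hα : 0 < α) (hL : 0 < L)
    (hT : 0 < T) (hA : 0 < A) (hP : 0 < P) (hM : 0 ≤ M) {δ : ℝ} (hδ : 0 < δ) :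
    ∃ c C H, 0 < c ∧ c ≤ C ∧ 0 ≤ H ∧
      ∀ k, CoeffBounds L δ α c C H (clipCoeff L T M A P a k) := by
  set R := max M (gradBound M A P δ) with hR
  obtain ⟨c, C, hc, hcC, hb⟩ := h.exists_bounds hα hL hT R
  obtain ⟨H, hH, hh⟩ := h.holder R
  obtain ⟨Λ, hΛ, hlip⟩ := exists_lipschitz_gradBound M A P hδ L
  have hp : ∀ k p x t, InnerDomain L δ x t → |clip (clipLevel L M A P k x t) p| ≤ R :=
    fun k p x t hin => (abs_clip_le (clipLevel_pos hP k x t).le).trans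
      ((clipLevel_le hM hA hP hδ hin k).trans (le_max_right _ _))
  have hq : ∀ q, |clip M q| ≤ R := fun q => (abs_clip_le hM).trans (le_max_left _ _)
  refine ⟨c, C, H * (1 + Λ) ^ α, hc, hcC, by positivity, fun k => ⟨?_, ?_⟩⟩
  · intro p q x t hin
    exact hb _ _ _ _ (hp k p x t hin) (hq q) (proj_mem hL.le x).1 (proj_mem hL.le x).2
      (proj_mem hT.le t).1 (proj_mem hT.le t).2
  · intro p q x t p' q' x' t' hin hin'
    refine (hh _ _ _ _ _ _ _ _ (hp k p x t hin) (hq q) (hp k p' x' t' hin') (hq q')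
      (proj_mem hL.le x).1 (proj_mem hL.le x).2 (proj_mem hT.le t).1 (proj_mem hT.le t).2
      (proj_mem hL.le x').1 (proj_mem hL.le x').2 (proj_mem hT.le t').1
      (proj_mem hT.le t').2).trans ?_
    rw [mul_assoc, ← Real.mul_rpow (by linarith) (by positivity)]
    refine mul_le_mul_of_nonneg_left (Real.rpow_le_rpow (by positivity) ?_ hα.le) hH
    have hbd : ∀ x t, InnerDomain L δ x t → boundaryDist L x t ≤ L := by
      intro x t hin
      exact (min_le_left _ _).trans (by linarith [hin.2.1])
    have e1 : |clipLevel L M A P k x t - clipLevel L M A P k x' t'|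
        ≤ Λ * (|x - x'| + |t - t'|) := by
      have h0 : 0 ≤ Λ * (|x - x'| + |t - t'|) := by positivity
      refine (abs_max_sub_max_le_max _ _ _ _).trans (max_le (by simpa using h0) ?_)
      refine (abs_min_sub_min_le_max _ _ _ _).trans (max_le ?_ (by simpa using h0))
      exact (hlip _ _ hin.le_boundaryDist (hbd x t hin) hin'.le_boundaryDist
        (hbd x' t' hin')).trans (mul_le_mul_of_nonneg_left (abs_boundaryDist_sub_le _ _ _ _ _) hΛ)
    have e2 := abs_clip_sub_le (clipLevel L M A P k x t) p (clipLevel L M A P k x' t') p'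
    have e3 := abs_clip_sub_le M q M q'
    rw [sub_self, abs_zero, zero_add] at e3
    have e4 := abs_proj_sub_le L x x'
    have e5 := abs_proj_sub_le T t t'
    have e6 : 0 ≤ Λ * (|p - p'| + |q - q'|) := by positivity
    linarith [show (1 + Λ) * (|p - p'| + |q - q'| + |x - x'| + |t - t'|)
      = |p - p'| + |q - q'| + |x - x'| + |t - t'| + Λ * (|x - x'| + |t - t'|)
        + Λ * (|p - p'| + |q - q'|) by ring]

/-- Solutions for all the truncated coefficients are controlled by the same constants. -/
theorem exists_controlled (h : AdmissibleCoeff L T α A P a) (hα : 0 < α) (hL : 0 < L)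
    (hT : 0 < T) (hP : 0 < P) (hM : 0 ≤ M) : ∃ N : ℝ → ℝ,
      ∀ {σ : ℝ} {K ρ : ℝ → ℝ} {g : ℝ → ℝ → ℝ} {k : ℕ} {U v s : ℝ → ℝ → ℝ}, 0 < σ →
      (∀ δ, 0 < δ → 0 < ρ δ) → ExpansionSolution L M σ K ρ (clipCoeff L T M A P a k) g U v s →
      ControlledSolution L M A P N g U
        (fun x t => clipCoeff L T M A P a k (v x t) (U x t) x t) v s := by
  choose c N hc hcN hb using fun R => h.exists_bounds hα hL hT (max M R)
  refine ⟨N, fun {σ K ρ g k U v s} hσ hρ hU => ⟨hU.cont, hU.bound, hU.data, ?_, ?_, ?_, ?_⟩⟩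
  · intro x t h0 h1 ht
    obtain ⟨δ, hδ, hin⟩ := exists_innerDomain h0 h1 ht
    exact ⟨σ, K δ, ρ δ, hσ, hρ δ hδ, hU.expansion δ hδ x t hin⟩
  · intro x t _ _ _
    exact h.pos _ _ _ _ (proj_mem hL.le x).1 (proj_mem hL.le x).2 (proj_mem hT.le t).1
      (proj_mem hT.le t).2
  · intro x t _ _ _ hPv
    have hG := clipLevel_pos (L := L) (M := M) (A := A) hP k x t
    have hPG : P ≤ clipLevel L M A P k x t := le_max_left _ _
    have h1 : P ≤ |clip (clipLevel L M A P k x t) (v x t)| := by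
      rcases le_total |v x t| (clipLevel L M A P k x t) with h2 | h2
      · rwa [clip_of_abs_le h2]
      · rwa [abs_clip_of_le hG.le h2]
    have mL := proj_mem hL.le x
    have mT := proj_mem hT.le t
    refine (h.degen _ (clip M (U x t)) _ _ mL.1 mL.2 mT.1 mT.2 h1).trans ?_
    exact mul_le_mul_of_nonneg_left (sq_le_sq.2 (abs_clip_le_abs hG.le))
      (h.pos _ _ _ _ mL.1 mL.2 mT.1 mT.2).le
  · intro x t p _ _ _ hp
    have mL := proj_mem hL.le x
    have mT := proj_mem hT.le t
    exact (hb p _ _ _ _ (((abs_clip_le_abs (clipLevel_pos hP k x t).le).trans hp).trans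
      (le_max_right _ _)) ((abs_clip_le hM).trans (le_max_left _ _)) mL.1 mL.2 mT.1 mT.2).2

end AdmissibleCoeff

theorem ParabolicExpansion.of_tendsto {l : Filter ℕ} [l.NeBot] {Uₙ : ℕ → ℝ → ℝ → ℝ}
    {U : ℝ → ℝ → ℝ} {aₙ vₙ sₙ : ℕ → ℝ} {σ K ρ₀ a₀ v s x t : ℝ}
    (h : ∀ n, ParabolicExpansion (Uₙ n) σ K ρ₀ (aₙ n) (vₙ n) (sₙ n) x t) (hρ₀ : 0 < ρ₀)
    (hρ1 : ρ₀ ≤ 1)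
    (hU : ∀ y τ, |y - x| ≤ ρ₀ → |τ - t| ≤ ρ₀ → Tendsto (fun n => Uₙ n y τ) l (𝓝 (U y τ)))
    (ha : Tendsto aₙ l (𝓝 a₀)) (hv : Tendsto vₙ l (𝓝 v)) (hs : Tendsto sₙ l (𝓝 s)) :
    ParabolicExpansion U σ K ρ₀ a₀ v s x t := by
  intro ρ h0 h1 y τ hy hτ
  have hsq : ρ ^ 2 ≤ ρ₀ := by
    rw [sq]
    exact (mul_le_of_le_one_left h0.le (h1.trans hρ1)).trans h1
  have h2 := ((hU y τ (hy.trans h1) (hτ.trans hsq)).sub (((hU x t (by simpa using hρ₀.le)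
    (by simpa using hρ₀.le)).add (hv.mul_const (y - x))).add
      (hs.mul ((ha.mul_const (τ - t)).const_add ((y - x) ^ 2 / 2))))).abs
  exact le_of_tendsto h2 (Eventually.of_forall fun n => h n ρ h0 h1 y τ hy hτ)

set_option maxHeartbeats 1000000 in
/-- Solvability of the Dirichlet problem for an admissible coefficient, with interior expansions. -/
theorem AdmissibleCoeff.exists_solution {L T α A P M : ℝ} {a : ℝ → ℝ → ℝ → ℝ → ℝ}
    {g : ℝ → ℝ → ℝ} (h : AdmissibleCoeff L T α A P a) (hα : 0 < α) (hα1 : α ≤ 1) (hL : 0 < L)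
    (hT : 0 < T) (hA : 0 < A) (hP : 0 < P) (hM : 0 ≤ M)
    (hg : Continuous fun z : ℝ × ℝ => g z.1 z.2) (hgM : ∀ x t, |g x t| ≤ M) :
    ∃ (U v s : ℝ → ℝ → ℝ) (K ρ : ℝ → ℝ), (∀ δ, 0 < δ → 0 < ρ δ) ∧
      ExpansionSolution L M (α / (3 + α)) K ρ (fun p q x t => a p q x (proj T t)) g U v s := by
  choose c C H hc hcC hH hB using fun δ : {δ : ℝ // 0 < δ} =>
    h.exists_coeffBounds hα hL hT hA hP hM δ.2
  classical
  obtain ⟨K, ρ, hKρ, hex⟩ := exists_expansionSolution (L := L) (M := M) (α := α)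
    (c := fun δ => if hδ : 0 < δ then c ⟨δ, hδ⟩ else 1)
    (C := fun δ => if hδ : 0 < δ then C ⟨δ, hδ⟩ else 1)
    (H := fun δ => if hδ : 0 < δ then H ⟨δ, hδ⟩ else 1) hL hM hα hα1
    (fun δ hδ => by simp only [hδ, dif_pos]; exact hc _)
    (fun δ hδ => by simp only [hδ, dif_pos]; exact hcC _)
    (fun δ hδ => by simp only [hδ, dif_pos]; exact hH _)
  have hsol : ∀ k : ℕ, ∃ U v s,
      ExpansionSolution L M (α / (3 + α)) K ρ (clipCoeff L T M A P a k) g U v s := by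
    intro k
    obtain ⟨c', C', hc', hb'⟩ := h.exists_global_bounds hα hL hT hP hM k
    exact hex _ g c' C' (fun δ hδ => by simp only [hδ, dif_pos]; exact hB ⟨δ, hδ⟩ k) hc' hb' hg hgM
  choose U v s hU using hsol
  have hσ : 0 < α / (3 + α) := by positivity
  have hρ0 : ∀ δ, 0 < δ → 0 < ρ δ := fun δ hδ => (hKρ δ hδ).2.1
  obtain ⟨N, hN⟩ := h.exists_controlled hα hL hT hP hM
  have hctl := fun k => hN hσ hρ0 (hU k)
  have hUlim : ∀ x t, 0 ≤ x → x ≤ L → 0 ≤ t →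
      Tendsto (fun k => U k x t) (hyperfilter ℕ) (𝓝 (ulim fun k => U k x t)) :=
    fun x t h0 h1 ht => tendsto_ulim (Eventually.of_forall fun k => (hU k).bound x t h0 h1 ht)
  have hcoeff : ∀ δ, 0 < δ → ∀ x t, InnerDomain L δ x t → ∀ k,
      |v k x t| * ρ δ ≤ M + K δ * ρ δ ^ (2 + α / (3 + α)) ∧
      |s k x t| * ρ δ ^ 2 ≤ 4 * (M + K δ * ρ δ ^ (2 + α / (3 + α))) := by
    intro δ hδ x t hin k
    refine ((hU k).expansion δ hδ x t hin).coeff_bound (hρ0 δ hδ) fun y hy => ?_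
    have h1 := abs_le.1 hy
    have h2 := (hKρ δ hδ).2.2.2
    exact (hU k).bound y t (by linarith [hin.1]) (by linarith [hin.2.1]) (by linarith [hin.2.2])
  have hvlim : ∀ x t, 0 < x → x < L → 0 < t →
      Tendsto (fun k => v k x t) (hyperfilter ℕ) (𝓝 (ulim fun k => v k x t)) := by
    intro x t h0 h1 ht
    obtain ⟨δ, hδ, hin⟩ := exists_innerDomain h0 h1 ht
    refine tendsto_ulim (B := (M + K δ * ρ δ ^ (2 + α / (3 + α))) / ρ δ)
      (Eventually.of_forall fun k => ?_)
    rw [le_div_iff₀ (hρ0 δ hδ)]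
    exact (hcoeff δ hδ x t hin k).1
  have hslim : ∀ x t, 0 < x → x < L → 0 < t →
      Tendsto (fun k => s k x t) (hyperfilter ℕ) (𝓝 (ulim fun k => s k x t)) := by
    intro x t h0 h1 ht
    obtain ⟨δ, hδ, hin⟩ := exists_innerDomain h0 h1 ht
    refine tendsto_ulim (B := 4 * (M + K δ * ρ δ ^ (2 + α / (3 + α))) / ρ δ ^ 2)
      (Eventually.of_forall fun k => ?_)
    rw [le_div_iff₀ (pow_pos (hρ0 δ hδ) 2)]
    exact (hcoeff δ hδ x t hin k).2
  have hdata : ∀ x t, 0 ≤ x → x ≤ L → t = 0 ∨ 0 ≤ t ∧ (x = 0 ∨ x = L) →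
      (ulim fun k => U k x t) = g x t := by
    intro x t h0 h1 hb
    have ht : 0 ≤ t := by rcases hb with h2 | h2; exacts [h2.ge, h2.1]
    refine tendsto_nhds_unique (hUlim x t h0 h1 ht) ?_
    simp only [fun k => (hU k).data x t h0 h1 hb]
    exact tendsto_const_nhds
  have hexp : ∀ δ, 0 < δ → ∀ x t, InnerDomain L δ x t →
      ParabolicExpansion (fun x t => ulim fun k => U k x t) (α / (3 + α)) (K δ) (ρ δ)
        (a (ulim fun k => v k x t) (ulim fun k => U k x t) x (proj T t))
        (ulim fun k => v k x t) (ulim fun k => s k x t) x t := by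
    intro δ hδ x t hin
    have hx0 : 0 < x := hδ.trans_le hin.1
    have hxL : x < L := by linarith [hin.2.1]
    have ht0 : 0 < t := hδ.trans_le hin.2.2
    have hρδ := (hKρ δ hδ).2.2.2
    refine ParabolicExpansion.of_tendsto (l := hyperfilter ℕ) (Uₙ := U)
      (fun k => (hU k).expansion δ hδ x t hin) (hρ0 δ hδ) (hKρ δ hδ).2.2.1 ?_ ?_
      (hvlim x t hx0 hxL ht0) (hslim x t hx0 hxL ht0)
    · intro y τ hy hτ
      have h1 := abs_le.1 hy
      have h2 := abs_le.1 hτ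
      exact hUlim y τ (by linarith [hin.1]) (by linarith [hin.2.1]) (by linarith [hin.2.2])
    · set Γ := gradBound M A P (boundaryDist L x t) with hΓ
      have hd : 0 < boundaryDist L x t := hδ.trans_le hin.le_boundaryDist
      have hvΓ : ∀ k, |v k x t| ≤ Γ := fun k =>
        (hctl k).abs_gradient_le hA hP hd hM (innerDomain_boundaryDist L x t)
      have hUM : ∀ k, |U k x t| ≤ M := fun k => (hU k).bound x t hx0.le hxL.le ht0.le
      have hvlim' := hvlim x t hx0 hxL ht0
      have hUlim' := hUlim x t hx0.le hxL.le ht0.le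
      have hmem : ∀ p q, |p| ≤ Γ → |q| ≤ M →
          ((p, q, x, proj T t) : ℝ × ℝ × ℝ × ℝ) ∈ coeffBox L T (max M Γ) := fun p q hp hq =>
        ⟨abs_le.1 (hp.trans (le_max_right _ _)), abs_le.1 (hq.trans (le_max_left _ _)),
          ⟨hx0.le, hxL.le⟩, proj_mem hT.le t⟩
      have hcont := h.continuousOn hα (max M Γ) _ (hmem _ _
        (abs_le_of_tendsto hvlim' (Eventually.of_forall hvΓ))
        (abs_le_of_tendsto hUlim' (Eventually.of_forall hUM)))
      have hlim : Tendsto (fun k => ((v k x t, U k x t, x, proj T t) : ℝ × ℝ × ℝ × ℝ))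
          (hyperfilter ℕ) (𝓝[coeffBox L T (max M Γ)]
            (ulim fun k => v k x t, ulim fun k => U k x t, x, proj T t)) :=
        tendsto_nhdsWithin_of_tendsto_nhds_of_eventually_within _
          (hvlim'.prodMk_nhds (hUlim'.prodMk_nhds (tendsto_const_nhds.prodMk_nhds
            tendsto_const_nhds))) (Eventually.of_forall fun k => hmem _ _ (hvΓ k) (hUM k))
      refine (hcont.tendsto.comp hlim).congr' ?_
      refine eventually_hyperfilter ?_
      obtain ⟨n, hn⟩ := exists_nat_ge Γ
      filter_upwards [eventually_ge_atTop n] with k hk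
      have hkΓ : Γ ≤ k := hn.trans (by exact_mod_cast hk)
      simp only [Function.comp_apply, clipCoeff]
      rw [clip_of_abs_le ((hvΓ k).trans (AdmissibleCoeff.le_clipLevel hkΓ)),
        clip_of_abs_le (hUM k), proj_of_mem hx0.le hxL.le]
  refine ⟨fun x t => ulim fun k => U k x t, fun x t => ulim fun k => v k x t,
    fun x t => ulim fun k => s k x t, K, ρ, hρ0, ?_, ?_, hdata, hexp⟩
  · refine continuousOn_of_boundary ?_ hdata ?_
    · intro x t h0 h1 ht
      obtain ⟨δ, hδ, hin⟩ := exists_innerDomain h0 h1 ht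
      exact (hexp δ hδ x t hin).continuousAt (hρ0 δ hδ) hσ
    · intro y r hy0 hyL hyr ε hε
      obtain ⟨δ, hδ, hmod⟩ := ControlledSolution.exists_boundary_modulus (N := N) hL hA hP hg hgM
        hy0 hyL hyr hε
      refine ⟨δ, hδ, fun x t h0 h1 ht hx ht' => ?_⟩
      exact abs_le_of_tendsto ((hUlim x t h0 h1 ht).sub_const _)
        (Eventually.of_forall fun k => hmod _ _ _ _ (hctl k) x t h0 h1 ht hx ht')
  · exact fun x t h0 h1 ht => abs_le_of_tendsto (hUlim x t h0 h1 ht)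
      (Eventually.of_forall fun k => (hU k).bound x t h0 h1 ht)

theorem InnerDomain.of_near {L δ x t y τ : ℝ} (h : InnerDomain L δ x t) (hy : |y - x| ≤ δ / 2)
    (hτ : |τ - t| ≤ δ / 2) : InnerDomain L (δ / 2) y τ := by
  obtain ⟨h1, h2, h3⟩ := h
  rw [abs_le] at hy hτ
  exact ⟨by linarith, by linarith, by linarith⟩

theorem ExpansionSolution.exists_compare {L M σ : ℝ} {K ρ : ℝ → ℝ} {A : ℝ → ℝ → ℝ → ℝ → ℝ}
    {g U v s : ℝ → ℝ → ℝ} (h : ExpansionSolution L M σ K ρ A g U v s)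
    (hρ : ∀ δ, 0 < δ → 0 < ρ δ) (hσ1 : σ ≤ 1) {x t : ℝ} (h0 : 0 < x) (h1 : x < L) (ht : 0 < t) :
    ∃ C r, 0 < r ∧ ∀ d, 0 < d → d ≤ r → ∀ y τ, |y - x| ≤ d → |τ - t| ≤ d ^ 2 →
      |v y τ - v x t - s x t * (y - x)| ≤ 9 * C * d ^ (1 + σ) ∧
        |s y τ - s x t| ≤ 36 * C * d ^ σ := by
  obtain ⟨δ, hδ, hin⟩ := exists_innerDomain h0 h1 ht
  have hδ2 : 0 < δ / 2 := by positivity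
  have hρδ := hρ _ hδ2
  have he := h.expansion _ hδ2 x t (hin.of_near (by simpa using hδ2.le) (by simpa using hδ2.le))
  refine ⟨K (δ / 2), min 1 (min (δ / 2) (ρ (δ / 2) / 2)), by positivity, ?_⟩
  intro d hd hdr y τ hy hτ
  have hd1 : d ≤ 1 := hdr.trans (min_le_left _ _)
  have hd2 : d ≤ δ / 2 := hdr.trans ((min_le_right _ _).trans (min_le_left _ _))
  have hd3 : d ≤ ρ (δ / 2) / 2 := hdr.trans ((min_le_right _ _).trans (min_le_right _ _))
  have he' := h.expansion _ hδ2 y τ (hin.of_near (hy.trans hd2) (hτ.trans (by nlinarith)))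
  exact ParabolicExpansion.compare (he.nonneg hρδ) hσ1 he he' hd (by linarith) hy hτ

theorem ExpansionSolution.hasDerivAt_gradient {L M σ : ℝ} {K ρ : ℝ → ℝ}
    {A : ℝ → ℝ → ℝ → ℝ → ℝ} {g U v s : ℝ → ℝ → ℝ} (h : ExpansionSolution L M σ K ρ A g U v s)
    (hρ : ∀ δ, 0 < δ → 0 < ρ δ) (hσ : 0 < σ) (hσ1 : σ ≤ 1) {x t : ℝ} (h0 : 0 < x) (h1 : x < L)
    (ht : 0 < t) : HasDerivAt (fun y => v y t) (s x t) x := by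
  obtain ⟨C, r, hr, hC⟩ := h.exists_compare hρ hσ1 h0 h1 ht
  refine hasDerivAt_of_abs_le_rpow hσ hr (K := 9 * C) fun y hy => ?_
  rcases (abs_nonneg (y - x)).eq_or_lt with h2 | h2
  · have h3 : y = x := by linarith [abs_eq_zero.1 h2.symm]
    subst h3
    simp [Real.zero_rpow (by linarith : 1 + σ ≠ 0)]
  · exact (hC _ h2 hy y t le_rfl (by simp [sq_nonneg])).1

/-- The parabolic distance between two points. -/
noncomputable def parabolicDist (x t : ℝ) (z : ℝ × ℝ) : ℝ := |z.1 - x| + √|z.2 - t|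

theorem tendsto_parabolicDist (x t : ℝ) : Tendsto (parabolicDist x t) (𝓝 (x, t)) (𝓝 0) := by
  have h : Continuous (parabolicDist x t) := by unfold parabolicDist; fun_prop
  simpa [parabolicDist] using h.tendsto (x, t)

theorem ExpansionSolution.continuousAt_derivs {L M σ : ℝ} {K ρ : ℝ → ℝ}
    {A : ℝ → ℝ → ℝ → ℝ → ℝ} {g U v s : ℝ → ℝ → ℝ} (h : ExpansionSolution L M σ K ρ A g U v s)
    (hρ : ∀ δ, 0 < δ → 0 < ρ δ) (hσ : 0 < σ) (hσ1 : σ ≤ 1) {x t : ℝ} (h0 : 0 < x) (h1 : x < L)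
    (ht : 0 < t) :
    ContinuousAt (fun z : ℝ × ℝ => v z.1 z.2) (x, t) ∧
      ContinuousAt (fun z : ℝ × ℝ => s z.1 z.2) (x, t) := by
  obtain ⟨C, r, hr, hC⟩ := h.exists_compare hρ hσ1 h0 h1 ht
  have hd := tendsto_parabolicDist x t
  have hev : ∀ᶠ z in 𝓝 (x, t), parabolicDist x t z ≤ r := hd.eventually_le_const hr
  have key : ∀ z : ℝ × ℝ, parabolicDist x t z ≤ r →
      |v z.1 z.2 - v x t - s x t * (z.1 - x)| ≤ 9 * C * parabolicDist x t z ^ (1 + σ) ∧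
        |s z.1 z.2 - s x t| ≤ 36 * C * parabolicDist x t z ^ σ := by
    intro z hz
    have hs0 := Real.sqrt_nonneg |z.2 - t|
    have ha0 := abs_nonneg (z.1 - x)
    have hnn : 0 ≤ parabolicDist x t z := add_nonneg ha0 hs0
    have hsq : |z.2 - t| ≤ parabolicDist x t z ^ 2 := by
      rw [← Real.sqrt_le_left hnn]
      exact le_add_of_nonneg_left ha0
    have hle : |z.1 - x| ≤ parabolicDist x t z := le_add_of_nonneg_right hs0
    rcases hnn.eq_or_lt with h2 | h2
    · rw [← h2] at hsq hle
      have h3 : z.1 = x := by linarith [abs_nonpos_iff.1 hle]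
      have h4 : z.2 = t := by
        rw [zero_pow two_ne_zero] at hsq
        linarith [abs_nonpos_iff.1 hsq]
      rw [h3, h4, ← h2]
      simp [Real.zero_rpow (by linarith : 1 + σ ≠ 0), Real.zero_rpow hσ.ne']
    · exact hC _ h2 hz _ _ hle hsq
  constructor
  · have h3 : Tendsto (fun z : ℝ × ℝ => 9 * C * parabolicDist x t z ^ (1 + σ)) (𝓝 (x, t))
        (𝓝 0) := by
      have := (hd.rpow_const (p := 1 + σ) (Or.inr (by linarith))).const_mul (9 * C)
      simpa [Real.zero_rpow (by linarith : 1 + σ ≠ 0)] using this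
    have h4 := squeeze_zero_norm'
      (f := fun z : ℝ × ℝ => v z.1 z.2 - v x t - s x t * (z.1 - x))
      (hev.mono fun z hz => (key z hz).1) h3
    have h5 : Tendsto (fun z : ℝ × ℝ => v x t + s x t * (z.1 - x)) (𝓝 (x, t))
        (𝓝 (v x t + s x t * (x - x))) :=
      Continuous.tendsto (by fun_prop : Continuous fun z : ℝ × ℝ => v x t + s x t * (z.1 - x)) (x, t)
    have h6 := h4.add h5
    simp only [sub_self, mul_zero, add_zero, zero_add] at h6
    exact h6.congr fun z => by ring
  · have h3 : Tendsto (fun z : ℝ × ℝ => 36 * C * parabolicDist x t z ^ σ) (𝓝 (x, t)) (𝓝 0) := by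
      have := (hd.rpow_const (p := σ) (Or.inr hσ.le)).const_mul (36 * C)
      simpa [Real.zero_rpow hσ.ne'] using this
    have h4 := squeeze_zero_norm' (f := fun z : ℝ × ℝ => s z.1 z.2 - s x t)
      (hev.mono fun z hz => (key z hz).2) h3
    exact tendsto_sub_nhds_zero_iff.1 h4

/-- Extension of continuous data on the parabolic boundary to a bounded continuous function. -/
theorem exists_bounded_extension {s : Set (ℝ × ℝ)} (hs : IsCompact s) {f : ℝ × ℝ → ℝ}
    (hf : ContinuousOn f s) :
    ∃ (G : ℝ × ℝ → ℝ) (M : ℝ), 0 ≤ M ∧ Continuous G ∧ (∀ z, |G z| ≤ M) ∧ ∀ z ∈ s, G z = f z := by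
  obtain ⟨M, hM⟩ := hs.exists_bound_of_continuousOn hf
  have hne : (Set.Icc (-|M|) |M|).Nonempty := ⟨0, by simp⟩
  obtain ⟨G, hG, hGf⟩ := ContinuousMap.exists_restrict_eq_forall_mem_of_closed
    ⟨s.domRestrict f, hf.domRestrict⟩ (t := Set.Icc (-|M|) |M|)
    (fun z => abs_le.1 ((hM z z.2).trans (le_abs_self M))) hne hs.isClosed
  exact ⟨G, |M|, abs_nonneg M, G.continuous, fun z => abs_le.2 (hG z),
    fun z hz => DFunLike.congr_fun hGf ⟨z, hz⟩⟩

/-- Translating the base point of a coefficient on `[x₀, x₁]` to the origin. -/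
theorem admissibleCoeff_translate {x₀ x₁ T α A P : ℝ} {a : ℝ → ℝ → ℝ → ℝ → ℝ} (hα : 0 < α)
    (ha_pos : ∀ p q : ℝ, ∀ x ∈ Set.Icc x₀ x₁, ∀ t ∈ Set.Icc (0:ℝ) T, 0 < a p q x t)
    (ha_holder : ∀ K : Set (ℝ × ℝ × ℝ × ℝ),
      K ⊆ Set.univ ×ˢ Set.univ ×ˢ Set.Icc x₀ x₁ ×ˢ Set.Icc 0 T →
      Bornology.IsBounded K →
      ∃ C : ℝ, 0 < C ∧ ∀ z ∈ K, ∀ z' ∈ K,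
        |a z.1 z.2.1 z.2.2.1 z.2.2.2 - a z'.1 z'.2.1 z'.2.2.1 z'.2.2.2|
          ≤ C * dist z z' ^ α)
    (ha_deg : ∀ p q : ℝ, ∀ x ∈ Set.Icc x₀ x₁, ∀ t ∈ Set.Icc (0:ℝ) T,
      P ≤ |p| → A ≤ a p q x t * p ^ 2) :
    AdmissibleCoeff (x₁ - x₀) T α A P (fun p q x t => a p q (x₀ + x) t) where
  pos p q x t h0 h1 h2 h3 := ha_pos p q _ ⟨by linarith, by linarith⟩ t ⟨h2, h3⟩
  degen p q x t h0 h1 h2 h3 h4 := ha_deg p q _ ⟨by linarith, by linarith⟩ t ⟨h2, h3⟩ h4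
  holder R := by
    obtain ⟨C, hC, hCb⟩ := ha_holder
      (Set.Icc (-R) R ×ˢ Set.Icc (-R) R ×ˢ Set.Icc x₀ x₁ ×ˢ Set.Icc 0 T)
      (Set.prod_mono (Set.subset_univ _) (Set.prod_mono (Set.subset_univ _) le_rfl))
      ((Metric.isBounded_Icc _ _).prod ((Metric.isBounded_Icc _ _).prod
        ((Metric.isBounded_Icc _ _).prod (Metric.isBounded_Icc _ _))))
    refine ⟨C, hC.le, ?_⟩
    intro p q x t p' q' x' t' hp hq hp' hq' h0 h1 h2 h3 h0' h1' h2' h3'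
    refine (hCb (p, q, x₀ + x, t)
      ⟨abs_le.1 hp, abs_le.1 hq, ⟨by linarith, by linarith⟩, h2, h3⟩ (p', q', x₀ + x', t')
      ⟨abs_le.1 hp', abs_le.1 hq', ⟨by linarith, by linarith⟩, h2', h3'⟩).trans ?_
    refine mul_le_mul_of_nonneg_left (Real.rpow_le_rpow dist_nonneg ?_ hα.le) hC.le
    have e1 := abs_nonneg (p - p')
    have e2 := abs_nonneg (q - q')
    have e3 := abs_nonneg (x - x')
    have e4 := abs_nonneg (t - t')
    simp only [Prod.dist_eq, Real.dist_eq, add_sub_add_left_eq_sub]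
    refine max_le ?_ (max_le ?_ (max_le ?_ ?_)) <;> linarith

theorem AdmissibleCoeff.continuousAt_comp {L T α A P : ℝ} {a : ℝ → ℝ → ℝ → ℝ → ℝ}
    (h : AdmissibleCoeff L T α A P a) (hα : 0 < α) {v U : ℝ → ℝ → ℝ} {x t : ℝ} (h0 : 0 < x)
    (h1 : x < L) (ht : 0 < t) (htT : t < T)
    (hv : ContinuousAt (fun z : ℝ × ℝ => v z.1 z.2) (x, t))
    (hU : ContinuousAt (fun z : ℝ × ℝ => U z.1 z.2) (x, t)) :
    ContinuousAt (fun z : ℝ × ℝ => a (v z.1 z.2) (U z.1 z.2) z.1 z.2) (x, t) := by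
  set R := max |v x t| |U x t| + 1 with hR
  have hvR : |v x t| < R := by linarith [le_max_left |v x t| |U x t|]
  have hUR : |U x t| < R := by linarith [le_max_right |v x t| |U x t|]
  have hbox : coeffBox L T R ∈ 𝓝 (v x t, U x t, x, t) := by
    rw [abs_lt] at hvR hUR
    exact prod_mem_nhds (Icc_mem_nhds hvR.1 hvR.2) (prod_mem_nhds (Icc_mem_nhds hUR.1 hUR.2)
      (prod_mem_nhds (Icc_mem_nhds h0 h1) (Icc_mem_nhds ht htT)))
  have hcont := (h.continuousOn hα R).continuousAt hbox
  have hinner : ContinuousAt (fun z : ℝ × ℝ => (v z.1 z.2, U z.1 z.2, z.1, z.2)) (x, t) :=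
    hv.prodMk (hU.prodMk (continuousAt_fst.prodMk continuousAt_snd))
  exact ContinuousAt.comp (f := fun z : ℝ × ℝ => (v z.1 z.2, U z.1 z.2, z.1, z.2))
    (g := fun z : ℝ × ℝ × ℝ × ℝ => a z.1 z.2.1 z.2.2.1 z.2.2.2) hcont hinner

/-- Existence of a classical solution of the Cauchy–Dirichlet
problem for `u_t = a(u_x,u,x,t) u_{xx}` with continuous data on the parabolic
boundary, for a positive, locally Hölder continuous coefficient `a` with the
degeneracy control `a p² ≥ A` for `|p| ≥ P`. -/
theorem existence_continuous_data_one_dim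
    (x₀ x₁ T : ℝ) (hx : x₀ < x₁) (hT : 0 < T)
    (a : ℝ → ℝ → ℝ → ℝ → ℝ)
    (ha_pos : ∀ p q : ℝ, ∀ x ∈ Set.Icc x₀ x₁, ∀ t ∈ Set.Icc (0:ℝ) T, 0 < a p q x t)
    (α : ℝ) (hα : α ∈ Set.Ioo (0:ℝ) 1)
    (ha_holder : ∀ K : Set (ℝ × ℝ × ℝ × ℝ),
      K ⊆ Set.univ ×ˢ Set.univ ×ˢ Set.Icc x₀ x₁ ×ˢ Set.Icc 0 T →
      Bornology.IsBounded K →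
      ∃ C : ℝ, 0 < C ∧ ∀ z ∈ K, ∀ z' ∈ K,
        |a z.1 z.2.1 z.2.2.1 z.2.2.2 - a z'.1 z'.2.1 z'.2.2.1 z'.2.2.2|
          ≤ C * dist z z' ^ α)
    (A P : ℝ) (hA : 0 < A) (hP : 0 < P)
    (ha_deg : ∀ p q : ℝ, ∀ x ∈ Set.Icc x₀ x₁, ∀ t ∈ Set.Icc (0:ℝ) T,
      P ≤ |p| → A ≤ a p q x t * p ^ 2)
    (u₀ : ℝ → ℝ → ℝ)
    (hu₀ : ContinuousOn (fun z : ℝ × ℝ => u₀ z.1 z.2)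
      ((Set.Icc x₀ x₁ ×ˢ ({0} : Set ℝ)) ∪ (({x₀, x₁} : Set ℝ) ×ˢ Set.Icc 0 T))) :
    ∃ u ut ux uxx : ℝ → ℝ → ℝ,
      ContinuousOn (fun z : ℝ × ℝ => u z.1 z.2) (Set.Icc x₀ x₁ ×ˢ Set.Icc 0 T) ∧
      (∀ x ∈ Set.Ioo x₀ x₁, ∀ t ∈ Set.Ioo (0:ℝ) T,
        HasDerivAt (fun s => u x s) (ut x t) t) ∧
      (∀ x ∈ Set.Ioo x₀ x₁, ∀ t ∈ Set.Ioo (0:ℝ) T,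
        HasDerivAt (fun y => u y t) (ux x t) x) ∧
      (∀ x ∈ Set.Ioo x₀ x₁, ∀ t ∈ Set.Ioo (0:ℝ) T,
        HasDerivAt (fun y => ux y t) (uxx x t) x) ∧
      ContinuousOn (fun z : ℝ × ℝ => ut z.1 z.2) (Set.Ioo x₀ x₁ ×ˢ Set.Ioo 0 T) ∧
      ContinuousOn (fun z : ℝ × ℝ => ux z.1 z.2) (Set.Ioo x₀ x₁ ×ˢ Set.Ioo 0 T) ∧
      ContinuousOn (fun z : ℝ × ℝ => uxx z.1 z.2) (Set.Ioo x₀ x₁ ×ˢ Set.Ioo 0 T) ∧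
      (∀ x ∈ Set.Ioo x₀ x₁, ∀ t ∈ Set.Ioo (0:ℝ) T,
        ut x t = a (ux x t) (u x t) x t * uxx x t) ∧
      (∀ x ∈ Set.Icc x₀ x₁, u x 0 = u₀ x 0) ∧
      (∀ t ∈ Set.Icc (0:ℝ) T, u x₀ t = u₀ x₀ t ∧ u x₁ t = u₀ x₁ t) := by

  obtain ⟨hα0, hα1⟩ := hα
  have hL : 0 < x₁ - x₀ := by linarith
  have hadm := admissibleCoeff_translate hα0 ha_pos ha_holder ha_deg
  obtain ⟨G, M, hM, hGc, hGM, hG⟩ := exists_bounded_extension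
    ((isCompact_Icc.prod isCompact_singleton).union
      (((Set.finite_singleton x₁).insert x₀).isCompact.prod isCompact_Icc)) hu₀
  obtain ⟨U, v, s, K, ρ, hρ, hU⟩ := hadm.exists_solution (g := fun x t => G (x₀ + x, t)) hα0 hα1.le
    hL hT hA hP hM (by fun_prop) (fun x t => hGM _)
  have hσ : 0 < α / (3 + α) := by positivity
  have hσ1 : α / (3 + α) ≤ 1 := (div_le_one (by positivity)).2 (by linarith)
  have hexp : ∀ x ∈ Set.Ioo x₀ x₁, ∀ t ∈ Set.Ioo (0:ℝ) T, ∃ C r, 0 < r ∧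
      ParabolicExpansion U (α / (3 + α)) C r
        (a (v (x - x₀) t) (U (x - x₀) t) x t) (v (x - x₀) t) (s (x - x₀) t) (x - x₀) t := by
    intro x hx' t ht
    obtain ⟨δ, hδ, hin⟩ := exists_innerDomain (L := x₁ - x₀) (x := x - x₀) (sub_pos.2 hx'.1)
      (by linarith [hx'.2]) ht.1
    have h := hU.expansion δ hδ _ _ hin
    rw [proj_of_mem ht.1.le ht.2.le, add_sub_cancel] at h
    exact ⟨_, _, hρ δ hδ, h⟩
  have hshift : ∀ z : ℝ × ℝ, ContinuousAt (fun z : ℝ × ℝ => (z.1 - x₀, z.2)) z := fun z => by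
    fun_prop
  have hUc : ∀ z ∈ Set.Ioo x₀ x₁ ×ˢ Set.Ioo (0:ℝ) T,
      ContinuousAt (fun z : ℝ × ℝ => U z.1 z.2) (z.1 - x₀, z.2) := by
    rintro ⟨x, t⟩ ⟨hx', ht⟩
    exact hU.cont.continuousAt (prod_mem_nhds
      (Icc_mem_nhds (sub_pos.2 hx'.1) (by linarith [hx'.2] : x - x₀ < x₁ - x₀)) (Ici_mem_nhds ht.1))
  have hvs := fun (z : ℝ × ℝ) (hz : z ∈ Set.Ioo x₀ x₁ ×ˢ Set.Ioo (0:ℝ) T) =>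
    hU.continuousAt_derivs hρ hσ hσ1 (sub_pos.2 hz.1.1) (sub_lt_sub_right hz.1.2 x₀) hz.2.1
  have hcomp : ∀ {f : ℝ → ℝ → ℝ}, (∀ z ∈ Set.Ioo x₀ x₁ ×ˢ Set.Ioo (0:ℝ) T,
      ContinuousAt (fun z : ℝ × ℝ => f z.1 z.2) (z.1 - x₀, z.2)) →
      ContinuousOn (fun z : ℝ × ℝ => f (z.1 - x₀) z.2) (Set.Ioo x₀ x₁ ×ˢ Set.Ioo 0 T) :=
    fun {f} hf z hz => (ContinuousAt.comp (f := fun z : ℝ × ℝ => (z.1 - x₀, z.2))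
      (g := fun z : ℝ × ℝ => f z.1 z.2) (hf z hz) (hshift z)).continuousWithinAt
  have hsub : ∀ x : ℝ, HasDerivAt (fun y => y - x₀) 1 x := fun x => (hasDerivAt_id x).sub_const x₀
  refine ⟨fun x t => U (x - x₀) t,
    fun x t => a (v (x - x₀) t) (U (x - x₀) t) x t * s (x - x₀) t,
    fun x t => v (x - x₀) t, fun x t => s (x - x₀) t, ?_, ?_, ?_, ?_, ?_,
    hcomp fun z hz => (hvs z hz).1, hcomp fun z hz => (hvs z hz).2, fun _ _ _ _ => rfl, ?_, ?_⟩
  · refine hU.cont.comp (f := fun z : ℝ × ℝ => (z.1 - x₀, z.2)) (by fun_prop) ?_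
    rintro ⟨x, t⟩ ⟨hx', ht⟩
    exact ⟨⟨sub_nonneg.2 hx'.1, sub_le_sub_right hx'.2 x₀⟩, ht.1⟩
  · intro x hx' t ht
    obtain ⟨C, r, hr, h⟩ := hexp x hx' t ht
    exact h.hasDerivAt_time hr hσ
  · intro x hx' t ht
    obtain ⟨C, r, hr, h⟩ := hexp x hx' t ht
    have h' := (h.hasDerivAt_space hr (h.nonneg hr) hσ).comp x (hsub x)
    rwa [mul_one] at h'
  · intro x hx' t ht
    have h' := (hU.hasDerivAt_gradient hρ hσ hσ1 (sub_pos.2 hx'.1) (sub_lt_sub_right hx'.2 x₀)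
      ht.1).comp x (hsub x)
    rwa [mul_one] at h'
  · have h := hcomp (f := fun y t => a (v y t) (U y t) (x₀ + y) t * s y t) fun z hz =>
      (hadm.continuousAt_comp hα0 (sub_pos.2 hz.1.1) (sub_lt_sub_right hz.1.2 x₀) hz.2.1 hz.2.2
        (hvs z hz).1 (hUc z hz)).mul (hvs z hz).2
    simpa only [add_sub_cancel] using h
  · intro x hx'
    have h := hU.data (x - x₀) 0 (sub_nonneg.2 hx'.1) (sub_le_sub_right hx'.2 x₀) (Or.inl rfl)
    rw [add_sub_cancel] at h
    exact h.trans (hG (x, 0) (Or.inl ⟨hx', rfl⟩))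
  · intro t ht
    have h := hU.data (x₀ - x₀) t (by simp) (by simpa using hx.le)
      (Or.inr ⟨ht.1, Or.inl (sub_self x₀)⟩)
    have h' := hU.data (x₁ - x₀) t hL.le le_rfl (Or.inr ⟨ht.1, Or.inr rfl⟩)
    rw [add_sub_cancel] at h h'
    exact ⟨h.trans (hG (x₀, t) (Or.inr ⟨Or.inl rfl, ht⟩)),
      h'.trans (hG (x₁, t) (Or.inr ⟨Or.inr rfl, ht⟩))⟩
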